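/- Let T > 0 and ρ > 0, and let X^ρ be a centered pathwise continuous Gaussian process on [0,T], regarded as a centered Gaussian random vector in H = L²([0,T], dt), with covariance function E X^ρ_s X^ρ_t = ∫_0^{s∧t} (t−r)^{ρ−1/2}(s−r)^{ρ−1/2} dr (the Riemann–Liouville process). Then the minimal quantization errors satisfy e_n(X^ρ) ∼ T^{ρ+1/2} π^{−(ρ+1/2)} (ρ + 1/2)^ρ ((2ρ+1)/(2ρ))^{1/2} Γ(ρ + 1/2) (log n)^{−ρ} as n → ∞. -/

import Mathlib

open MeasureTheory ProbabilityTheory Real Filter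

noncomputable section

/-- Minimal `n`-th `L²` quantization error of an `H`-valued random vector `X` under `P`. -/
def quantErr {Ω H : Type*} [MeasurableSpace Ω] [NormedAddCommGroup H]
    (P : Measure Ω) (X : Ω → H) (n : ℕ) : ℝ :=
  sInf { r : ℝ | ∃ α : Finset H, α.Nonempty ∧ α.card ≤ n ∧
    r = (∫ ω, (⨅ a : α, ‖X ω - (a : H)‖ ^ 2) ∂P) ^ (1/2 : ℝ) }

theorem integrable_gaussianReal_iff {m : ℝ} {v : NNReal} (hv : v ≠ 0) {f : ℝ → ℝ} :
    Integrable f (gaussianReal m v) ↔ Integrable (fun x => gaussianPDFReal m v x * f x) := by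
  rw [gaussianReal_of_var_ne_zero _ hv, integrable_withDensity_iff_integrable_smul'
    (measurable_gaussianPDF m v) (ae_of_all _ fun x => gaussianPDF_lt_top)]
  simp only [toReal_gaussianPDF, smul_eq_mul]

theorem integrable_sq_gaussianReal (v : NNReal) :
    Integrable (fun x : ℝ => x ^ 2) (gaussianReal 0 v) :=
  (memLp_id_gaussianReal (μ := 0) (v := v) 2).integrable_sq

theorem integral_sq_gaussianReal (v : NNReal) :
    ∫ x, x ^ 2 ∂(gaussianReal 0 v) = v := by
  have h := variance_id_gaussianReal (μ := 0) (v := v)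
  rw [variance_eq_integral aemeasurable_id] at h
  simpa using h

theorem integral_sub_sq_gaussianReal (σ a : ℝ) :
    Integrable (fun x : ℝ => (σ * x - a) ^ 2) (gaussianReal 0 1) := by
  have h1 : MemLp (fun x : ℝ => σ * x - a) 2 (gaussianReal 0 1) :=
    ((memLp_id_gaussianReal (μ := 0) (v := 1) 2).const_mul σ).sub (memLp_const a)
  exact h1.integrable_sq

theorem gaussianPDFReal_mul_tilt {σ θ : ℝ} (hσ : 0 < σ) (hθ : 0 < θ) (a x : ℝ) :
    gaussianPDFReal 0 1 x *
      exp (-(σ * x - a) ^ 2 / (2 * θ) - (1 / 2 * log (θ / σ ^ 2) - x ^ 2 / 2)) =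
    gaussianPDFReal (a / σ) (Real.toNNReal (θ / σ ^ 2)) x := by
  have hp : 0 < θ / σ ^ 2 := by positivity
  simp only [gaussianPDFReal, Real.coe_toNNReal _ hp.le, NNReal.coe_one, mul_one, sub_zero]
  have h1 : √(2 * π * (θ / σ ^ 2)) = √(2 * π) * exp (1 / 2 * log (θ / σ ^ 2)) := by
    rw [Real.sqrt_mul (by positivity), one_div, mul_comm (2⁻¹ : ℝ), ← Real.rpow_def_of_pos hp,
      ← one_div, ← Real.sqrt_eq_rpow]
  rw [h1, mul_inv, ← Real.exp_neg, mul_assoc, mul_assoc, ← Real.exp_add, ← Real.exp_add]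
  congr 2
  field_simp
  ring

theorem integral_tilt_eq_one {σ θ : ℝ} (hσ : 0 < σ) (hθ : 0 < θ) (a : ℝ) :
    Integrable (fun x => exp (-(σ * x - a) ^ 2 / (2 * θ) - (1 / 2 * log (θ / σ ^ 2) - x ^ 2 / 2)))
      (gaussianReal 0 1) ∧
    ∫ x, exp (-(σ * x - a) ^ 2 / (2 * θ) - (1 / 2 * log (θ / σ ^ 2) - x ^ 2 / 2))
      ∂(gaussianReal 0 1) = 1 := by
  have hp : Real.toNNReal (θ / σ ^ 2) ≠ 0 := by
    have : 0 < θ / σ ^ 2 := by positivity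
    simpa using this
  constructor
  · rw [integrable_gaussianReal_iff one_ne_zero]
    simp_rw [gaussianPDFReal_mul_tilt hσ hθ]
    exact integrable_gaussianPDFReal _ _
  · rw [integral_gaussianReal_eq_integral_smul one_ne_zero]
    simp_rw [smul_eq_mul, gaussianPDFReal_mul_tilt hσ hθ]
    exact integral_gaussianPDFReal_eq_one _ hp

theorem integral_shift_le_one {σ θ : ℝ} (hθ : 0 < θ) (hσ : σ ^ 2 ≤ θ) (a : ℝ) :
    Integrable (fun x => exp (-(σ * x - a) ^ 2 / (2 * θ) - -(σ ^ 2 * x ^ 2 / (2 * θ))))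
      (gaussianReal 0 1) ∧
    ∫ x, exp (-(σ * x - a) ^ 2 / (2 * θ) - -(σ ^ 2 * x ^ 2 / (2 * θ))) ∂(gaussianReal 0 1) ≤ 1 := by
  have h : ∀ x : ℝ, exp (-(σ * x - a) ^ 2 / (2 * θ) - -(σ ^ 2 * x ^ 2 / (2 * θ))) =
      exp (-a ^ 2 / (2 * θ)) * exp ((σ * a / θ) * x) := by
    intro x
    rw [← Real.exp_add]
    congr 1
    field_simp
    ring
  simp_rw [h]
  constructor
  · exact (integrable_exp_mul_gaussianReal _).const_mul _
  · rw [integral_const_mul]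
    have := congrFun (mgf_fun_id_gaussianReal (μ := 0) (v := 1)) (σ * a / θ)
    simp only [mgf] at this
    rw [this, ← Real.exp_add, Real.exp_le_one_iff]
    have e : -a ^ 2 / (2 * θ) + (0 * (σ * a / θ) + ((1 : NNReal) : ℝ) * (σ * a / θ) ^ 2 / 2) =
        -(a ^ 2 / (2 * θ ^ 2) * (θ - σ ^ 2)) := by
      push_cast
      field_simp
      ring
    rw [e, neg_nonpos]
    exact mul_nonneg (by positivity) (by linarith)

section
variable {ι : Type*} [Fintype ι]

/-- The standard Gaussian measure on `ι → ℝ`. -/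
abbrev stdGauss (ι : Type*) [Fintype ι] : Measure (ι → ℝ) :=
  Measure.pi fun _ : ι => gaussianReal 0 1

theorem integrable_eval_pi {ν : ι → Measure ℝ} [∀ i, IsProbabilityMeasure (ν i)] {f : ℝ → ℝ}
    (i : ι) (hf : Integrable f (ν i)) : Integrable (fun x : ι → ℝ => f (x i)) (Measure.pi ν) :=
  (measurePreserving_eval ν i).integrable_comp_of_integrable hf

theorem integral_eval_pi {ν : ι → Measure ℝ} [∀ i, IsProbabilityMeasure (ν i)] {f : ℝ → ℝ}
    (i : ι) (hf : AEStronglyMeasurable f (ν i)) :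
    ∫ x, f (x i) ∂(Measure.pi ν) = ∫ y, f y ∂(ν i) := by
  have h := measurePreserving_eval ν i
  rw [← h.map_eq] at hf
  rw [← h.map_eq, integral_map h.measurable.aemeasurable hf]

theorem stdGauss_integral_iInf_ge (σ : ι → ℝ) (A : Finset ι) [DecidableEq ι] {θ : ℝ} (hθ : 0 < θ)
    (hA : ∀ j ∈ A, 0 < σ j) (hB : ∀ j ∉ A, σ j ^ 2 ≤ θ)
    {κ : Type*} [Fintype κ] [Nonempty κ] (a : κ → ι → ℝ) :
    ∑ j, (if j ∈ A then θ * (1 + log (σ j ^ 2 / θ)) else σ j ^ 2) - 2 * θ * log (Fintype.card κ) ≤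
      ∫ x, (⨅ c, ∑ j, (σ j * x j - a c j) ^ 2) ∂(stdGauss ι) := by
  set g : ι → ℝ → ℝ := fun j y => if j ∈ A then 1 / 2 * log (θ / σ j ^ 2) - y ^ 2 / 2
    else -(σ j ^ 2 * y ^ 2 / (2 * θ)) with hg
  set m : (ι → ℝ) → ℝ := fun x => ⨅ c, ∑ j, (σ j * x j - a c j) ^ 2 with hm
  set n : ℝ := (Fintype.card κ : ℝ) with hn
  have hn0 : 0 < n := by rw [hn]; exact_mod_cast Fintype.card_pos
  have hint : ∀ c, Integrable (fun x : ι → ℝ => ∑ j, (σ j * x j - a c j) ^ 2) (stdGauss ι) :=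
    fun c => integrable_finsetSum _ fun j _ =>
      integrable_eval_pi (ν := fun _ : ι => gaussianReal 0 1) j
        (integral_sub_sq_gaussianReal (σ j) (a c j))
  have hmle : ∀ x c, m x ≤ ∑ j, (σ j * x j - a c j) ^ 2 := fun x c =>
    ciInf_le (Set.finite_range _).bddBelow c
  have hm0 : ∀ x, 0 ≤ m x := fun x => le_ciInf fun c => Finset.sum_nonneg fun j _ => sq_nonneg _
  have hmm : Measurable m := Measurable.iInf fun c => by fun_prop
  have hmint : Integrable m (stdGauss ι) := by
    refine (hint (Classical.arbitrary κ)).mono' hmm.aestronglyMeasurable (ae_of_all _ fun x => ?_)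
    rw [Real.norm_of_nonneg (hm0 x)]
    exact hmle x _
  have hg1 : ∀ j, Integrable (g j) (gaussianReal 0 1) := by
    intro j
    by_cases hj : j ∈ A
    · simp only [hg, hj, if_true]
      exact (integrable_const _).sub ((integrable_sq_gaussianReal 1).div_const 2)
    · simp only [hg, hj, if_false]
      exact (((integrable_sq_gaussianReal 1).const_mul _).div_const _).neg
  have hgint : Integrable (fun x : ι → ℝ => ∑ j, g j (x j)) (stdGauss ι) :=
    integrable_finsetSum _ fun j _ =>
      integrable_eval_pi (ν := fun _ : ι => gaussianReal 0 1) j (hg1 j)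
  have hgval : ∀ j, ∫ y, g j y ∂(gaussianReal 0 1) =
      -(if j ∈ A then θ * (1 + log (σ j ^ 2 / θ)) else σ j ^ 2) / (2 * θ) := by
    intro j
    have hs := integral_sq_gaussianReal 1
    by_cases hj : j ∈ A
    · simp only [hg, hj, if_true]
      rw [integral_sub (integrable_const _) ((integrable_sq_gaussianReal 1).div_const 2),
        integral_div, hs, integral_const]
      have : log (θ / σ j ^ 2) = - log (σ j ^ 2 / θ) := by rw [← Real.log_inv, inv_div]
      rw [this]
      simp
      field_simp
      ring
    · simp only [hg, hj, if_false]
      rw [integral_neg, integral_div, integral_const_mul, hs]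
      simp
      ring
  set w : κ → ι → ℝ → ℝ := fun c j y => exp (-(σ j * y - a c j) ^ 2 / (2 * θ) - g j y) with hw
  have hwint : ∀ c j, Integrable (w c j) (gaussianReal 0 1) ∧
      ∫ y, w c j y ∂(gaussianReal 0 1) ≤ 1 := by
    intro c j
    by_cases hj : j ∈ A
    · simp only [hw, hg, hj, if_true]
      have := integral_tilt_eq_one (hA j hj) hθ (a c j)
      exact ⟨this.1, this.2.le⟩
    · simp only [hw, hg, hj, if_false]
      exact integral_shift_le_one hθ (hB j hj) (a c j)
  have hprod : ∀ c (x : ι → ℝ), ∏ j, w c j (x j) =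
      exp (-(∑ j, (σ j * x j - a c j) ^ 2) / (2 * θ) - ∑ j, g j (x j)) := by
    intro c x
    rw [hw, ← Real.exp_sum, Finset.sum_sub_distrib, ← Finset.sum_div, Finset.sum_neg_distrib]
  have hpt : ∀ x : ι → ℝ, -m x / (2 * θ) - ∑ j, g j (x j) ≤
      (∑ c, ∏ j, w c j (x j)) / n - 1 + log n := by
    intro x
    obtain ⟨c, hc⟩ := exists_eq_ciInf_of_finite (f := fun c => ∑ j, (σ j * x j - a c j) ^ 2)
    have h1 : exp (-m x / (2 * θ) - ∑ j, g j (x j)) ≤ ∑ c, ∏ j, w c j (x j) := by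
      have : m x = ∑ j, (σ j * x j - a c j) ^ 2 := hc.symm
      rw [this, ← hprod c x]
      exact Finset.single_le_sum (f := fun c => ∏ j, w c j (x j))
        (fun c _ => Finset.prod_nonneg fun j _ => (Real.exp_pos _).le) (Finset.mem_univ c)
    have h2 := Real.log_le_sub_one_of_pos (div_pos (Real.exp_pos
      (-m x / (2 * θ) - ∑ j, g j (x j))) hn0)
    rw [Real.log_div (Real.exp_pos _).ne' hn0.ne', Real.log_exp] at h2
    have h3 := div_le_div_of_nonneg_right h1 hn0.le
    linarith
  have hL : Integrable (fun x => -m x / (2 * θ) - ∑ j, g j (x j)) (stdGauss ι) :=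
    (hmint.neg.div_const _).sub hgint
  have hPi : ∀ c, Integrable (fun x : ι → ℝ => ∏ j, w c j (x j)) (stdGauss ι) := fun c =>
    Integrable.fintype_prod fun j => (hwint c j).1
  have hS : Integrable (fun x : ι → ℝ => (∑ c, ∏ j, w c j (x j)) / n) (stdGauss ι) :=
    (integrable_finsetSum _ fun c _ => hPi c).div_const _
  have hS1 : Integrable (fun x : ι → ℝ => (∑ c, ∏ j, w c j (x j)) / n - 1) (stdGauss ι) :=
    hS.sub (integrable_const 1)
  have hm2 : Integrable (fun x => -m x / (2 * θ)) (stdGauss ι) := hmint.neg.div_const _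
  have hmain := integral_mono hL (hS1.add (integrable_const (log n))) hpt
  have hR : ∫ x : ι → ℝ, ((∑ c, ∏ j, w c j (x j)) / n - 1 + log n) ∂(stdGauss ι) ≤ log n := by
    rw [integral_add hS1 (integrable_const _),
      integral_sub hS (integrable_const 1), integral_div, integral_finsetSum _ fun c _ => hPi c]
    have : ∑ c : κ, ∫ x : ι → ℝ, ∏ j, w c j (x j) ∂(stdGauss ι) ≤ n := by
      calc _ ≤ ∑ c : κ, (1 : ℝ) := by
            refine Finset.sum_le_sum fun c _ => ?_
            rw [integral_fintype_prod_eq_prod]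
            exact Finset.prod_le_one (fun j _ => integral_nonneg fun _ => (Real.exp_pos _).le)
              fun j _ => (hwint c j).2
        _ = n := by simp [hn]
    have h4 : (∑ c : κ, ∫ x : ι → ℝ, ∏ j, w c j (x j) ∂(stdGauss ι)) / n ≤ 1 :=
      (div_le_one hn0).2 this
    simp only [integral_const, probReal_univ, smul_eq_mul, one_mul]
    linarith
  have hLv : ∫ x : ι → ℝ, (-m x / (2 * θ) - ∑ j, g j (x j)) ∂(stdGauss ι) =
      -(∫ x, m x ∂(stdGauss ι)) / (2 * θ) +
      (∑ j, (if j ∈ A then θ * (1 + log (σ j ^ 2 / θ)) else σ j ^ 2)) / (2 * θ) := by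
    rw [integral_sub hm2 hgint, integral_div, integral_neg,
      integral_finsetSum _ fun j _ =>
        integrable_eval_pi (ν := fun _ : ι => gaussianReal 0 1) j (hg1 j)]
    have : ∀ j, ∫ x : ι → ℝ, g j (x j) ∂(stdGauss ι) =
        -(if j ∈ A then θ * (1 + log (σ j ^ 2 / θ)) else σ j ^ 2) / (2 * θ) := fun j => by
      rw [integral_eval_pi (ν := fun _ : ι => gaussianReal 0 1) j (hg1 j).aestronglyMeasurable,
        hgval]
    simp_rw [this, neg_div, Finset.sum_neg_distrib, ← Finset.sum_div]
    ring
  have hfin := (hLv ▸ hmain).trans hR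
  rw [← add_div, div_le_iff₀ (by positivity)] at hfin
  linarith

end

section
variable {ι : Type*} [Fintype ι]

theorem lintegral_pi_prod {E : Type*} [MeasurableSpace E] (ν : ι → Measure E)
    [∀ i, IsProbabilityMeasure (ν i)] {f : ι → E → ENNReal} (hf : ∀ i, Measurable (f i)) :
    ∫⁻ x, ∏ i, f i (x i) ∂(Measure.pi ν) = ∏ i, ∫⁻ y, f i y ∂(ν i) := by
  have hind : iIndepFun (fun i (x : ι → E) => f i (x i)) (Measure.pi ν) :=
    iIndepFun_pi fun i => (hf i).aemeasurable
  have := lintegral_prod_eq_prod_lintegral_of_indepFun Finset.univ _ hind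
    (fun i => (hf i).comp (measurable_pi_apply i))
  rw [this]
  refine Finset.prod_congr rfl fun i _ => ?_
  exact (measurePreserving_eval ν i).lintegral_comp (hf i)
end

/-- Ratio of the density of `N(a, θ)` to that of `N(0, σ²)`, evaluated at `σ y`. -/
def gaussRatio (σ θ y a : ℝ) : ℝ :=
  exp (-(σ * y - a) ^ 2 / (2 * θ) - (1 / 2 * log (θ / σ ^ 2) - y ^ 2 / 2))

theorem measurable_gaussRatio (σ θ : ℝ) :
    Measurable fun p : ℝ × ℝ => gaussRatio σ θ p.1 p.2 := by
  unfold gaussRatio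
  fun_prop

theorem lintegral_gaussianReal_eq {m : ℝ} {v : NNReal} (hv : v ≠ 0) {f : ℝ → ENNReal}
    (hf : Measurable f) :
    ∫⁻ x, f x ∂(gaussianReal m v) = ∫⁻ x, ENNReal.ofReal (gaussianPDFReal m v x) * f x := by
  rw [gaussianReal_of_var_ne_zero _ hv,
    lintegral_withDensity_eq_lintegral_mul _ (measurable_gaussianPDF m v) hf]
  rfl

theorem lintegral_gaussRatio_right {σ θ : ℝ} (hσ : 0 < σ) (hθ : 0 < θ) (h : θ ≤ σ ^ 2) (y : ℝ) :
    ∫⁻ a, ENNReal.ofReal (gaussRatio σ θ y a) ∂(gaussianReal 0 (Real.toNNReal (σ ^ 2 - θ))) =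
      1 := by
  have hmeas : Measurable fun a => ENNReal.ofReal (gaussRatio σ θ y a) :=
    ((measurable_gaussRatio σ θ).comp (measurable_const.prodMk measurable_id)).ennreal_ofReal
  rcases h.eq_or_lt with h | h
  · simp only [h, sub_self, Real.toNNReal_zero, gaussianReal_zero_var]
    rw [lintegral_dirac' _ (by rw [← h]; exact hmeas)]
    unfold gaussRatio
    have : -(σ * y - 0) ^ 2 / (2 * σ ^ 2) - (1 / 2 * log (σ ^ 2 / σ ^ 2) - y ^ 2 / 2) = 0 := by
      rw [div_self (by positivity), Real.log_one]
      field_simp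
      ring
    rw [this]
    simp
  · have hv : 0 < σ ^ 2 - θ := by linarith
    have hv0 : Real.toNNReal (σ ^ 2 - θ) ≠ 0 := by simpa using h
    have hw : 0 < (σ ^ 2 - θ) * θ / σ ^ 2 := by positivity
    have hw0 : Real.toNNReal ((σ ^ 2 - θ) * θ / σ ^ 2) ≠ 0 := by simpa using hw
    rw [lintegral_gaussianReal_eq hv0 hmeas]
    have key : ∀ a, ENNReal.ofReal (gaussianPDFReal 0 (Real.toNNReal (σ ^ 2 - θ)) a) *
        ENNReal.ofReal (gaussRatio σ θ y a) = ENNReal.ofReal (gaussianPDFReal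
          (y * (σ ^ 2 - θ) / σ) (Real.toNNReal ((σ ^ 2 - θ) * θ / σ ^ 2)) a) := by
      intro a
      rw [← ENNReal.ofReal_mul (gaussianPDFReal_nonneg _ _ _)]
      congr 1
      simp only [gaussianPDFReal, Real.coe_toNNReal _ hv.le, Real.coe_toNNReal _ hw.le, gaussRatio]
      have h1 : √(2 * π * ((σ ^ 2 - θ) * θ / σ ^ 2)) =
          √(2 * π * (σ ^ 2 - θ)) * exp (1 / 2 * log (θ / σ ^ 2)) := by
        have hp : 0 < θ / σ ^ 2 := by positivity
        have : 2 * π * ((σ ^ 2 - θ) * θ / σ ^ 2) = 2 * π * (σ ^ 2 - θ) * (θ / σ ^ 2) := by ring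
        rw [this, Real.sqrt_mul (by positivity), one_div, mul_comm (2⁻¹ : ℝ),
          ← Real.rpow_def_of_pos hp, ← one_div, ← Real.sqrt_eq_rpow]
      generalize √(2 * π * (σ ^ 2 - θ)) = q at h1 ⊢
      rw [h1, mul_inv, ← Real.exp_neg, mul_assoc, mul_assoc, ← Real.exp_add, ← Real.exp_add]
      congr 2
      have := hv.ne'
      field_simp
      ring
    simp_rw [key]
    exact lintegral_gaussianPDFReal_eq_one _ hw0

theorem lintegral_gaussRatio_left {σ θ : ℝ} (hσ : 0 < σ) (hθ : 0 < θ) (a : ℝ)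
    {f : ℝ → ENNReal} (hf : Measurable f) :
    ∫⁻ y, ENNReal.ofReal (gaussRatio σ θ y a) * f ((σ * y - a) ^ 2 / θ) ∂(gaussianReal 0 1) =
      ∫⁻ z, f (z ^ 2) ∂(gaussianReal 0 1) := by
  have hp : 0 < θ / σ ^ 2 := by positivity
  have hp0 : Real.toNNReal (θ / σ ^ 2) ≠ 0 := by simpa using hp
  have hmeas : Measurable fun y => ENNReal.ofReal (gaussRatio σ θ y a) :=
    ((measurable_gaussRatio σ θ).comp (measurable_id.prodMk measurable_const)).ennreal_ofReal
  have hf1 : Measurable fun y : ℝ => f ((σ * y - a) ^ 2 / θ) := hf.comp (by fun_prop)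
  have hm2 : Measurable fun y =>
      ENNReal.ofReal (gaussRatio σ θ y a) * f ((σ * y - a) ^ 2 / θ) := hmeas.mul hf1
  rw [lintegral_gaussianReal_eq one_ne_zero hm2]
  have key : ∀ y, ENNReal.ofReal (gaussianPDFReal 0 1 y) *
      (ENNReal.ofReal (gaussRatio σ θ y a) * f ((σ * y - a) ^ 2 / θ)) =
      ENNReal.ofReal (gaussianPDFReal (a / σ) (Real.toNNReal (θ / σ ^ 2)) y) *
        f ((σ * y - a) ^ 2 / θ) := by
    intro y
    rw [← mul_assoc, ← ENNReal.ofReal_mul (gaussianPDFReal_nonneg _ _ _), gaussRatio,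
      gaussianPDFReal_mul_tilt hσ hθ]
  simp_rw [key]
  rw [← lintegral_gaussianReal_eq hp0 hf1]
  have hlaw : (gaussianReal (a / σ) (Real.toNNReal (θ / σ ^ 2))).map
      (fun y => (σ / √θ) * (y - a / σ)) = gaussianReal 0 1 := by
    have h1 : (fun y : ℝ => (σ / √θ) * (y - a / σ)) =
        (fun y => (σ / √θ) * y) ∘ (fun y => y - a / σ) := rfl
    rw [h1, ← Measure.map_map (by fun_prop) (by fun_prop), gaussianReal_map_sub_const,
      gaussianReal_map_const_mul, sub_self, mul_zero]
    congr 1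
    ext
    simp only [NNReal.coe_mul, NNReal.coe_mk, Real.coe_toNNReal _ hp.le, NNReal.coe_one]
    rw [div_pow, Real.sq_sqrt hθ.le]
    field_simp
  have hf2 : Measurable fun z : ℝ => f (z ^ 2) := hf.comp (by fun_prop)
  rw [← hlaw, lintegral_map hf2 (by fun_prop)]
  refine lintegral_congr fun y => ?_
  congr 1
  rw [mul_pow, div_pow, Real.sq_sqrt hθ.le]
  field_simp

theorem lintegral_exp_mul_sq_gaussianReal {s : ℝ} (hs : s < 1 / 2) :
    ∫⁻ x, ENNReal.ofReal (exp (s * x ^ 2)) ∂(gaussianReal 0 1) =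
      ENNReal.ofReal (1 / √(1 - 2 * s)) := by
  have hp : 0 < 1 - 2 * s := by linarith
  have hp0 : Real.toNNReal (1 / (1 - 2 * s)) ≠ 0 := by simpa using hp
  rw [lintegral_gaussianReal_eq one_ne_zero (by fun_prop)]
  have key : ∀ x, ENNReal.ofReal (gaussianPDFReal 0 1 x) * ENNReal.ofReal (exp (s * x ^ 2)) =
      ENNReal.ofReal (1 / √(1 - 2 * s)) *
        ENNReal.ofReal (gaussianPDFReal 0 (Real.toNNReal (1 / (1 - 2 * s))) x) := by
    intro x
    rw [← ENNReal.ofReal_mul (gaussianPDFReal_nonneg _ _ _), ← ENNReal.ofReal_mul (by positivity)]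
    congr 1
    simp only [gaussianPDFReal, Real.coe_toNNReal _ (one_div_pos.2 hp).le, NNReal.coe_one]
    rw [mul_one, Real.sqrt_mul (by positivity) (1 / _), mul_assoc, ← Real.exp_add,
      Real.sqrt_div zero_le_one, Real.sqrt_one]
    have : 0 < √(1 - 2 * s) := Real.sqrt_pos.2 hp
    have e : -(x - 0) ^ 2 / (2 * 1) + s * x ^ 2 = -(x - 0) ^ 2 / (2 * (1 / (1 - 2 * s))) := by
      field_simp
      ring
    rw [e]
    field_simp
  simp_rw [key]
  rw [lintegral_const_mul _ (by fun_prop)]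
  rw [lintegral_gaussianPDFReal_eq_one _ hp0, mul_one]

theorem chernoff_upper {δ : ℝ} (h0 : 0 < δ) (h1 : δ ≤ 1) :
    ∫⁻ x, ENNReal.ofReal (exp (δ / 8 * (x ^ 2 - (1 + δ)))) ∂(gaussianReal 0 1) ≤
      ENNReal.ofReal (exp (-(δ ^ 2 / 16))) := by
  have e : ∀ x : ℝ, ENNReal.ofReal (exp (δ / 8 * (x ^ 2 - (1 + δ)))) =
      ENNReal.ofReal (exp (-(δ / 8 * (1 + δ)))) * ENNReal.ofReal (exp (δ / 8 * x ^ 2)) := by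
    intro x
    rw [← ENNReal.ofReal_mul (Real.exp_pos _).le, ← Real.exp_add]
    ring_nf
  simp_rw [e]
  rw [lintegral_const_mul _ (by fun_prop), lintegral_exp_mul_sq_gaussianReal (by linarith),
    ← ENNReal.ofReal_mul (Real.exp_pos _).le]
  refine ENNReal.ofReal_le_ofReal ?_
  have hp : 0 < 1 - 2 * (δ / 8) := by linarith
  have hq : 1 / √(1 - 2 * (δ / 8)) ≤ exp (δ / 8 + δ ^ 2 / 32) := by
    rw [div_le_iff₀ (Real.sqrt_pos.2 hp)]
    have h2 : exp (-(δ / 8 + δ ^ 2 / 32)) ≤ √(1 - 2 * (δ / 8)) := by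
      refine Real.le_sqrt_of_sq_le ?_
      rw [← Real.exp_nat_mul, ← inv_inv (1 - 2 * (δ / 8)), le_inv_comm₀ (Real.exp_pos _)
        (by positivity), ← Real.exp_neg, inv_eq_one_div, div_le_iff₀ hp]
      have h3 := Real.quadratic_le_exp_of_nonneg (x := δ / 4 + δ ^ 2 / 16) (by positivity)
      have h4 : -((2 : ℕ) * -(δ / 8 + δ ^ 2 / 32)) = δ / 4 + δ ^ 2 / 16 := by push_cast; ring
      rw [h4]
      refine le_trans ?_ (mul_le_mul_of_nonneg_right h3 hp.le)
      nlinarith [mul_nonneg (sq_nonneg δ) (sub_nonneg.2 h1), mul_nonneg (pow_pos h0 3).le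
        (sub_nonneg.2 h1), mul_nonneg (pow_pos h0 4).le (sub_nonneg.2 h1)]
    calc (1 : ℝ) = exp (δ / 8 + δ ^ 2 / 32) * exp (-(δ / 8 + δ ^ 2 / 32)) := by
          rw [← Real.exp_add]; simp
      _ ≤ _ := mul_le_mul_of_nonneg_left h2 (Real.exp_pos _).le
  calc _ ≤ exp (-(δ / 8 * (1 + δ))) * exp (δ / 8 + δ ^ 2 / 32) :=
        mul_le_mul_of_nonneg_left hq (Real.exp_pos _).le
    _ = exp (-(δ / 8 * (1 + δ)) + (δ / 8 + δ ^ 2 / 32)) := (Real.exp_add _ _).symm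
    _ ≤ _ := Real.exp_le_exp.2 (by nlinarith)

theorem chernoff_lower {δ : ℝ} (h0 : 0 < δ) :
    ∫⁻ x, ENNReal.ofReal (exp (-(δ / 8) * (x ^ 2 - (1 - δ)))) ∂(gaussianReal 0 1) ≤
      ENNReal.ofReal (exp (-(δ ^ 2 / 16))) := by
  have e : ∀ x : ℝ, ENNReal.ofReal (exp (-(δ / 8) * (x ^ 2 - (1 - δ)))) =
      ENNReal.ofReal (exp (δ / 8 * (1 - δ))) * ENNReal.ofReal (exp (-(δ / 8) * x ^ 2)) := by
    intro x
    rw [← ENNReal.ofReal_mul (Real.exp_pos _).le, ← Real.exp_add]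
    ring_nf
  simp_rw [e]
  rw [lintegral_const_mul _ (by fun_prop), lintegral_exp_mul_sq_gaussianReal (by linarith),
    ← ENNReal.ofReal_mul (Real.exp_pos _).le]
  refine ENNReal.ofReal_le_ofReal ?_
  have hp : 0 < 1 - 2 * (-(δ / 8)) := by linarith
  have hq : 1 / √(1 - 2 * (-(δ / 8))) ≤ exp (-(δ / 8) + δ ^ 2 / 32) := by
    rw [div_le_iff₀ (Real.sqrt_pos.2 hp)]
    have h2 : exp (-(-(δ / 8) + δ ^ 2 / 32)) ≤ √(1 - 2 * (-(δ / 8))) := by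
      refine Real.le_sqrt_of_sq_le ?_
      rw [← Real.exp_nat_mul, ← inv_inv (1 - 2 * (-(δ / 8))), le_inv_comm₀ (Real.exp_pos _)
        (by positivity), ← Real.exp_neg, inv_eq_one_div, div_le_iff₀ hp]
      have h3 := Real.add_one_le_exp (-(δ / 4) + δ ^ 2 / 16)
      have h4 : -((2 : ℕ) * -(-(δ / 8) + δ ^ 2 / 32)) = -(δ / 4) + δ ^ 2 / 16 := by push_cast; ring
      rw [h4]
      refine le_trans ?_ (mul_le_mul_of_nonneg_right h3 hp.le)
      nlinarith [pow_pos h0 3]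
    calc (1 : ℝ) = exp (-(δ / 8) + δ ^ 2 / 32) * exp (-(-(δ / 8) + δ ^ 2 / 32)) := by
          rw [← Real.exp_add]; simp
      _ ≤ _ := mul_le_mul_of_nonneg_left h2 (Real.exp_pos _).le
  calc _ ≤ exp (δ / 8 * (1 - δ)) * exp (-(δ / 8) + δ ^ 2 / 32) :=
        mul_le_mul_of_nonneg_left hq (Real.exp_pos _).le
    _ = exp (δ / 8 * (1 - δ) + (-(δ / 8) + δ ^ 2 / 32)) := (Real.exp_add _ _).symm
    _ ≤ _ := Real.exp_le_exp.2 (by nlinarith)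

theorem pow_le_add_exp_neg {p b u : ℝ} (n : ℕ) (hp0 : 0 ≤ p) (hp1 : p ≤ 1) (hb : 0 ≤ b)
    (hu1 : u ≤ 1) (h : u * (1 - b) ≤ 1 - p) :
    p ^ n ≤ b + exp (-(n * u)) := by
  rcases le_or_gt 1 b with hb1 | hb1
  · have := pow_le_one₀ (n := n) hp0 hp1
    have := Real.exp_pos (-(n * u))
    linarith
  have h1 : p ≤ b * 1 + (1 - b) * (1 - u) := by linarith
  have h2 : p ^ n ≤ (b * 1 + (1 - b) * (1 - u)) ^ n := pow_le_pow_left₀ hp0 h1 n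
  have h3 := (convexOn_pow n).2 (x := (1 : ℝ)) (y := 1 - u) (by simp) (by simpa using hu1)
    hb (by linarith : 0 ≤ 1 - b) (by ring)
  simp only [smul_eq_mul, one_pow, mul_one] at h3 h2
  have h4 : (1 - u) ^ n ≤ exp (-(n * u)) := by
    have h5 : (1 - u) ≤ exp (-u) := by linarith [Real.add_one_le_exp (-u)]
    calc (1 - u) ^ n ≤ exp (-u) ^ n := pow_le_pow_left₀ (by linarith) h5 n
      _ = exp (-(n * u)) := by rw [← Real.exp_nat_mul]; ring_nf
  have h6 : (1 - b) * (1 - u) ^ n ≤ exp (-(n * u)) := by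
    have := pow_nonneg (by linarith : 0 ≤ 1 - u) n
    nlinarith
  linarith

theorem lintegral_lintegral_add {α β : Type*} [MeasurableSpace α] [MeasurableSpace β]
    {μ : Measure α} {ν : Measure β} [SFinite ν] {f g : α → β → ENNReal}
    (hf : Measurable fun p : α × β => f p.1 p.2) :
    ∫⁻ x, ∫⁻ y, f x y + g x y ∂ν ∂μ = ∫⁻ x, ∫⁻ y, f x y ∂ν ∂μ + ∫⁻ x, ∫⁻ y, g x y ∂ν ∂μ := by
  have h1 : Measurable fun x => ∫⁻ y, f x y ∂ν := hf.lintegral_prod_right'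
  rw [← lintegral_add_left h1]
  refine lintegral_congr fun x => lintegral_add_left ?_ _
  exact hf.comp (measurable_const.prodMk measurable_id)

section RandomCoding

variable {ι : Type*} [Fintype ι]

/-- The optimal reproduction law in the reverse water-filling scheme. -/
abbrev reproLaw (σ : ι → ℝ) (θ : ℝ) : Measure (ι → ℝ) :=
  Measure.pi fun j => gaussianReal 0 (Real.toNNReal (σ j ^ 2 - θ))

/-- The likelihood ratio of the optimal test channel. -/
def channelRatio (σ : ι → ℝ) (θ : ℝ) (x a : ι → ℝ) : ENNReal :=
  ∏ j, ENNReal.ofReal (gaussRatio (σ j) θ (x j) (a j))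

/-- Chernoff weight for the exceptional event of the random coding argument. -/
def chernoffWeight (σ : ι → ℝ) (θ δ : ℝ) (x a : ι → ℝ) : ENNReal :=
  (∏ j, ENNReal.ofReal (exp (δ / 8 * ((x j) ^ 2 - (1 + δ))))) +
  (∏ j, ENNReal.ofReal (exp (δ / 8 * ((σ j * x j - a j) ^ 2 / θ - (1 + δ))))) +
  (∏ j, ENNReal.ofReal (exp (-(δ / 8) * ((σ j * x j - a j) ^ 2 / θ - (1 - δ)))))

theorem prod_ofReal_exp (f : ι → ℝ) :
    ∏ j, ENNReal.ofReal (exp (f j)) = ENNReal.ofReal (exp (∑ j, f j)) := by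
  rw [← ENNReal.ofReal_prod_of_nonneg fun _ _ => (Real.exp_pos _).le, Real.exp_sum]

theorem one_le_prod_ofReal_exp {f : ι → ℝ} (h : 0 ≤ ∑ j, f j) :
    1 ≤ ∏ j, ENNReal.ofReal (exp (f j)) := by
  rw [prod_ofReal_exp, ENNReal.one_le_ofReal]
  exact Real.one_le_exp h

theorem channelRatio_le {σ : ι → ℝ} {θ δ : ℝ} (hσ : ∀ j, 0 < σ j) (hθ : 0 < θ) (hδ : 0 < δ)
    (x a : ι → ℝ) :
    channelRatio σ θ x a ≤
      ENNReal.ofReal (exp (∑ j, 1 / 2 * log (σ j ^ 2 / θ) + δ * Fintype.card ι)) *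
        (if ∑ j, (σ j * x j - a j) ^ 2 ≤ (1 + δ) * θ * Fintype.card ι then 1 else 0) +
      channelRatio σ θ x a * chernoffWeight σ θ δ x a := by
  have hcard : ∀ c : ℝ, ∑ _j : ι, c = c * Fintype.card ι := fun c => by
    rw [Finset.sum_const, Finset.card_univ, nsmul_eq_mul, mul_comm]
  by_cases hw : 1 ≤ chernoffWeight σ θ δ x a
  · exact le_add_left (le_mul_of_one_le_right' hw)
  have hW : ∑ j, (σ j * x j - a j) ^ 2 / θ = (∑ j, (σ j * x j - a j) ^ 2) / θ := by
    rw [Finset.sum_div]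
  have h1 : ∑ j, (δ / 8 * ((x j) ^ 2 - (1 + δ))) < 0 := by
    by_contra hc
    exact hw ((one_le_prod_ofReal_exp (not_lt.1 hc)).trans
      (le_add_right (le_add_right le_rfl)))
  have h2 : ∑ j, (δ / 8 * ((σ j * x j - a j) ^ 2 / θ - (1 + δ))) < 0 := by
    by_contra hc
    exact hw ((one_le_prod_ofReal_exp (not_lt.1 hc)).trans
      (le_add_right (le_add_left le_rfl)))
  have h3 : ∑ j, (-(δ / 8) * ((σ j * x j - a j) ^ 2 / θ - (1 - δ))) < 0 := by
    by_contra hc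
    exact hw ((one_le_prod_ofReal_exp (not_lt.1 hc)).trans (le_add_left le_rfl))
  rw [← Finset.mul_sum, Finset.sum_sub_distrib, hcard] at h1 h2 h3
  have h1' : ∑ j, (x j) ^ 2 - (1 + δ) * Fintype.card ι < 0 := by nlinarith
  have h2' : ∑ j, (σ j * x j - a j) ^ 2 / θ - (1 + δ) * Fintype.card ι < 0 := by nlinarith
  have h3' : 0 < ∑ j, (σ j * x j - a j) ^ 2 / θ - (1 - δ) * Fintype.card ι := by nlinarith
  have hgood : ∑ j, (σ j * x j - a j) ^ 2 ≤ (1 + δ) * θ * Fintype.card ι := by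
    have h4 : (∑ j, (σ j * x j - a j) ^ 2) / θ ≤ (1 + δ) * Fintype.card ι := by
      rw [← hW]; linarith
    rw [div_le_iff₀ hθ] at h4
    linarith
  rw [if_pos hgood, mul_one]
  refine le_add_right ?_
  unfold channelRatio gaussRatio
  rw [prod_ofReal_exp]
  refine ENNReal.ofReal_le_ofReal (Real.exp_le_exp.2 ?_)
  have h5 : ∀ j, -(σ j * x j - a j) ^ 2 / (2 * θ) - (1 / 2 * log (θ / σ j ^ 2) - x j ^ 2 / 2) =
      1 / 2 * log (σ j ^ 2 / θ) + 1 / 2 * x j ^ 2 - 1 / 2 * ((σ j * x j - a j) ^ 2 / θ) := by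
    intro j
    have := hσ j
    rw [Real.log_div hθ.ne' (by positivity), Real.log_div (by positivity) hθ.ne']
    field_simp
    ring
  simp_rw [h5]
  rw [Finset.sum_sub_distrib, Finset.sum_add_distrib,
    ← Finset.mul_sum Finset.univ (fun j => x j ^ 2),
    ← Finset.mul_sum Finset.univ (fun j => (σ j * x j - a j) ^ 2 / θ)]
  linarith

theorem measurable_channelRatio (σ : ι → ℝ) (θ : ℝ) :
    Measurable fun p : (ι → ℝ) × (ι → ℝ) => channelRatio σ θ p.1 p.2 := by
  unfold channelRatio gaussRatio
  fun_prop

theorem measurable_channelRatio_right (σ : ι → ℝ) (θ : ℝ) (x : ι → ℝ) :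
    Measurable fun a => channelRatio σ θ x a := by
  unfold channelRatio gaussRatio
  fun_prop

theorem measurable_chernoffWeight (σ : ι → ℝ) (θ δ : ℝ) :
    Measurable fun p : (ι → ℝ) × (ι → ℝ) => chernoffWeight σ θ δ p.1 p.2 := by
  unfold chernoffWeight
  fun_prop

theorem lintegral_channelRatio {σ : ι → ℝ} {θ : ℝ} (hσ : ∀ j, 0 < σ j) (hθ : 0 < θ)
    (h : ∀ j, θ ≤ σ j ^ 2) (x : ι → ℝ) : ∫⁻ a, channelRatio σ θ x a ∂(reproLaw σ θ) = 1 := by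
  unfold channelRatio
  have hm : ∀ j, Measurable fun a => ENNReal.ofReal (gaussRatio (σ j) θ (x j) a) := by
    intro j
    unfold gaussRatio
    fun_prop
  rw [lintegral_pi_prod _ hm]
  exact Finset.prod_eq_one fun j _ => lintegral_gaussRatio_right (hσ j) hθ (h j) _

theorem prod_exp_neg_const (c : ℝ) :
    ∏ _j : ι, ENNReal.ofReal (exp (-c)) = ENNReal.ofReal (exp (-(c * Fintype.card ι))) := by
  rw [prod_ofReal_exp, Finset.sum_const, Finset.card_univ, nsmul_eq_mul]
  ring_nf

theorem lintegral_channelRatio_mul_prod_le {σ : ι → ℝ} {θ c : ℝ} (hσ : ∀ j, 0 < σ j) (hθ : 0 < θ)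
    {f : ℝ → ENNReal} (hf : Measurable f)
    (hc : ∫⁻ z, f (z ^ 2) ∂(gaussianReal 0 1) ≤ ENNReal.ofReal (exp (-c))) :
    ∫⁻ x, ∫⁻ a, channelRatio σ θ x a * ∏ j, f ((σ j * x j - a j) ^ 2 / θ) ∂(reproLaw σ θ)
      ∂(stdGauss ι) ≤ ENNReal.ofReal (exp (-(c * Fintype.card ι))) := by
  have hm : Measurable fun p : (ι → ℝ) × (ι → ℝ) => channelRatio σ θ p.1 p.2 *
      ∏ j, f ((σ j * p.1 j - p.2 j) ^ 2 / θ) :=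
    (measurable_channelRatio σ θ).mul
      (Finset.measurable_fun_prod _ fun j _ => hf.comp (by fun_prop))
  rw [lintegral_lintegral_swap hm.aemeasurable]
  refine (lintegral_mono (g := fun _ => ENNReal.ofReal (exp (-(c * Fintype.card ι))))
    fun a => ?_).trans ?_
  · simp only [channelRatio, ← Finset.prod_mul_distrib]
    have hm : ∀ j, Measurable fun y => ENNReal.ofReal (gaussRatio (σ j) θ y (a j)) *
        f ((σ j * y - a j) ^ 2 / θ) := by
      intro j
      refine Measurable.mul ?_ (hf.comp (by fun_prop))
      unfold gaussRatio
      fun_prop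
    rw [lintegral_pi_prod _ hm, ← prod_exp_neg_const]
    refine Finset.prod_le_prod' fun j _ => ?_
    rw [lintegral_gaussRatio_left (hσ j) hθ _ hf]
    exact hc
  · rw [lintegral_const, measure_univ, mul_one]

theorem lintegral_channelRatio_mul_chernoffWeight_le {σ : ι → ℝ} {θ δ : ℝ} (hσ : ∀ j, 0 < σ j)
    (hθ : 0 < θ) (h : ∀ j, θ ≤ σ j ^ 2) (hδ : 0 < δ) (hδ1 : δ ≤ 1) :
    ∫⁻ x, ∫⁻ a, channelRatio σ θ x a * chernoffWeight σ θ δ x a ∂(reproLaw σ θ) ∂(stdGauss ι) ≤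
      3 * ENNReal.ofReal (exp (-(δ ^ 2 / 16 * Fintype.card ι))) := by
  have h2 := lintegral_channelRatio_mul_prod_le (c := δ ^ 2 / 16) hσ hθ
    (f := fun u => ENNReal.ofReal (exp (δ / 8 * (u - (1 + δ))))) (by fun_prop)
    (chernoff_upper hδ hδ1)
  have h3 := lintegral_channelRatio_mul_prod_le (c := δ ^ 2 / 16) hσ hθ
    (f := fun u => ENNReal.ofReal (exp (-(δ / 8) * (u - (1 - δ))))) (by fun_prop)
    (chernoff_lower hδ)
  have h1 : ∫⁻ x, ∫⁻ a, channelRatio σ θ x a *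
      ∏ j, ENNReal.ofReal (exp (δ / 8 * ((x j) ^ 2 - (1 + δ)))) ∂(reproLaw σ θ) ∂(stdGauss ι) ≤
      ENNReal.ofReal (exp (-(δ ^ 2 / 16 * Fintype.card ι))) := by
    have e : ∀ (x : ι → ℝ) (c : ENNReal),
        ∫⁻ a, channelRatio σ θ x a * c ∂(reproLaw σ θ) = c := by
      intro x c
      rw [lintegral_mul_const _ (measurable_channelRatio_right σ θ x),
        lintegral_channelRatio hσ hθ h, one_mul]
    simp_rw [e]
    have hp := lintegral_pi_prod (fun _ : ι => gaussianReal 0 1)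
      (f := fun _ y => ENNReal.ofReal (exp (δ / 8 * (y ^ 2 - (1 + δ))))) (fun _ => by fun_prop)
    refine hp.trans_le ?_
    rw [← prod_exp_neg_const]
    exact Finset.prod_le_prod' fun _ _ => chernoff_upper hδ hδ1
  simp only [chernoffWeight, mul_add]
  have m1 : Measurable fun p : (ι → ℝ) × (ι → ℝ) => channelRatio σ θ p.1 p.2 *
      ∏ j, ENNReal.ofReal (exp (δ / 8 * ((p.1 j) ^ 2 - (1 + δ)))) :=
    (measurable_channelRatio σ θ).mul (by fun_prop)
  have m2 : Measurable fun p : (ι → ℝ) × (ι → ℝ) => channelRatio σ θ p.1 p.2 *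
      ∏ j, ENNReal.ofReal (exp (δ / 8 * ((σ j * p.1 j - p.2 j) ^ 2 / θ - (1 + δ)))) :=
    (measurable_channelRatio σ θ).mul (by fun_prop)
  rw [lintegral_lintegral_add (m1.add m2), lintegral_lintegral_add m1]
  refine (add_le_add (add_le_add h1 h2) h3).trans_eq ?_
  ring

end RandomCoding

section RandomCoding

variable {ι : Type*} [Fintype ι]

theorem reproLaw_miss_pow_le {σ : ι → ℝ} {θ δ : ℝ} (hσ : ∀ j, 0 < σ j) (hθ : 0 < θ)
    (h : ∀ j, θ ≤ σ j ^ 2) (hδ : 0 < δ) {n : ℕ}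
    (hn : exp (∑ j, 1 / 2 * log (σ j ^ 2 / θ) + 2 * δ * Fintype.card ι) ≤ n) (x : ι → ℝ) :
    (reproLaw σ θ {a | (1 + δ) * θ * Fintype.card ι < ∑ j, (σ j * x j - a j) ^ 2}) ^ n ≤
      min 1 (∫⁻ a, channelRatio σ θ x a * chernoffWeight σ θ δ x a ∂(reproLaw σ θ)) +
        ENNReal.ofReal (exp (-(δ * Fintype.card ι))) := by
  set b := ∫⁻ a, channelRatio σ θ x a * chernoffWeight σ θ δ x a ∂(reproLaw σ θ) with hb
  set B := {a : ι → ℝ | (1 + δ) * θ * Fintype.card ι < ∑ j, (σ j * x j - a j) ^ 2} with hB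
  set K := ∑ j, 1 / 2 * log (σ j ^ 2 / θ) + δ * Fintype.card ι with hK
  have hBm : MeasurableSet B := measurableSet_lt (by fun_prop) (by fun_prop)
  have hK0 : 0 ≤ K := by
    refine add_nonneg (Finset.sum_nonneg fun j _ => mul_nonneg (by norm_num) ?_) (by positivity)
    exact Real.log_nonneg ((one_le_div hθ).2 (h j))
  have hp1 : reproLaw σ θ B ≤ 1 := prob_le_one
  rcases le_or_gt 1 b with h1 | h1
  · rw [min_eq_left h1]
    exact le_add_right (pow_le_one₀ zero_le hp1)
  rw [min_eq_right h1.le]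
  have hcomp : (reproLaw σ θ B).toReal + (reproLaw σ θ Bᶜ).toReal = 1 :=
    probReal_add_probReal_compl hBm
  have hmain : (1 : ENNReal) ≤ ENNReal.ofReal (exp K) * reproLaw σ θ Bᶜ + b := by
    rw [← lintegral_channelRatio hσ hθ h x, hb,
      ← lintegral_indicator_one hBm.compl, ← lintegral_const_mul _ (by
        exact measurable_one.indicator hBm.compl), ← lintegral_add_left (by
        exact (measurable_one.indicator hBm.compl).const_mul _)]
    refine lintegral_mono fun a => (channelRatio_le hσ hθ hδ x a).trans_eq ?_
    congr 2
    simp only [Set.indicator, hB, Set.mem_compl_iff, Set.mem_ofPred_eq, not_lt, Pi.one_apply]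
  have hreal : 1 ≤ exp K * (reproLaw σ θ Bᶜ).toReal + b.toReal := by
    have h2 := ENNReal.toReal_mono (by
      exact ENNReal.add_ne_top.2 ⟨ENNReal.mul_ne_top ENNReal.ofReal_ne_top (measure_ne_top _ _),
        h1.ne_top⟩) hmain
    rwa [ENNReal.toReal_one, ENNReal.toReal_add (ENNReal.mul_ne_top ENNReal.ofReal_ne_top
      (measure_ne_top _ _)) h1.ne_top, ENNReal.toReal_mul,
      ENNReal.toReal_ofReal (Real.exp_pos _).le] at h2
  have hpow := pow_le_add_exp_neg (p := (reproLaw σ θ B).toReal) (b := b.toReal) (u := exp (-K)) n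
    ENNReal.toReal_nonneg (by linarith [ENNReal.toReal_nonneg (a := reproLaw σ θ Bᶜ)])
    ENNReal.toReal_nonneg (Real.exp_le_one_iff.2 (by linarith)) (by
      have e1 : exp (-K) * exp K = 1 := by rw [← Real.exp_add]; simp
      have := Real.exp_pos (-K)
      have h3 : exp (-K) * (1 - b.toReal) ≤ exp (-K) * (exp K * (reproLaw σ θ Bᶜ).toReal) :=
        mul_le_mul_of_nonneg_left (by linarith) this.le
      rw [← mul_assoc, e1] at h3
      linarith)
  have hnu : δ * Fintype.card ι ≤ n * exp (-K) := by
    calc δ * Fintype.card ι ≤ exp (δ * Fintype.card ι) := by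
          linarith [Real.add_one_le_exp (δ * Fintype.card ι)]
      _ = exp (∑ j, 1 / 2 * log (σ j ^ 2 / θ) + 2 * δ * Fintype.card ι) * exp (-K) := by
          rw [← Real.exp_add]; congr 1; rw [hK]; ring
      _ ≤ _ := mul_le_mul_of_nonneg_right hn (Real.exp_pos _).le
  have hpow2 : (reproLaw σ θ B).toReal ^ n ≤ b.toReal + exp (-(δ * Fintype.card ι)) :=
    hpow.trans (by gcongr)
  have h4 := ENNReal.ofReal_le_ofReal hpow2
  rwa [ENNReal.ofReal_add ENNReal.toReal_nonneg (Real.exp_pos _).le, ENNReal.ofReal_toReal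
    h1.ne_top, ← ENNReal.toReal_pow, ENNReal.ofReal_toReal
      (ENNReal.pow_ne_top (measure_ne_top _ _))] at h4

theorem ofReal_mul_min_le {S t : ℝ} (hS : 0 ≤ S) (ht : 0 < t) (b : ENNReal) :
    ENNReal.ofReal S * min 1 b ≤ ENNReal.ofReal (t * S ^ 2) + ENNReal.ofReal (1 / t) * b := by
  have hm : min 1 b ≠ ⊤ := (lt_of_le_of_lt (min_le_left _ _) ENNReal.one_lt_top).ne
  have hle : (min 1 b).toReal ≤ 1 := ENNReal.toReal_le_of_le_ofReal zero_le_one (by simp)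
  refine le_trans ?_ (add_le_add_right (mul_le_mul_right (min_le_right 1 b) _) _)
  rw [← ENNReal.ofReal_toReal hm, ← ENNReal.ofReal_mul hS, ← ENNReal.ofReal_mul (by positivity),
    ← ENNReal.ofReal_add (by positivity) (by positivity)]
  refine ENNReal.ofReal_le_ofReal ?_
  generalize hmm : (min 1 b).toReal = m at hle
  have h0 : 0 ≤ m := hmm ▸ ENNReal.toReal_nonneg
  have e : t * S ^ 2 + 1 / t * m - S * m = (t * S - m / 2) ^ 2 / t + (m - m ^ 2 / 4) / t := by
    field_simp
    ring
  have : 0 ≤ (t * S - m / 2) ^ 2 / t + (m - m ^ 2 / 4) / t :=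
    add_nonneg (by positivity) (div_nonneg (by nlinarith) ht.le)
  linarith

theorem integrable_pow_gaussianReal (k : ℕ) :
    Integrable (fun x : ℝ => x ^ k) (gaussianReal 0 1) := by
  rcases Nat.eq_zero_or_pos k with rfl | hk
  · simp
  · have := (memLp_id_gaussianReal (μ := 0) (v := 1) k).integrable_norm_pow hk.ne'
    refine this.mono' (by fun_prop) (ae_of_all _ fun x => ?_)
    simp

theorem lintegral_sum_sq_sq_le {σ : ι → ℝ} {Λ : ℝ} (hΛ : ∀ j, σ j ^ 2 ≤ Λ) :
    ∫⁻ x, ENNReal.ofReal ((∑ j, σ j ^ 2 * x j ^ 2) ^ 2) ∂(stdGauss ι) ≤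
      ENNReal.ofReal (Λ ^ 2 * Fintype.card ι ^ 2 * ∫ x, x ^ 4 ∂(gaussianReal 0 1)) := by
  have hint : ∀ j, Integrable (fun x : ι → ℝ => x j ^ 4) (stdGauss ι) := fun j =>
    integrable_eval_pi (ν := fun _ => gaussianReal 0 1) (f := fun y => y ^ 4) j
      (integrable_pow_gaussianReal 4)
  have hint2 : Integrable (fun x : ι → ℝ => Λ ^ 2 * (Fintype.card ι * ∑ j, x j ^ 4))
      (stdGauss ι) :=
    ((integrable_finsetSum _ fun j _ => hint j).const_mul _).const_mul _
  have hle : ∀ x : ι → ℝ, (∑ j, σ j ^ 2 * x j ^ 2) ^ 2 ≤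
      Λ ^ 2 * (Fintype.card ι * ∑ j, x j ^ 4) := by
    intro x
    have h1 : ∑ j, σ j ^ 2 * x j ^ 2 ≤ Λ * ∑ j, x j ^ 2 := by
      rw [Finset.mul_sum]
      exact Finset.sum_le_sum fun j _ => mul_le_mul_of_nonneg_right (hΛ j) (sq_nonneg _)
    have h2 : (∑ j, x j ^ 2) ^ 2 ≤ Fintype.card ι * ∑ j, (x j ^ 2) ^ 2 := by
      simpa using sq_sum_le_card_mul_sum_sq (s := Finset.univ) (f := fun j => x j ^ 2)
    calc _ ≤ (Λ * ∑ j, x j ^ 2) ^ 2 :=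
          pow_le_pow_left₀ (Finset.sum_nonneg fun j _ => by positivity) h1 2
      _ = Λ ^ 2 * (∑ j, x j ^ 2) ^ 2 := by ring
      _ ≤ Λ ^ 2 * (Fintype.card ι * ∑ j, (x j ^ 2) ^ 2) :=
          mul_le_mul_of_nonneg_left h2 (sq_nonneg _)
      _ = _ := by simp only [← pow_mul]
  calc _ ≤ ∫⁻ x, ENNReal.ofReal (Λ ^ 2 * (Fintype.card ι * ∑ j, x j ^ 4)) ∂(stdGauss ι) :=
        lintegral_mono fun x => ENNReal.ofReal_le_ofReal (hle x)
    _ = ENNReal.ofReal (∫ x, Λ ^ 2 * (Fintype.card ι * ∑ j, x j ^ 4) ∂(stdGauss ι)) :=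
        (ofReal_integral_eq_lintegral_ofReal hint2 (ae_of_all _ fun x => by positivity)).symm
    _ = _ := by
        congr 1
        rw [integral_const_mul, integral_const_mul, integral_finsetSum _ fun j _ => hint j]
        have : ∀ j, ∫ x : ι → ℝ, x j ^ 4 ∂(stdGauss ι) = ∫ x, x ^ 4 ∂(gaussianReal 0 1) :=
          fun j => integral_eval_pi (ν := fun _ => gaussianReal 0 1) j (f := fun y => y ^ 4)
            (by fun_prop)
        simp_rw [this]
        rw [Finset.sum_const, Finset.card_univ, nsmul_eq_mul]
        ring

theorem lintegral_randomCode_le {σ : ι → ℝ} {θ δ Λ : ℝ} (hσ : ∀ j, 0 < σ j) (hθ : 0 < θ)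
    (h : ∀ j, θ ≤ σ j ^ 2) (hδ : 0 < δ) (hδ1 : δ ≤ 1) (hΛ : ∀ j, σ j ^ 2 ≤ Λ) {n : ℕ}
    (hn : exp (∑ j, 1 / 2 * log (σ j ^ 2 / θ) + 2 * δ * Fintype.card ι) ≤ n) :
    ∫⁻ x, ENNReal.ofReal (∑ j, σ j ^ 2 * x j ^ 2) *
      (reproLaw σ θ {a | (1 + δ) * θ * Fintype.card ι < ∑ j, (σ j * x j - a j) ^ 2}) ^ n
        ∂(stdGauss ι) ≤
      ENNReal.ofReal (exp (-(δ ^ 2 / 32 * Fintype.card ι)) *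
        (2 * (Λ ^ 2 * Fintype.card ι ^ 2 * ∫ x, x ^ 4 ∂(gaussianReal 0 1)) + 4)) := by
  set t := exp (-(δ ^ 2 / 32 * Fintype.card ι)) with ht
  have ht0 : 0 < t := Real.exp_pos _
  set M := Λ ^ 2 * Fintype.card ι ^ 2 * ∫ x, x ^ 4 ∂(gaussianReal 0 1) with hM
  have hM0 : 0 ≤ M := mul_nonneg (by positivity) (integral_nonneg fun x => by positivity)
  have het : exp (-(δ * Fintype.card ι)) ≤ t := by
    refine Real.exp_le_exp.2 (neg_le_neg ?_)
    exact mul_le_mul_of_nonneg_right (by nlinarith) (by positivity)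
  have hS0 : ∀ x : ι → ℝ, 0 ≤ ∑ j, σ j ^ 2 * x j ^ 2 := fun x =>
    Finset.sum_nonneg fun j _ => by positivity
  have hpt : ∀ x : ι → ℝ, ENNReal.ofReal (∑ j, σ j ^ 2 * x j ^ 2) *
      (reproLaw σ θ {a | (1 + δ) * θ * Fintype.card ι < ∑ j, (σ j * x j - a j) ^ 2}) ^ n ≤
      (ENNReal.ofReal (2 * t) * ENNReal.ofReal ((∑ j, σ j ^ 2 * x j ^ 2) ^ 2) +
        ENNReal.ofReal t) + ENNReal.ofReal (1 / t) *
        ∫⁻ a, channelRatio σ θ x a * chernoffWeight σ θ δ x a ∂(reproLaw σ θ) := by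
    intro x
    refine (mul_le_mul_right (reproLaw_miss_pow_le hσ hθ h hδ hn x) _).trans ?_
    rw [mul_add]
    have h1 := ofReal_mul_min_le (hS0 x) ht0
      (∫⁻ a, channelRatio σ θ x a * chernoffWeight σ θ δ x a ∂(reproLaw σ θ))
    have h2 : ENNReal.ofReal (∑ j, σ j ^ 2 * x j ^ 2) *
        ENNReal.ofReal (exp (-(δ * Fintype.card ι))) ≤
        ENNReal.ofReal (t * (∑ j, σ j ^ 2 * x j ^ 2) ^ 2 + t) := by
      rw [← ENNReal.ofReal_mul (hS0 x)]
      refine ENNReal.ofReal_le_ofReal ((mul_le_mul_of_nonneg_left het (hS0 x)).trans ?_)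
      nlinarith [sq_nonneg (∑ j, σ j ^ 2 * x j ^ 2 - 1)]
    refine (add_le_add h1 h2).trans_eq ?_
    rw [ENNReal.ofReal_add (by positivity) ht0.le, ENNReal.ofReal_mul ht0.le,
      ENNReal.ofReal_mul zero_le_two]
    simp only [ENNReal.ofReal_ofNat]
    ring
  have hm1 : Measurable fun x : ι → ℝ => ENNReal.ofReal ((∑ j, σ j ^ 2 * x j ^ 2) ^ 2) := by
    fun_prop
  have hm2 : Measurable fun x => ∫⁻ a, channelRatio σ θ x a * chernoffWeight σ θ δ x a
      ∂(reproLaw σ θ) :=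
    ((measurable_channelRatio σ θ).mul (measurable_chernoffWeight σ θ δ)).lintegral_prod_right'
  refine (lintegral_mono hpt).trans ?_
  rw [lintegral_add_right _ (hm2.const_mul _), lintegral_const_mul _ hm2,
    lintegral_add_left (hm1.const_mul _), lintegral_const_mul _ hm1, lintegral_const,
    measure_univ, mul_one]
  have h3 := lintegral_channelRatio_mul_chernoffWeight_le hσ hθ h hδ hδ1
  refine (add_le_add (add_le_add_left (mul_le_mul_right (lintegral_sum_sq_sq_le hΛ) _) _)
    (mul_le_mul_right h3 _)).trans_eq ?_
  have e3 : (3 : ENNReal) = ENNReal.ofReal 3 := by simp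
  rw [← hM, e3, ← ENNReal.ofReal_mul (by positivity), ← ENNReal.ofReal_mul (by positivity),
    ← ENNReal.ofReal_mul (by positivity), ← ENNReal.ofReal_add (by positivity) ht0.le,
    ← ENNReal.ofReal_add (by positivity) (by positivity)]
  congr 1
  have e4 : exp (-(δ ^ 2 / 16 * Fintype.card ι)) = t * t := by
    rw [ht, ← Real.exp_add]
    ring_nf
  rw [e4]
  field_simp
  ring

/-- Random coding: a product Gaussian vector has a codebook of rate slightly above
`∑ ½ log (σ²/θ)` whose distortion is slightly above `θ` per coordinate. -/
theorem exists_code_stdGauss {σ : ι → ℝ} {θ δ Λ : ℝ} (hσ : ∀ j, 0 < σ j) (hθ : 0 < θ)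
    (h : ∀ j, θ ≤ σ j ^ 2) (hδ : 0 < δ) (hδ1 : δ ≤ 1) (hΛ : ∀ j, σ j ^ 2 ≤ Λ) {n : ℕ}
    (hn : exp (∑ j, 1 / 2 * log (σ j ^ 2 / θ) + 2 * δ * Fintype.card ι) ≤ n) :
    ∃ c : Option (Fin n) → ι → ℝ,
      ∫ x, (⨅ i, ∑ j, (σ j * x j - c i j) ^ 2) ∂(stdGauss ι) ≤
        (1 + δ) * θ * Fintype.card ι + exp (-(δ ^ 2 / 32 * Fintype.card ι)) *
        (2 * (Λ ^ 2 * Fintype.card ι ^ 2 * ∫ x, x ^ 4 ∂(gaussianReal 0 1)) + 4) := by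
  set D := (1 + δ) * θ * Fintype.card ι with hD
  have hD0 : 0 ≤ D := by positivity
  have hS0 : ∀ x : ι → ℝ, 0 ≤ ∑ j, σ j ^ 2 * x j ^ 2 := fun x =>
    Finset.sum_nonneg fun j _ => by positivity
  let miss : (ι → ℝ) → (ι → ℝ) → ENNReal := fun x a =>
    if D < ∑ j, (σ j * x j - a j) ^ 2 then 1 else 0
  let F : (Fin n → ι → ℝ) → (ι → ℝ) → ENNReal := fun c x =>
    ENNReal.ofReal (∑ j, σ j ^ 2 * x j ^ 2) * ∏ i, miss x (c i)
  have hFm : Measurable fun p : (Fin n → ι → ℝ) × (ι → ℝ) => F p.1 p.2 := by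
    refine Measurable.mul (by fun_prop) (Finset.measurable_fun_prod _ fun i _ => ?_)
    exact Measurable.ite (measurableSet_lt (by fun_prop) (by fun_prop)) measurable_const
      measurable_const
  obtain ⟨c, hc⟩ := exists_le_lintegral (μ := Measure.pi fun _ : Fin n => reproLaw σ θ)
    (f := fun c => ∫⁻ x, F c x ∂(stdGauss ι)) hFm.lintegral_prod_right'.aemeasurable
  have hswap : ∫⁻ c, ∫⁻ x, F c x ∂(stdGauss ι) ∂(Measure.pi fun _ : Fin n => reproLaw σ θ) =
      ∫⁻ x, ENNReal.ofReal (∑ j, σ j ^ 2 * x j ^ 2) *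
        (reproLaw σ θ {a | D < ∑ j, (σ j * x j - a j) ^ 2}) ^ n ∂(stdGauss ι) := by
    rw [lintegral_lintegral_swap hFm.aemeasurable]
    refine lintegral_congr fun x => ?_
    have hmx : Measurable (miss x) :=
      Measurable.ite (measurableSet_lt (by fun_prop) (by fun_prop))
        measurable_const measurable_const
    have hind : ∫⁻ a, miss x a ∂(reproLaw σ θ) =
        reproLaw σ θ {a | D < ∑ j, (σ j * x j - a j) ^ 2} := by
      rw [← lintegral_indicator_one (measurableSet_lt (by fun_prop) (by fun_prop))]
      rfl
    have hmp : Measurable fun c : Fin n → ι → ℝ => ∏ i, miss x (c i) :=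
      Finset.measurable_fun_prod _ fun i _ => hmx.comp (measurable_pi_apply i)
    refine (lintegral_const_mul _ hmp).trans ?_
    rw [lintegral_pi_prod (fun _ => reproLaw σ θ) (fun _ => hmx)]
    simp [hind]
  rw [hswap] at hc
  have hc2 := hc.trans (lintegral_randomCode_le hσ hθ h hδ hδ1 hΛ hn)
  refine ⟨fun i => i.elim 0 c, ?_⟩
  set R := exp (-(δ ^ 2 / 32 * Fintype.card ι)) *
    (2 * (Λ ^ 2 * Fintype.card ι ^ 2 * ∫ x, x ^ 4 ∂(gaussianReal 0 1)) + 4) with hR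
  have hR0 : 0 ≤ R := by
    have : 0 ≤ ∫ x : ℝ, x ^ 4 ∂(gaussianReal 0 1) := integral_nonneg fun x => by positivity
    positivity
  have hpt : ∀ x : ι → ℝ, ENNReal.ofReal
      (⨅ i : Option (Fin n), ∑ j, (σ j * x j - (i.elim 0 c : ι → ℝ) j) ^ 2) ≤
      ENNReal.ofReal D + F c x := by
    intro x
    by_cases hx : ∃ i, ∑ j, (σ j * x j - c i j) ^ 2 ≤ D
    · obtain ⟨i, hi⟩ := hx
      exact le_add_right (ENNReal.ofReal_le_ofReal
        ((ciInf_le (Set.finite_range _).bddBelow (some i)).trans hi))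
    · push Not at hx
      refine le_add_left ?_
      have : ∏ i, miss x (c i) = 1 := Finset.prod_eq_one fun i _ => if_pos (hx i)
      simp only [F, this, mul_one]
      refine ENNReal.ofReal_le_ofReal ((ciInf_le (Set.finite_range _).bddBelow none).trans_eq ?_)
      simp [mul_pow]
  have hnn : ∀ x : ι → ℝ, 0 ≤
      ⨅ i : Option (Fin n), ∑ j, (σ j * x j - (i.elim 0 c : ι → ℝ) j) ^ 2 := fun x =>
    Real.iInf_nonneg fun i => Finset.sum_nonneg fun j _ => sq_nonneg _
  rw [integral_eq_lintegral_of_nonneg_ae (ae_of_all _ hnn)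
    (Measurable.iInf fun i => by fun_prop).aestronglyMeasurable]
  refine ENNReal.toReal_le_of_le_ofReal (by positivity) ?_
  refine (lintegral_mono hpt).trans ?_
  rw [lintegral_add_left measurable_const, lintegral_const, measure_univ, mul_one,
    ENNReal.ofReal_add hD0 hR0]
  exact add_le_add_right hc2 _

end RandomCoding

/-- The law of a two-sided sequence of independent standard Gaussian variables. -/
abbrev gaussSeq : Measure (ℤ → ℝ) := Measure.infinitePi fun _ : ℤ => gaussianReal 0 1

theorem measurePreserving_coord (k : ℤ) :
    MeasurePreserving (fun ω : ℤ → ℝ => ω k) gaussSeq (gaussianReal 0 1) :=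
  measurePreserving_eval_infinitePi (fun _ : ℤ => gaussianReal 0 1) k

theorem memLp_coord (k : ℤ) : MemLp (fun ω : ℤ → ℝ => ω k) 2 gaussSeq :=
  (memLp_id_gaussianReal (μ := 0) (v := 1) 2).comp_measurePreserving (measurePreserving_coord k)

theorem integral_coord_mul_coord {k l : ℤ} (h : k ≠ l) :
    ∫ ω : ℤ → ℝ, ω k * ω l ∂gaussSeq = 0 := by
  have hind : iIndepFun (fun (k : ℤ) (ω : ℤ → ℝ) => ω k) gaussSeq :=
    iIndepFun_infinitePi (X := fun _ x => x) fun _ => measurable_id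
  rw [(hind.indepFun h).integral_fun_mul_eq_mul_integral
    (measurable_pi_apply k).aestronglyMeasurable (measurable_pi_apply l).aestronglyMeasurable]
  have : ∫ ω : ℤ → ℝ, ω k ∂gaussSeq = 0 := by
    have h2 := integral_map (μ := gaussSeq) (φ := fun ω : ℤ → ℝ => ω k)
      (measurable_pi_apply k).aemeasurable
      (f := fun x : ℝ => x) (by fun_prop)
    rw [(measurePreserving_coord k).map_eq] at h2
    rw [← h2]
    simp
  rw [this, zero_mul]

theorem integral_coord_sq (k : ℤ) : ∫ ω : ℤ → ℝ, ω k ^ 2 ∂gaussSeq = 1 := by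
  have h2 := integral_map (μ := gaussSeq) (φ := fun ω : ℤ → ℝ => ω k)
      (measurable_pi_apply k).aemeasurable
    (f := fun x : ℝ => x ^ 2) (by fun_prop)
  rw [(measurePreserving_coord k).map_eq] at h2
  rw [← h2, integral_sq_gaussianReal]
  simp

section
variable {H F : Type*} [NormedAddCommGroup H] [InnerProductSpace ℝ H]
  [NormedAddCommGroup F] [InnerProductSpace ℝ F]

/-- Multiplication of vectors by the `k`-th Gaussian coordinate. -/
def coordIsometry (H : Type*) [NormedAddCommGroup H] [InnerProductSpace ℝ H] (k : ℤ) :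
    H →ₗᵢ[ℝ] Lp H 2 gaussSeq where
  toFun h := ((ContinuousLinearMap.toSpanSingleton ℝ h).comp_memLp' (memLp_coord k)).toLp _
  map_add' x y := by
    rw [← MemLp.toLp_add]
    congr 1
    ext ω
    simp
  map_smul' c x := by
    rw [RingHom.id_apply, ← MemLp.toLp_const_smul]
    congr 1
    ext ω
    exact smul_comm _ _ _
  norm_map' x := by
    have h1 : ‖((ContinuousLinearMap.toSpanSingleton ℝ x).comp_memLp'
        (memLp_coord k)).toLp _‖ ^ 2 = ‖x‖ ^ 2 := by
      rw [← real_inner_self_eq_norm_sq, L2.inner_def]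
      have : ∀ᵐ ω ∂gaussSeq, inner ℝ ((((ContinuousLinearMap.toSpanSingleton ℝ x).comp_memLp'
          (memLp_coord k)).toLp _ : Lp H 2 gaussSeq) ω)
          ((((ContinuousLinearMap.toSpanSingleton ℝ x).comp_memLp'
          (memLp_coord k)).toLp _ : Lp H 2 gaussSeq) ω) = ω k ^ 2 * ‖x‖ ^ 2 := by
        filter_upwards [((ContinuousLinearMap.toSpanSingleton ℝ x).comp_memLp'
          (memLp_coord k)).coeFn_toLp] with ω hω
        rw [hω]
        simp [norm_smul, mul_pow]
      rw [integral_congr_ae this, integral_mul_const, integral_coord_sq, one_mul]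
    exact (pow_left_inj₀ (norm_nonneg _) (norm_nonneg _) two_ne_zero).1 h1

theorem coordIsometry_coeFn (k : ℤ) (h : H) :
    ∀ᵐ ω ∂gaussSeq, (coordIsometry H k h : (ℤ → ℝ) → H) ω = ω k • h := by
  filter_upwards [((ContinuousLinearMap.toSpanSingleton ℝ h).comp_memLp'
    (memLp_coord k)).coeFn_toLp] with ω hω
  exact hω.trans (by simp)

theorem orthogonalFamily_coordIsometry :
    OrthogonalFamily ℝ (fun _ : ℤ => H) (coordIsometry H) := by
  intro k l hkl v w
  rw [L2.inner_def]
  have : ∀ᵐ ω ∂gaussSeq, inner ℝ ((coordIsometry H k v : (ℤ → ℝ) → H) ω)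
      ((coordIsometry H l w : (ℤ → ℝ) → H) ω) = ω k * ω l * inner ℝ v w := by
    filter_upwards [coordIsometry_coeFn k v, coordIsometry_coeFn l w] with ω h1 h2
    rw [h1, h2, real_inner_smul_left, real_inner_smul_right]
    ring
  rw [integral_congr_ae this, integral_mul_const, integral_coord_mul_coord hkl, zero_mul]

variable [CompleteSpace H] [CompleteSpace F]

/-- The Gaussian series `∑ ξ_k v_k` attached to a square summable family of vectors. -/
def gaussSeries : lp (fun _ : ℤ => H) 2 →ₗᵢ[ℝ] Lp H 2 gaussSeq :=
  (orthogonalFamily_coordIsometry (H := H)).linearIsometry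

theorem hasSum_gaussSeries (v : lp (fun _ : ℤ => H) 2) :
    HasSum (fun k => coordIsometry H k (v k)) (gaussSeries v) :=
  (orthogonalFamily_coordIsometry (H := H)).hasSum_linearIsometry v

theorem gaussSeries_map (L : H →L[ℝ] F) {v : lp (fun _ : ℤ => H) 2} {w : lp (fun _ : ℤ => F) 2}
    (hw : ∀ k, w k = L (v k)) :
    ∀ᵐ ω ∂gaussSeq, (gaussSeries w : (ℤ → ℝ) → F) ω = L ((gaussSeries v : (ℤ → ℝ) → H) ω) := by
  have h1 : HasSum (fun k => L.compLpL 2 gaussSeq (coordIsometry H k (v k)))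
      (L.compLpL 2 gaussSeq (gaussSeries v)) :=
    (L.compLpL 2 gaussSeq).hasSum (hasSum_gaussSeries v)
  have h2 : ∀ k, L.compLpL 2 gaussSeq (coordIsometry H k (v k)) = coordIsometry F k (w k) := by
    intro k
    refine Lp.ext ?_
    filter_upwards [L.coeFn_compLpL (p := 2) (μ := gaussSeq) (coordIsometry H k (v k)),
      coordIsometry_coeFn k (v k), coordIsometry_coeFn k (w k)] with ω h3 h4 h5
    rw [h3, h4, h5, hw, map_smul]
  simp_rw [h2] at h1
  rw [(hasSum_gaussSeries w).unique h1]
  exact L.coeFn_compLpL _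

theorem gaussSeries_eq_of_single {v : lp (fun _ : ℤ => H) 2} {k : ℤ}
    (hv : ∀ l, l ≠ k → v l = 0) :
    ∀ᵐ ω ∂gaussSeq, (gaussSeries v : (ℤ → ℝ) → H) ω = ω k • v k := by
  have h1 : gaussSeries v = coordIsometry H k (v k) := by
    refine (hasSum_gaussSeries v).unique (hasSum_single k fun l hl => ?_)
    rw [hv l hl, map_zero]
  rw [h1]
  exact coordIsometry_coeFn k (v k)

theorem lp_norm_sq {H : Type*} [NormedAddCommGroup H] (v : lp (fun _ : ℤ => H) 2) :
    ‖v‖ ^ 2 = ∑' k, ‖v k‖ ^ 2 := by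
  have h := lp.norm_rpow_eq_tsum (p := 2) (by norm_num) v
  simpa using h

theorem integral_norm_sq_gaussSeries (v : lp (fun _ : ℤ => H) 2) :
    ∫ ω, ‖(gaussSeries v : (ℤ → ℝ) → H) ω‖ ^ 2 ∂gaussSeq = ∑' k, ‖v k‖ ^ 2 := by
  rw [← lp_norm_sq, ← gaussSeries.norm_map v, ← real_inner_self_eq_norm_sq (gaussSeries v),
    L2.inner_def]
  simp only [real_inner_self_eq_norm_sq]

theorem integrable_norm_sq_gaussSeries (v : lp (fun _ : ℤ => H) 2) :
    Integrable (fun ω => ‖(gaussSeries v : (ℤ → ℝ) → H) ω‖ ^ 2) gaussSeq :=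
  (Lp.memLp (gaussSeries v)).integrable_norm_pow two_ne_zero
end

theorem integral_norm_le_norm_Lp {Ω : Type*} [MeasurableSpace Ω] {P : Measure Ω}
    [IsProbabilityMeasure P] (h : Lp ℝ 2 P) : ∫ ω, ‖h ω‖ ∂P ≤ ‖h‖ := by
  rw [integral_norm_eq_lintegral_enorm (Lp.aestronglyMeasurable h), Lp.norm_def,
    ← eLpNorm_one_eq_lintegral_enorm]
  refine ENNReal.toReal_mono (Lp.eLpNorm_ne_top h) ?_
  exact eLpNorm_le_eLpNorm_of_exponent_le (by norm_num) (Lp.aestronglyMeasurable h)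

theorem norm_cexp_sub_cexp_le (a b : ℝ) :
    ‖Complex.exp (a * Complex.I) - Complex.exp (b * Complex.I)‖ ≤ ‖a - b‖ := by
  have h : Complex.exp (a * Complex.I) - Complex.exp (b * Complex.I) =
      Complex.exp (b * Complex.I) * (Complex.exp (Complex.I * ((a - b : ℝ) : ℂ)) - 1) := by
    rw [mul_sub, mul_one, ← Complex.exp_add]
    push_cast
    ring_nf
  rw [h, norm_mul, Complex.norm_exp_ofReal_mul_I, one_mul]
  exact Real.norm_exp_I_mul_ofReal_sub_one_le

theorem integrable_cexp_mul_I {Ω : Type*} [MeasurableSpace Ω] {P : Measure Ω}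
    [IsProbabilityMeasure P] {f : Ω → ℝ} (hf : AEStronglyMeasurable f P) :
    Integrable (fun ω => Complex.exp (f ω * Complex.I)) P := by
  refine Integrable.of_bound (C := 1) ?_ (ae_of_all _ fun ω => ?_)
  · have : Continuous fun x : ℝ => Complex.exp (x * Complex.I) := by fun_prop
    exact this.comp_aestronglyMeasurable hf
  · exact (Complex.norm_exp_ofReal_mul_I _).le

theorem continuous_integral_cexp {Ω : Type*} [MeasurableSpace Ω] {P : Measure Ω}
    [IsProbabilityMeasure P] :
    Continuous fun f : Lp ℝ 2 P => ∫ ω, Complex.exp ((f ω : ℝ) * Complex.I) ∂P := by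
  refine (LipschitzWith.of_dist_le_mul (K := 1) fun f g => ?_).continuous
  rw [NNReal.coe_one, one_mul, dist_eq_norm, dist_eq_norm,
    ← integral_sub (integrable_cexp_mul_I (Lp.aestronglyMeasurable f))
      (integrable_cexp_mul_I (Lp.aestronglyMeasurable g))]
  refine (norm_integral_le_integral_norm _).trans (le_trans ?_ (integral_norm_le_norm_Lp (f - g)))
  refine integral_mono_ae (((integrable_cexp_mul_I (Lp.aestronglyMeasurable f)).sub
    (integrable_cexp_mul_I (Lp.aestronglyMeasurable g))).norm)
    ((Lp.memLp (f - g)).integrable one_le_two).norm ?_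
  filter_upwards [Lp.coeFn_sub f g] with ω hω
  rw [hω]
  exact norm_cexp_sub_cexp_le _ _

theorem integral_cexp_finset_sum (w : ℤ → ℝ) (s : Finset ℤ) :
    ∫ ω : ℤ → ℝ, Complex.exp ((∑ k ∈ s, ω k * w k : ℝ) * Complex.I) ∂gaussSeq =
      Complex.exp (((-(∑ k ∈ s, w k ^ 2) / 2 : ℝ)) : ℂ) := by
  have h1 : ∀ ω : ℤ → ℝ, Complex.exp ((∑ k ∈ s, ω k * w k : ℝ) * Complex.I) =
      (fun y : s → ℝ => ∏ k : s, Complex.exp ((w k : ℝ) * (y k : ℝ) * Complex.I))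
        (s.restrict ω) := by
    intro ω
    simp only [Finset.restrict]
    rw [← Complex.exp_sum, ← Finset.sum_coe_sort]
    push_cast
    rw [Finset.sum_mul]
    congr 1
    exact Finset.sum_congr rfl fun k _ => by ring
  simp_rw [h1]
  refine (integral_restrict_infinitePi (μ := fun _ : ℤ => gaussianReal 0 1)
    (f := fun y : s → ℝ => ∏ k : s, Complex.exp ((w k : ℝ) * (y k : ℝ) * Complex.I))
    (Continuous.aestronglyMeasurable (by fun_prop))).trans ?_
  rw [integral_fintype_prod_eq_prod
    (fun k : s => fun y : ℝ => Complex.exp ((w k : ℝ) * (y : ℝ) * Complex.I))]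
  simp_rw [← charFun_apply_real, charFun_gaussianReal]
  rw [← Complex.exp_sum]
  congr 1
  rw [Finset.sum_coe_sort s (fun k => ((w k : ℝ) : ℂ) * ((0 : ℝ) : ℂ) * Complex.I -
    ((1 : NNReal) : ℝ) * (w k : ℂ) ^ 2 / 2)]
  push_cast
  rw [← Finset.sum_neg_distrib, Finset.sum_div]
  exact Finset.sum_congr rfl fun k _ => by ring

theorem integral_cexp_gaussSeries (w : lp (fun _ : ℤ => ℝ) 2) :
    ∫ ω, Complex.exp (((gaussSeries w : (ℤ → ℝ) → ℝ) ω : ℝ) * Complex.I) ∂gaussSeq =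
      Complex.exp (((-(∑' k, w k ^ 2) / 2 : ℝ)) : ℂ) := by
  have h1 := (continuous_integral_cexp (P := gaussSeq)).tendsto (gaussSeries w)
  have h2 := h1.comp (hasSum_gaussSeries w)
  have hsum : Summable fun k => w k ^ 2 := by
    have := (memℓp_gen_iff (p := 2) (by norm_num)).1 (lp.memℓp w)
    simpa using this
  have h3 : Tendsto (fun s : Finset ℤ => Complex.exp (((-(∑ k ∈ s, w k ^ 2) / 2 : ℝ)) : ℂ)) atTop
      (nhds (Complex.exp (((-(∑' k, w k ^ 2) / 2 : ℝ)) : ℂ))) := by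
    have hc : Continuous fun x : ℝ => Complex.exp (((-x / 2 : ℝ)) : ℂ) := by fun_prop
    exact (hc.tendsto _).comp hsum.hasSum
  refine tendsto_nhds_unique h2 (h3.congr fun s => ?_)
  rw [← integral_cexp_finset_sum]
  refine integral_congr_ae ?_
  have hae : ∀ᵐ ω ∂gaussSeq, ∀ k : ℤ, (coordIsometry ℝ k (w k) : (ℤ → ℝ) → ℝ) ω = ω k • w k :=
    ae_all_iff.2 fun k => coordIsometry_coeFn k (w k)
  filter_upwards [hae, Lp.coeFn_finsetSum s (fun k => coordIsometry ℝ k (w k))] with ω h4 h5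
  have h6 : ((∑ k ∈ s, coordIsometry ℝ k (w k) : Lp ℝ 2 gaussSeq) : (ℤ → ℝ) → ℝ) ω =
      ∑ k ∈ s, ω k * w k := by
    rw [h5, Finset.sum_apply]
    exact Finset.sum_congr rfl fun k _ => h4 k
  exact congrArg (fun x : ℝ => Complex.exp (x * Complex.I)) h6.symm

theorem gaussSeries_map_law (w : lp (fun _ : ℤ => ℝ) 2) :
    gaussSeq.map (gaussSeries w : (ℤ → ℝ) → ℝ) =
      gaussianReal 0 (Real.toNNReal (∑' k, w k ^ 2)) := by
  have hm := (Lp.aestronglyMeasurable (gaussSeries w)).aemeasurable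
  have := Measure.isProbabilityMeasure_map hm
  refine Measure.ext_of_charFun (funext fun t => ?_)
  rw [charFun_apply_real, charFun_gaussianReal, integral_map hm
    (Continuous.aestronglyMeasurable (by fun_prop))]
  have h1 := integral_cexp_gaussSeries (t • w)
  have h2 : ∀ᵐ ω ∂gaussSeq, (gaussSeries (t • w) : (ℤ → ℝ) → ℝ) ω =
      t * (gaussSeries w : (ℤ → ℝ) → ℝ) ω := by
    rw [map_smul]
    exact Lp.coeFn_smul t (gaussSeries w)
  have h3 : ∫ ω, Complex.exp (t * (gaussSeries w : (ℤ → ℝ) → ℝ) ω * Complex.I) ∂gaussSeq =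
      ∫ ω, Complex.exp (((gaussSeries (t • w) : (ℤ → ℝ) → ℝ) ω : ℝ) * Complex.I) ∂gaussSeq := by
    refine integral_congr_ae ?_
    filter_upwards [h2] with ω hω
    rw [hω]
    push_cast
    rfl
  rw [h3, h1]
  congr 1
  have h4 : ∑' k, (t • w) k ^ 2 = t ^ 2 * ∑' k, w k ^ 2 := by
    rw [← tsum_mul_left]
    exact tsum_congr fun k => by simp [mul_pow]
  rw [h4, Real.coe_toNNReal _ (tsum_nonneg fun k => sq_nonneg _)]
  push_cast
  ring

section
variable {H : Type*} [NormedAddCommGroup H] [InnerProductSpace ℝ H] [CompleteSpace H]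

theorem summable_norm_sq_lp {H : Type*} [NormedAddCommGroup H] (v : lp (fun _ : ℤ => H) 2) :
    Summable fun k => ‖v k‖ ^ 2 := by
  have := (memℓp_gen_iff (p := 2) (by norm_num)).1 (lp.memℓp v)
  simpa using this

/-- Square summable families as elements of `lp`. -/
def lpOf {H : Type*} [NormedAddCommGroup H] (v : ℤ → H) (hv : Summable fun k => ‖v k‖ ^ 2) :
    lp (fun _ : ℤ => H) 2 :=
  ⟨v, (memℓp_gen_iff (p := 2) (by norm_num)).2 (by simpa using hv)⟩

theorem lpOf_apply {H : Type*} [NormedAddCommGroup H] (v : ℤ → H)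
    (hv : Summable fun k => ‖v k‖ ^ 2) (k : ℤ) : lpOf v hv k = v k := rfl

theorem exists_lp_map {H F : Type*} [NormedAddCommGroup H] [InnerProductSpace ℝ H]
    [NormedAddCommGroup F] [InnerProductSpace ℝ F] (L : H →L[ℝ] F)
    (v : lp (fun _ : ℤ => H) 2) : ∃ w : lp (fun _ : ℤ => F) 2, ∀ k, w k = L (v k) := by
  refine ⟨lpOf (fun k => L (v k)) ?_, fun k => rfl⟩
  refine Summable.of_nonneg_of_le (fun k => sq_nonneg _) (fun k => ?_)
    ((summable_norm_sq_lp v).mul_left (‖L‖ ^ 2))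
  rw [← mul_pow]
  exact pow_le_pow_left₀ (norm_nonneg _) (L.le_opNorm _) 2

theorem gaussSeries_inner_law (v : lp (fun _ : ℤ => H) 2) (f : H) :
    gaussSeq.map (fun ω => inner ℝ f ((gaussSeries v : (ℤ → ℝ) → H) ω)) =
      gaussianReal 0 (Real.toNNReal (∑' k, inner ℝ f (v k) ^ 2)) := by
  obtain ⟨w, hw⟩ := exists_lp_map (innerSL ℝ f) v
  have h1 := gaussSeries_map (innerSL ℝ f) hw
  have h2 := gaussSeries_map_law w
  simp_rw [hw, innerSL_apply_apply] at h2
  rw [← h2]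
  refine Measure.map_congr ?_
  filter_upwards [h1] with ω hω
  rw [hω, innerSL_apply_apply]

theorem charFun_gaussSeries [MeasurableSpace H] [BorelSpace H] [SecondCountableTopology H]
    (v : lp (fun _ : ℤ => H) 2) (f : H) :
    charFun (gaussSeq.map (gaussSeries v : (ℤ → ℝ) → H)) f =
      Complex.exp ((-(∑' k, inner ℝ f (v k) ^ 2) / 2 : ℝ) : ℂ) := by
  have h1 : charFun (gaussSeq.map fun ω => inner ℝ f ((gaussSeries v : (ℤ → ℝ) → H) ω)) 1 =
      charFun (gaussianReal 0 (toNNReal (∑' k, inner ℝ f (v k) ^ 2))) 1 := by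
    rw [gaussSeries_inner_law]
  rw [charFun_gaussianReal, charFun_apply_real] at h1
  have hm := (Lp.aestronglyMeasurable (gaussSeries v)).aemeasurable
  rw [charFun_apply, integral_map hm (Continuous.aestronglyMeasurable (by fun_prop))]
  have hin : AEMeasurable (fun ω => inner ℝ f ((gaussSeries v : (ℤ → ℝ) → H) ω)) gaussSeq :=
    (Lp.aestronglyMeasurable (gaussSeries v)).const_inner.aemeasurable
  rw [integral_map hin (Continuous.aestronglyMeasurable (by fun_prop)),
    Real.coe_toNNReal _ (tsum_nonneg fun k => sq_nonneg _)] at h1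
  simp only [Complex.ofReal_one, one_mul] at h1
  simp_rw [real_inner_comm f]
  refine h1.trans ?_
  congr 1
  push_cast
  ring
end

/-- Lebesgue measure on `[0, T]`. -/
abbrev intervalMeasure (T : ℝ) : Measure ℝ := volume.restrict (Set.Icc 0 T)

theorem integral_intervalMeasure {E : Type*} [NormedAddCommGroup E] [NormedSpace ℝ E] {T : ℝ}
    (hT : 0 < T) (f : ℝ → E) : ∫ t, f t ∂(intervalMeasure T) = ∫ t in (0 : ℝ)..T, f t := by
  rw [integral_Icc_eq_integral_Ioc, intervalIntegral.integral_of_le hT.le]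

theorem memLp_intervalMeasure_of_continuous {T : ℝ} {f : ℝ → ℝ} (hf : Continuous f) (p : ENNReal) :
    MemLp f p (intervalMeasure T) := by
  obtain ⟨C, hC⟩ := isCompact_Icc.exists_bound_of_continuousOn (s := Set.Icc 0 T) hf.continuousOn
  refine MemLp.of_bound hf.aestronglyMeasurable C ?_
  exact (ae_restrict_iff' measurableSet_Icc).2 (ae_of_all _ hC)

/-- The normalised cosine wave of frequency `k` and phase `φ` on `[0, T]`. -/
def cosWave (T : ℝ) (k : ℤ) (φ t : ℝ) : ℝ := √(2 / T) * cos (2 * π * k / T * t - φ)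

theorem continuous_cosWave (T : ℝ) (k : ℤ) (φ : ℝ) : Continuous (cosWave T k φ) := by
  unfold cosWave
  fun_prop

/-- The cosine wave as an element of `L²([0, T])`. -/
def cosWaveLp (T : ℝ) (k : ℤ) (φ : ℝ) : Lp ℝ 2 (intervalMeasure T) :=
  (memLp_intervalMeasure_of_continuous (continuous_cosWave T k φ) 2).toLp

theorem cosWaveLp_coeFn (T : ℝ) (k : ℤ) (φ : ℝ) :
    cosWaveLp T k φ =ᵐ[intervalMeasure T] cosWave T k φ :=
  MemLp.coeFn_toLp _

theorem integral_cos_period {T : ℝ} (hT : 0 < T) (m : ℤ) (φ : ℝ) :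
    ∫ t in (0 : ℝ)..T, cos (2 * π * m / T * t - φ) = if m = 0 then T * cos φ else 0 := by
  split_ifs with h
  · simp [h]
  · have hc : 2 * π * m / T ≠ 0 := by positivity
    rw [intervalIntegral.integral_comp_mul_sub (fun x => cos x) hc, integral_cos]
    have h1 : 2 * π * m / T * T - φ = -φ + m * (2 * π) := by field_simp; ring
    rw [h1, Real.sin_add_int_mul_two_pi]
    simp

theorem inner_cosWaveLp {T : ℝ} (hT : 0 < T) (k l : ℤ) (φ ψ : ℝ) :
    inner ℝ (cosWaveLp T k φ) (cosWaveLp T l ψ) =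
      (if k = l then cos (φ - ψ) else 0) + (if k = -l then cos (φ + ψ) else 0) := by
  rw [L2.inner_def]
  have h1 : ∫ t, inner ℝ ((cosWaveLp T k φ : ℝ → ℝ) t) ((cosWaveLp T l ψ : ℝ → ℝ) t)
        ∂(intervalMeasure T) = ∫ t in (0 : ℝ)..T,
          (1 / T * cos (2 * π * (k - l : ℤ) / T * t - (φ - ψ))
          + 1 / T * cos (2 * π * (k + l : ℤ) / T * t - (φ + ψ))) := by
    rw [← integral_intervalMeasure hT]
    refine integral_congr_ae ?_
    filter_upwards [cosWaveLp_coeFn T k φ, cosWaveLp_coeFn T l ψ] with t h2 h3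
    rw [h2, h3]
    simp only [cosWave, RCLike.inner_apply, conj_trivial]
    have h4 : 2 * π * (k - l : ℤ) / T * t - (φ - ψ) =
        (2 * π * k / T * t - φ) - (2 * π * l / T * t - ψ) := by push_cast; ring
    have h5 : 2 * π * (k + l : ℤ) / T * t - (φ + ψ) =
        (2 * π * k / T * t - φ) + (2 * π * l / T * t - ψ) := by push_cast; ring
    rw [h4, h5, cos_sub (2 * π * k / T * t - φ), cos_add (2 * π * k / T * t - φ)]
    have h6 : √(2 / T) * √(2 / T) = 2 / T := mul_self_sqrt (by positivity)
    linear_combination (cos (2 * π * k / T * t - φ) * cos (2 * π * l / T * t - ψ)) * h6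
  rw [h1, intervalIntegral.integral_add
    (Continuous.intervalIntegrable (by fun_prop) _ _)
    (Continuous.intervalIntegrable (by fun_prop) _ _),
    intervalIntegral.integral_const_mul, intervalIntegral.integral_const_mul,
    integral_cos_period hT, integral_cos_period hT]
  simp only [sub_eq_zero, ← eq_neg_iff_add_eq_zero]
  congr 1 <;> split_ifs <;> field_simp <;> simp

theorem hasSum_inner_cosWaveLp_sq {T : ℝ} (hT : 0 < T) (g : Lp ℝ 2 (intervalMeasure T)) :
    HasSum (fun k : ℤ => inner ℝ (cosWaveLp T k (π / 4)) g ^ 2) (‖g‖ ^ 2) := by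
  set A : ℤ → ℝ := fun k => ∫ t, cos (2 * π * k / T * t) * g t ∂(intervalMeasure T) with hA
  set B : ℤ → ℝ := fun k => ∫ t, sin (2 * π * k / T * t) * g t ∂(intervalMeasure T) with hB
  have hgi : Integrable g (intervalMeasure T) := (Lp.memLp g).integrable (by norm_num)
  have hAi : ∀ k : ℤ, Integrable (fun t => cos (2 * π * k / T * t) * g t) (intervalMeasure T) :=
    fun k => hgi.bdd_mul (c := 1) (by fun_prop) (ae_of_all _ fun t => abs_cos_le_one _)
  have hBi : ∀ k : ℤ, Integrable (fun t => sin (2 * π * k / T * t) * g t) (intervalMeasure T) :=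
    fun k => hgi.bdd_mul (c := 1) (by fun_prop) (ae_of_all _ fun t => abs_sin_le_one _)
  have hgc : MemLp (fun t => ((g t : ℝ) : ℂ)) 2 (volume.restrict (Set.Ioc 0 T)) := by
    rw [restrict_Ioc_eq_restrict_Icc]
    exact (Lp.memLp g).ofReal
  have hpars := hasSum_sq_fourierCoeffOn hT hgc
  have hcoef : ∀ k : ℤ, ‖fourierCoeffOn hT (fun t => ((g t : ℝ) : ℂ)) k‖ ^ 2 =
      (A k ^ 2 + B k ^ 2) / T ^ 2 := by
    intro k
    have h1 : ∫ t in (0 : ℝ)..T, fourier (-k) (t : AddCircle (T - 0)) • ((g t : ℝ) : ℂ) =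
        (A k : ℂ) + (-B k : ℝ) * Complex.I := by
      rw [← integral_intervalMeasure hT, hA, hB, ← integral_neg, ← integral_complex_ofReal,
        ← integral_complex_ofReal, ← integral_mul_const, ← integral_add (hAi k).ofReal
          ((hBi k).neg.ofReal.mul_const _)]
      refine integral_congr_ae (ae_of_all _ fun t => ?_)
      simp only
      rw [fourier_coe_apply, sub_zero]
      have h2 : 2 * (π : ℂ) * Complex.I * ((-k : ℤ) : ℂ) * t / T =
          ((-(2 * π * k / T * t) : ℝ) : ℂ) * Complex.I := by push_cast; ring
      rw [h2, Complex.exp_mul_I, ← Complex.ofReal_cos, ← Complex.ofReal_sin, cos_neg, sin_neg]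
      simp only [smul_eq_mul]
      push_cast
      ring
    rw [fourierCoeffOn_eq_integral, h1, norm_smul, mul_pow, sub_zero, Complex.sq_norm,
      Complex.normSq_add_mul_I]
    simp
    ring
  simp_rw [hcoef] at hpars
  have hnorm : ∫ t in (0 : ℝ)..T, ‖((g t : ℝ) : ℂ)‖ ^ 2 = ‖g‖ ^ 2 := by
    rw [← integral_intervalMeasure hT, ← real_inner_self_eq_norm_sq, L2.inner_def]
    refine integral_congr_ae (ae_of_all _ fun t => ?_)
    simp [sq]
  rw [hnorm, sub_zero, smul_eq_mul] at hpars
  have h3 : HasSum (fun k => (A k ^ 2 + B k ^ 2) / T) (‖g‖ ^ 2) := by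
    have := hpars.mul_left T
    rw [← mul_assoc, mul_inv_cancel₀ hT.ne', one_mul] at this
    refine this.congr_fun ?_
    intro k
    field_simp
  have h4 : Summable fun k => 2 * A k * B k / T := by
    refine Summable.of_norm_bounded h3.summable fun k => ?_
    rw [norm_eq_abs, abs_div, abs_of_pos hT]
    refine div_le_div_of_nonneg_right ?_ hT.le
    exact abs_le.2 ⟨by nlinarith [sq_nonneg (A k + B k)], by nlinarith [sq_nonneg (A k - B k)]⟩
  have h5 : HasSum (fun k => 2 * A k * B k / T) 0 := by
    have h6 := h4.hasSum
    have h7 : HasSum (fun k => -(2 * A k * B k / T)) (∑' k, 2 * A k * B k / T) := by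
      rw [← (Equiv.neg ℤ).hasSum_iff] at h6
      refine h6.congr_fun fun k => ?_
      have hAk : A (-k) = A k := by
        simp only [hA]
        refine integral_congr_ae (ae_of_all _ fun t => ?_)
        simp only
        rw [show 2 * π * ((-k : ℤ) : ℝ) / T * t = -(2 * π * k / T * t) by push_cast; ring, cos_neg]
      have hBk : B (-k) = -B k := by
        simp only [hB]
        rw [← integral_neg]
        refine integral_congr_ae (ae_of_all _ fun t => ?_)
        simp only
        rw [show 2 * π * ((-k : ℤ) : ℝ) / T * t = -(2 * π * k / T * t) by push_cast; ring, sin_neg,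
          neg_mul]
      simp only [Function.comp, Equiv.neg_apply, hAk, hBk]
      ring
    have h8 := h7.unique h6.neg
    have h9 : ∑' k, 2 * A k * B k / T = 0 := by linarith
    rwa [h9] at h6
  have h10 := h3.add h5
  rw [add_zero] at h10
  refine h10.congr_fun fun k => ?_
  have h11 : inner ℝ (cosWaveLp T k (π / 4)) g = √(2 / T) * (√2 / 2) * (A k + B k) := by
    rw [L2.inner_def, hA, hB, ← integral_add (hAi k) (hBi k), ← integral_const_mul]
    refine integral_congr_ae ?_
    filter_upwards [cosWaveLp_coeFn T k (π / 4)] with t ht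
    rw [ht, cosWave, cos_sub, cos_pi_div_four, sin_pi_div_four]
    simp only [RCLike.inner_apply, conj_trivial]
    ring
  rw [h11, mul_pow, mul_pow, div_pow, sq_sqrt (by positivity), sq_sqrt (by norm_num)]
  field_simp
  ring

theorem exists_rpow_add_le_exp {T c β : ℝ} (hT : 0 ≤ T) (hc : 0 < c) (hβ : 0 ≤ β) :
    ∃ C, 0 ≤ C ∧ ∀ y, 0 ≤ y → (T + y) ^ β ≤ C * exp (c * y) := by
  set d := c / (β + 1) with hd
  have hd0 : 0 < d := by positivity
  have hdc : β * d ≤ c := by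
    rw [hd, ← mul_div_assoc, div_le_iff₀ (by positivity)]
    nlinarith
  refine ⟨d⁻¹ ^ β * exp (β * d * T), by positivity, fun y hy => ?_⟩
  have h1 : T + y ≤ d⁻¹ * exp (d * (T + y)) := by
    rw [inv_mul_eq_div, le_div_iff₀ hd0]
    linarith [add_one_le_exp (d * (T + y))]
  calc (T + y) ^ β ≤ (d⁻¹ * exp (d * (T + y))) ^ β := rpow_le_rpow (by positivity) h1 hβ
    _ = d⁻¹ ^ β * exp (β * d * T) * exp (β * d * y) := by
        rw [mul_rpow (by positivity) (exp_pos _).le, ← exp_mul, mul_assoc (d⁻¹ ^ β), ← exp_add]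
        ring_nf
    _ ≤ _ := by gcongr

theorem norm_ofReal_sub_mul_I_le {t y : ℝ} (ht : 0 ≤ t) (hy : 0 ≤ y) :
    ‖(t : ℂ) - y * Complex.I‖ ≤ t + y := by
  refine (norm_sub_le _ _).trans ?_
  simp [abs_of_nonneg ht, abs_of_nonneg hy]

theorem le_norm_ofReal_sub_mul_I (t y : ℝ) : t ≤ ‖(t : ℂ) - y * Complex.I‖ := by
  have := Complex.re_le_norm ((t : ℂ) - y * Complex.I)
  simpa using this

theorem le_norm_ofReal_sub_mul_I' (t y : ℝ) : y ≤ ‖(t : ℂ) - y * Complex.I‖ := by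
  have h2 := Complex.abs_im_le_norm ((t : ℂ) - y * Complex.I)
  have h3 : ((t : ℂ) - y * Complex.I).im = -y := by simp
  rw [h3, abs_neg] at h2
  exact (le_abs_self y).trans h2

theorem exists_norm_rpow_le {T c : ℝ} (hT : 0 ≤ T) (hc : 0 < c) (β : ℝ) :
    ∃ C, 0 ≤ C ∧ ∀ t, 0 < t → t ≤ T → ∀ y : ℝ, 0 ≤ y →
      ‖(t : ℂ) - y * Complex.I‖ ^ β ≤ C * t ^ min β 0 * exp (c * y) := by
  rcases le_total 0 β with hβ | hβ
  · obtain ⟨C, hC, h⟩ := exists_rpow_add_le_exp hT hc hβ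
    refine ⟨C, hC, fun t ht htT y hy => ?_⟩
    rw [min_eq_right hβ, rpow_zero, mul_one]
    refine (rpow_le_rpow (norm_nonneg _) ?_ hβ).trans (h y hy)
    linarith [norm_ofReal_sub_mul_I_le ht.le hy]
  · refine ⟨1, zero_le_one, fun t ht htT y hy => ?_⟩
    rw [min_eq_left hβ, one_mul]
    refine (rpow_le_rpow_of_nonpos ht (le_norm_ofReal_sub_mul_I t y) hβ).trans ?_
    exact le_mul_of_one_le_right (by positivity) (one_le_exp (by positivity))

theorem exists_norm_rpow_le' {T c : ℝ} (hT : 0 ≤ T) (hc : 0 < c) (β : ℝ) :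
    ∃ C, 0 ≤ C ∧ ∀ t, 0 ≤ t → t ≤ T → ∀ y : ℝ, 0 < y →
      ‖(t : ℂ) - y * Complex.I‖ ^ β ≤ y ^ β + C * exp (c * y) := by
  rcases le_total 0 β with hβ | hβ
  · obtain ⟨C, hC, h⟩ := exists_rpow_add_le_exp hT hc hβ
    refine ⟨C, hC, fun t ht htT y hy => ?_⟩
    refine ((rpow_le_rpow (norm_nonneg _) ?_ hβ).trans (h y hy.le)).trans ?_
    · linarith [norm_ofReal_sub_mul_I_le ht hy.le]
    · have : 0 ≤ y ^ β := by positivity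
      linarith
  · refine ⟨0, le_rfl, fun t ht htT y hy => ?_⟩
    rw [zero_mul, add_zero]
    exact rpow_le_rpow_of_nonpos hy (le_norm_ofReal_sub_mul_I' t y) hβ

/-- The integrand of the oscillatory remainder. -/
def remKernel (β ω t y : ℝ) : ℂ :=
  ((t : ℂ) - y * Complex.I) ^ (β : ℂ) * (exp (-(ω * y)) : ℝ)

theorem measurable_remKernel (β ω t : ℝ) : Measurable (remKernel β ω t) := by
  unfold remKernel
  fun_prop

theorem norm_remKernel (β ω t y : ℝ) :
    ‖remKernel β ω t y‖ = ‖(t : ℂ) - y * Complex.I‖ ^ β * exp (-(ω * y)) := by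
  rw [remKernel, norm_mul, Complex.norm_cpow_real, Complex.norm_real, norm_eq_abs, abs_exp]

theorem integrableOn_rpow_mul_exp_neg_mul {β ω : ℝ} (hβ : -1 < β) (hω : 0 < ω) :
    IntegrableOn (fun y : ℝ => y ^ β * exp (-(ω * y))) (Set.Ioi 0) := by
  have := integrableOn_rpow_mul_exp_neg_mul_rpow (s := β) (p := 1) hβ one_pos hω
  simpa using this

/-- Uniform integrable majorant for the remainder integrand. -/
theorem exists_remKernel_bound {T β ω : ℝ} (hT : 0 ≤ T) (hβ : -1 < β) (hω : 0 < ω) :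
    ∃ g : ℝ → ℝ, IntegrableOn g (Set.Ioi 0) ∧ ∀ t, 0 ≤ t → t ≤ T → ∀ y ∈ Set.Ioi (0 : ℝ),
      ‖remKernel β ω t y‖ ≤ g y := by
  obtain ⟨C, hC, h⟩ := exists_norm_rpow_le' hT (half_pos hω) β
  refine ⟨fun y => y ^ β * exp (-(ω * y)) + C * exp (-(ω / 2) * y),
    (integrableOn_rpow_mul_exp_neg_mul hβ hω).add
      ((integrableOn_exp_mul_Ioi (by linarith) 0).const_mul C), fun t ht htT y hy => ?_⟩
  rw [norm_remKernel]
  refine (mul_le_mul_of_nonneg_right (h t ht htT y hy) (exp_pos _).le).trans_eq ?_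
  rw [add_mul, mul_assoc, ← exp_add]
  ring_nf

theorem integrableOn_remKernel {β ω t : ℝ} (hβ : -1 < β) (hω : 0 < ω) (ht : 0 ≤ t) :
    IntegrableOn (remKernel β ω t) (Set.Ioi 0) := by
  obtain ⟨g, hg, h⟩ := exists_remKernel_bound ht hβ hω
  refine Integrable.mono' hg (measurable_remKernel β ω t).aestronglyMeasurable ?_
  exact (ae_restrict_iff' measurableSet_Ioi).2 (ae_of_all _ (h t ht le_rfl))

/-- The oscillatory remainder of the fractional integral of `exp (i ω ·)`. -/
def oscRem (β ω t : ℝ) : ℂ := -Complex.I * ∫ y in Set.Ioi (0 : ℝ), remKernel β ω t y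

theorem tendsto_oscRem_zero {β ω : ℝ} (hβ : -1 < β) (hω : 0 < ω) :
    Tendsto (oscRem β ω) (nhdsWithin 0 (Set.Ioi 0)) (nhds (oscRem β ω 0)) := by
  unfold oscRem
  refine Tendsto.const_mul _ ?_
  obtain ⟨g, hg, h⟩ := exists_remKernel_bound zero_le_one hβ hω
  refine tendsto_integral_filter_of_dominated_convergence g ?_ ?_ hg ?_
  · exact Eventually.of_forall fun t => (measurable_remKernel β ω t).aestronglyMeasurable
  · filter_upwards [Ioo_mem_nhdsGT (zero_lt_one (α := ℝ))] with t ht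
    exact (ae_restrict_iff' measurableSet_Ioi).2 (ae_of_all _ (h t ht.1.le ht.2.le))
  · refine (ae_restrict_iff' measurableSet_Ioi).2 (ae_of_all _ fun y hy => ?_)
    refine tendsto_nhdsWithin_of_tendsto_nhds ?_
    have hy' : (0 : ℝ) < y := hy
    have : ContinuousAt (fun t : ℝ => remKernel β ω t y) 0 := by
      unfold remKernel
      refine ContinuousAt.mul ?_ continuousAt_const
      refine ContinuousAt.cpow (by fun_prop) continuousAt_const ?_
      rw [Complex.mem_slitPlane_iff]
      right
      simp [hy'.ne']
    exact this

theorem oscRem_zero {β ω : ℝ} (hβ : -1 < β) (hω : 0 < ω) :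
    oscRem β ω 0 = (Real.Gamma (β + 1) * ω ^ (-(β + 1)) : ℝ) *
      Complex.exp ((-(π * (β + 1) / 2) : ℝ) * Complex.I) := by
  have h1 : ∀ y ∈ Set.Ioi (0 : ℝ), remKernel β ω 0 y =
      ((y ^ β * exp (-(ω * y)) : ℝ) : ℂ) * Complex.exp ((-(π * β / 2) : ℝ) * Complex.I) := by
    intro y hy
    have hy' : (0 : ℝ) < y := hy
    have h2 : ((0 : ℝ) : ℂ) - y * Complex.I = (y : ℂ) * (-Complex.I) := by simp
    rw [remKernel, h2, Complex.cpow_def_of_ne_zero (by simp [hy'.ne']),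
      Complex.log_ofReal_mul hy' (by simp), Complex.log_neg_I, rpow_def_of_pos hy']
    push_cast
    rw [add_mul, Complex.exp_add]
    ring_nf
  rw [oscRem, setIntegral_congr_fun measurableSet_Ioi h1, integral_mul_const,
    integral_complex_ofReal]
  have h3 := Real.integral_rpow_mul_exp_neg_mul_Ioi (a := β + 1) (r := ω) (by linarith) hω
  rw [add_sub_cancel_right] at h3
  rw [h3]
  have h4 : Complex.exp ((-(π * (β + 1) / 2) : ℝ) * Complex.I) =
      -Complex.I * Complex.exp ((-(π * β / 2) : ℝ) * Complex.I) := by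
    rw [← Complex.exp_neg_pi_div_two_mul_I, ← Complex.exp_add]
    push_cast
    ring_nf
  rw [h4, one_div, inv_rpow hω.le, rpow_neg hω.le]
  push_cast
  ring

theorem oscRem_sub_oscRem {β ω s t : ℝ} (hβ : -1 < β) (hω : 0 < ω) (hs : 0 < s) (hst : s ≤ t) :
    ∫ u in s..t, ((u ^ β : ℝ) : ℂ) * Complex.exp (-(ω * u : ℝ) * Complex.I) =
      Complex.exp (-(ω * s : ℝ) * Complex.I) * oscRem β ω s -
        Complex.exp (-(ω * t : ℝ) * Complex.I) * oscRem β ω t := by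
  set f : ℂ → ℂ := fun z => z ^ (β : ℂ) * Complex.exp (-ω * z * Complex.I) with hf
  have hvert : ∀ a y : ℝ, f (a + ((-y : ℝ) : ℂ) * Complex.I) =
      Complex.exp (-(ω * a : ℝ) * Complex.I) * remKernel β ω a y := by
    intro a y
    simp only [hf, remKernel]
    rw [mul_left_comm, Complex.ofReal_exp, ← Complex.exp_add]
    push_cast
    congr 2
    · ring
    · linear_combination (ω * y : ℂ) * Complex.I_sq
  have hrect : ∀ Y : ℝ, 0 ≤ Y → (∫ x in s..t, f (x : ℂ)) =
      (∫ x in s..t, f (x + ((-Y : ℝ) : ℂ) * Complex.I)) +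
      (Complex.I * (Complex.exp (-(ω * t : ℝ) * Complex.I) * ∫ y in (0 : ℝ)..Y, remKernel β ω t y)
        - Complex.I *
          (Complex.exp (-(ω * s : ℝ) * Complex.I) * ∫ y in (0 : ℝ)..Y, remKernel β ω s y)) := by
    intro Y hY
    have h1 := Complex.integral_boundary_rect_eq_zero_of_differentiableOn f (s : ℂ)
      (t + ((-Y : ℝ) : ℂ) * Complex.I) ?_
    · have h2 : ∀ a : ℝ, ∫ y in (0 : ℝ)..(-Y), f (a + (y : ℂ) * Complex.I) =
          -(Complex.exp (-(ω * a : ℝ) * Complex.I) * ∫ y in (0 : ℝ)..Y, remKernel β ω a y) := by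
        intro a
        have h3 := intervalIntegral.integral_comp_neg (a := 0) (b := Y)
          (fun y : ℝ => f (a + (y : ℂ) * Complex.I))
        rw [neg_zero] at h3
        rw [← intervalIntegral.integral_const_mul, intervalIntegral.integral_symm, ← h3]
        simp_rw [hvert]
      simp only [Complex.ofReal_re, Complex.ofReal_im, Complex.add_re, Complex.add_im,
        Complex.mul_re, Complex.mul_im, Complex.I_re, Complex.I_im, mul_zero, mul_one, zero_mul,
        sub_zero, add_zero, zero_add, Complex.ofReal_zero, h2, smul_eq_mul] at h1
      linear_combination h1
    · intro z hz
      have hz1 : z.re ∈ Set.uIcc s t := by simpa using hz.1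
      rw [Set.uIcc_of_le hst] at hz1
      have hz2 : z ∈ Complex.slitPlane := Or.inl (hs.trans_le hz1.1)
      refine DifferentiableAt.differentiableWithinAt ?_
      refine DifferentiableAt.mul ?_ (by fun_prop)
      exact differentiableAt_id.cpow (differentiableAt_const _) hz2
  have hbot : Tendsto (fun Y : ℝ => ∫ x in s..t, f (x + ((-Y : ℝ) : ℂ) * Complex.I)) atTop
      (nhds 0) := by
    obtain ⟨C, hC, h⟩ := exists_norm_rpow_le (hs.le.trans hst) (half_pos hω) β
    have h1 : Tendsto (fun Y : ℝ => C * s ^ min β 0 * exp (-(ω / 2) * Y) * |t - s|) atTop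
        (nhds 0) := by
      have : Tendsto (fun Y : ℝ => exp (-(ω / 2) * Y)) atTop (nhds 0) :=
        tendsto_exp_atBot.comp (tendsto_id.const_mul_atTop_of_neg (by linarith))
      simpa using (this.const_mul (C * s ^ min β 0)).mul_const |t - s|
    refine squeeze_zero_norm' ?_ h1
    filter_upwards [eventually_ge_atTop 0] with Y hY
    refine intervalIntegral.norm_integral_le_of_norm_le_const fun x hx => ?_
    rw [Set.uIoc_of_le hst] at hx
    have hx0 : 0 < x := hs.trans hx.1
    rw [hvert, norm_mul, norm_remKernel]
    have h2 : ‖Complex.exp (-(ω * x : ℝ) * Complex.I)‖ = 1 := by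
      rw [← Complex.ofReal_neg, Complex.norm_exp_ofReal_mul_I]
    rw [h2, one_mul]
    refine (mul_le_mul_of_nonneg_right (h x hx0 hx.2 Y hY) (exp_pos _).le).trans ?_
    rw [mul_assoc, ← exp_add]
    have h3 : x ^ min β 0 ≤ s ^ min β 0 :=
      rpow_le_rpow_of_nonpos hs hx.1.le (min_le_right _ _)
    have h4 : ω / 2 * Y + -(ω * Y) = -(ω / 2) * Y := by ring
    rw [h4]
    gcongr
  have hlim : ∀ a : ℝ, 0 ≤ a → Tendsto (fun Y => Complex.I * (Complex.exp (-(ω * a : ℝ) * Complex.I)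
      * ∫ y in (0 : ℝ)..Y, remKernel β ω a y)) atTop
      (nhds (-(Complex.exp (-(ω * a : ℝ) * Complex.I) * oscRem β ω a))) := by
    intro a ha
    have h1 := intervalIntegral_tendsto_integral_Ioi (0 : ℝ)
      (integrableOn_remKernel hβ hω ha) tendsto_id
    have h2 : -(Complex.exp (-(ω * a : ℝ) * Complex.I) * oscRem β ω a) = Complex.I *
        (Complex.exp (-(ω * a : ℝ) * Complex.I) * ∫ y in Set.Ioi (0 : ℝ), remKernel β ω a y) := by
      rw [oscRem]
      ring
    rw [h2]
    exact (h1.const_mul _).const_mul _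
  have hall := hbot.add ((hlim t (hs.le.trans hst)).sub (hlim s hs.le))
  have hconst : Tendsto (fun _ : ℝ => ∫ x in s..t, f (x : ℂ)) atTop
      (nhds (∫ x in s..t, f (x : ℂ))) := tendsto_const_nhds
  have hcongr := hconst.congr' (by
    filter_upwards [eventually_ge_atTop 0] with Y hY
    exact hrect Y hY)
  have heq := tendsto_nhds_unique hcongr hall
  have h5 : ∫ u in s..t, ((u ^ β : ℝ) : ℂ) * Complex.exp (-(ω * u : ℝ) * Complex.I) =
      ∫ x in s..t, f (x : ℂ) := by
    refine intervalIntegral.integral_congr fun x hx => ?_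
    rw [Set.uIcc_of_le hst] at hx
    simp only [hf]
    rw [Complex.ofReal_cpow (hs.le.trans hx.1)]
    push_cast
    ring_nf
  rw [h5, heq]
  ring

theorem intervalIntegrable_rpow_mul_cexp {β : ℝ} (hβ : -1 < β) (ω t : ℝ) :
    IntervalIntegrable (fun u : ℝ => ((u ^ β : ℝ) : ℂ) * Complex.exp (-(ω * u : ℝ) * Complex.I))
      volume 0 t :=
  IntervalIntegrable.mul_continuousOn (f := fun u : ℝ => ((u ^ β : ℝ) : ℂ))
    ⟨(intervalIntegral.intervalIntegrable_rpow' hβ).1.ofReal,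
      (intervalIntegral.intervalIntegrable_rpow' hβ).2.ofReal⟩ (by fun_prop)

theorem integral_rpow_mul_cexp {β ω t : ℝ} (hβ : -1 < β) (hω : 0 < ω) (ht : 0 < t) :
    ∫ u in (0 : ℝ)..t, ((u ^ β : ℝ) : ℂ) * Complex.exp (-(ω * u : ℝ) * Complex.I) =
      oscRem β ω 0 - Complex.exp (-(ω * t : ℝ) * Complex.I) * oscRem β ω t := by
  have hint := intervalIntegrable_rpow_mul_cexp hβ ω t
  have h1 : Tendsto (fun s : ℝ => ∫ u in s..t, ((u ^ β : ℝ) : ℂ) *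
      Complex.exp (-(ω * u : ℝ) * Complex.I)) (nhdsWithin 0 (Set.Ioi 0))
      (nhds (∫ u in (0 : ℝ)..t, ((u ^ β : ℝ) : ℂ) * Complex.exp (-(ω * u : ℝ) * Complex.I))) := by
    have h2 := intervalIntegral.continuousOn_primitive_interval_left
      (μ := volume) (a := 0) (b := t) (intervalIntegrable_iff_integrableOn_Icc_of_le ht.le |>.1 hint |> fun h => by
        rwa [Set.uIcc_of_le ht.le])
    have h3 := h2 0 (Set.left_mem_uIcc)
    refine Tendsto.mono_left h3 ?_
    rw [Set.uIcc_of_le ht.le]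
    exact nhdsWithin_le_of_mem (mem_of_superset (Ioo_mem_nhdsGT ht) Set.Ioo_subset_Icc_self)
  have h4 : Tendsto (fun s : ℝ => Complex.exp (-(ω * s : ℝ) * Complex.I) * oscRem β ω s -
      Complex.exp (-(ω * t : ℝ) * Complex.I) * oscRem β ω t) (nhdsWithin 0 (Set.Ioi 0))
      (nhds (1 * oscRem β ω 0 - Complex.exp (-(ω * t : ℝ) * Complex.I) * oscRem β ω t)) := by
    refine ((Tendsto.mul ?_ (tendsto_oscRem_zero hβ hω)).sub_const _)
    refine tendsto_nhdsWithin_of_tendsto_nhds ?_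
    have : Continuous fun s : ℝ => Complex.exp (-(ω * s : ℝ) * Complex.I) := by fun_prop
    simpa using this.tendsto 0
  rw [one_mul] at h4
  refine tendsto_nhds_unique h1 (h4.congr' ?_)
  filter_upwards [Ioo_mem_nhdsGT ht] with s hs
  exact (oscRem_sub_oscRem hβ hω hs.1 hs.2.le).symm

theorem exists_integral_norm_remKernel_le {T ω₁ : ℝ} (hT : 0 ≤ T) (hω₁ : 0 < ω₁) (β : ℝ) :
    ∃ C, 0 ≤ C ∧ ∀ ω, ω₁ ≤ ω → ∀ t, 0 < t → t ≤ T →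
      ∫ y in Set.Ioi (0 : ℝ), ‖remKernel β ω t y‖ ≤ C * t ^ min β 0 / ω := by
  obtain ⟨C, hC, h⟩ := exists_norm_rpow_le hT (half_pos hω₁) β
  refine ⟨2 * C, by positivity, fun ω hω t ht htT => ?_⟩
  have hω0 : 0 < ω := hω₁.trans_le hω
  have h1 : ∀ y ∈ Set.Ioi (0 : ℝ), ‖remKernel β ω t y‖ ≤
      C * t ^ min β 0 * exp (-(ω / 2) * y) := by
    intro y hy
    have hy0 : (0 : ℝ) < y := hy
    rw [norm_remKernel]
    refine (mul_le_mul_of_nonneg_right (h t ht htT y hy0.le) (exp_pos _).le).trans ?_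
    rw [mul_assoc, ← exp_add]
    gcongr
    nlinarith
  have h2 : ∫ y in Set.Ioi (0 : ℝ), C * t ^ min β 0 * exp (-(ω / 2) * y) =
      2 * C * t ^ min β 0 / ω := by
    rw [integral_const_mul, integral_exp_mul_Ioi (by linarith) 0]
    field_simp
    simp
  rw [← h2]
  refine integral_mono_of_nonneg (ae_of_all _ fun y => norm_nonneg _)
    ((integrableOn_exp_mul_Ioi (by linarith) 0).const_mul _) ?_
  exact (ae_restrict_iff' measurableSet_Ioi).2 (ae_of_all _ h1)

theorem norm_oscRem_le (β ω t : ℝ) :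
    ‖oscRem β ω t‖ ≤ ∫ y in Set.Ioi (0 : ℝ), ‖remKernel β ω t y‖ := by
  rw [oscRem, norm_mul, norm_neg, Complex.norm_I, one_mul]
  exact norm_integral_le_integral_norm _

theorem exists_cpow_taylor (β : ℂ) : ∃ a, 0 < a ∧ a < 1 ∧ ∃ C, 0 ≤ C ∧ ∃ q : ℕ → ℂ,
    ∀ z : ℂ, ‖z‖ ≤ 1 / 3 → ∀ m : ℕ,
      ‖(1 + z) ^ β - ∑ j ∈ Finset.range m, q j * z ^ j‖ ≤ C * a ^ m := by
  obtain ⟨a, ha, C, hC, h⟩ := (Complex.one_add_cpow_hasFPowerSeriesOnBall_zero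
    (a := β)).uniform_geometric_approx' (r' := 1 / 2) (by
      rw [← ENNReal.coe_one, ENNReal.coe_lt_coe]; exact NNReal.half_lt_self one_ne_zero)
  refine ⟨a, ha.1, ha.2, C, hC.le, fun j => Ring.choose β j, fun z hz m => ?_⟩
  have hzb : z ∈ Metric.ball (0 : ℂ) ((1 / 2 : NNReal) : ℝ) := by
    rw [mem_ball_zero_iff]
    push_cast
    linarith
  have h1 := h z hzb m
  have h2 : (binomialSeries ℂ β).partialSum m z =
      ∑ j ∈ Finset.range m, Ring.choose β j * z ^ j := by
    simp [FormalMultilinearSeries.partialSum, binomialSeries, mul_comm]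
  rw [zero_add, h2] at h1
  refine h1.trans ?_
  have ha0 := ha.1
  gcongr
  push_cast
  have : ‖z‖ / (1 / 2) ≤ 1 := by linarith
  nlinarith

theorem ofReal_sub_mul_I_cpow {p t y : ℝ} (hp : 0 < p) (ht : |t - p| ≤ p / 3) (β : ℂ) :
    ((t : ℂ) - y * Complex.I) ^ β = ((p : ℂ) - y * Complex.I) ^ β *
      (1 + ((t - p : ℝ) : ℂ) / ((p : ℂ) - y * Complex.I)) ^ β := by
  set w : ℂ := (p : ℂ) - y * Complex.I with hw
  have hwre : w.re = p := by simp [hw]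
  have hw0 : w ≠ 0 := fun h => by rw [h] at hwre; simp at hwre; linarith
  have hpw : p ≤ ‖w‖ := le_norm_ofReal_sub_mul_I p y
  set z : ℂ := ((t - p : ℝ) : ℂ) / w with hz
  have hzn : ‖z‖ ≤ 1 / 3 := by
    rw [hz, norm_div, Complex.norm_real, norm_eq_abs, div_le_iff₀ (by linarith)]
    linarith
  have hzre : 0 < (1 + z).re := by
    have := (abs_le.1 ((Complex.abs_re_le_norm z).trans hzn)).1
    simp only [Complex.add_re, Complex.one_re]
    linarith
  have hz0 : 1 + z ≠ 0 := fun h => by rw [h] at hzre; simp at hzre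
  have h1 : (t : ℂ) - y * Complex.I = w * (1 + z) := by
    rw [hz, mul_add, mul_div_cancel₀ _ hw0, hw]
    push_cast
    ring
  have ha1 : |w.arg| < π / 2 := Complex.abs_arg_lt_pi_div_two_iff.2
    (Or.inl (by rw [hwre]; exact hp))
  have ha2 : |(1 + z).arg| < π / 2 := Complex.abs_arg_lt_pi_div_two_iff.2 (Or.inl hzre)
  rw [abs_lt] at ha1 ha2
  rw [h1, Complex.cpow_def_of_ne_zero (mul_ne_zero hw0 hz0), Complex.cpow_def_of_ne_zero hw0,
    Complex.cpow_def_of_ne_zero hz0, Complex.log_mul hw0 hz0 ⟨by linarith, by linarith⟩, add_mul,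
    Complex.exp_add]

theorem norm_oscRem_sub_poly_le (β : ℝ) (hβ : -1 < β) : ∃ a, 0 < a ∧ a < 1 ∧ ∃ C, 0 ≤ C ∧
    ∀ ω, 0 < ω → ∀ p, 0 < p → ∀ m : ℕ, ∃ c : ℕ → ℂ, ∀ t, |t - p| ≤ p / 3 →
      ‖oscRem β ω t - ∑ j ∈ Finset.range m, c j * ((t - p : ℝ) : ℂ) ^ j‖ ≤
        C * a ^ m * ∫ y in Set.Ioi (0 : ℝ), ‖remKernel β ω p y‖ := by
  obtain ⟨a, ha0, ha1, C, hC, q, hq⟩ := exists_cpow_taylor β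
  refine ⟨a, ha0, ha1, C, hC, fun ω hω p hp m => ?_⟩
  set w : ℝ → ℂ := fun y => (p : ℂ) - y * Complex.I with hw
  have hpw : ∀ y, p ≤ ‖w y‖ := fun y => le_norm_ofReal_sub_mul_I p y
  have hw0 : ∀ y, w y ≠ 0 := fun y => norm_pos_iff.1 (hp.trans_le (hpw y))
  have hint := integrableOn_remKernel hβ hω hp.le
  have hint' : ∀ j : ℕ, IntegrableOn (fun y => ((w y)⁻¹ ^ j) * remKernel β ω p y)
      (Set.Ioi 0) := by
    intro j
    refine Integrable.bdd_mul (c := p⁻¹ ^ j) hint ?_ (ae_of_all _ fun y => ?_)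
    · refine Measurable.aestronglyMeasurable ?_
      simp only [hw]
      fun_prop
    · rw [norm_pow, norm_inv]
      exact pow_le_pow_left₀ (by positivity) (inv_anti₀ hp (hpw y)) j
  refine ⟨fun j => -Complex.I * (q j * ∫ y in Set.Ioi (0 : ℝ),
    ((w y)⁻¹ ^ j) * remKernel β ω p y), fun t ht => ?_⟩
  have ht0 : 0 ≤ t := by have := (abs_le.1 ht).1; linarith
  have h1 : oscRem β ω t - ∑ j ∈ Finset.range m, -Complex.I * (q j * ∫ y in Set.Ioi (0 : ℝ),
      ((w y)⁻¹ ^ j) * remKernel β ω p y) * ((t - p : ℝ) : ℂ) ^ j =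
      -Complex.I * ∫ y in Set.Ioi (0 : ℝ), (remKernel β ω t y -
        ∑ j ∈ Finset.range m, q j * ((t - p : ℝ) : ℂ) ^ j *
          (((w y)⁻¹ ^ j) * remKernel β ω p y)) := by
    rw [integral_sub (integrableOn_remKernel hβ hω ht0)
      (integrable_finsetSum _ fun j _ => (hint' j).const_mul _),
      integral_finsetSum _ fun j _ => (hint' j).const_mul _, oscRem, mul_sub, Finset.mul_sum]
    congr 1
    refine Finset.sum_congr rfl fun j _ => ?_
    rw [integral_const_mul]
    ring
  rw [h1, norm_mul, norm_neg, Complex.norm_I, one_mul, ← integral_const_mul]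
  refine norm_integral_le_of_norm_le (hint.norm.const_mul _) (ae_of_all _ fun y => ?_)
  have h2 : remKernel β ω t y - ∑ j ∈ Finset.range m, q j * ((t - p : ℝ) : ℂ) ^ j *
      (((w y)⁻¹ ^ j) * remKernel β ω p y) =
      ((1 + ((t - p : ℝ) : ℂ) / w y) ^ (β : ℂ) -
        ∑ j ∈ Finset.range m, q j * (((t - p : ℝ) : ℂ) / w y) ^ j) * remKernel β ω p y := by
    rw [sub_mul, Finset.sum_mul]
    congr 1
    · simp only [remKernel, hw]
      rw [ofReal_sub_mul_I_cpow hp ht]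
      ring
    · refine Finset.sum_congr rfl fun j _ => ?_
      rw [div_eq_mul_inv, mul_pow]
      ring
  rw [h2, norm_mul]
  refine mul_le_mul_of_nonneg_right (hq _ ?_ m) (norm_nonneg _)
  rw [norm_div, Complex.norm_real, norm_eq_abs, div_le_iff₀ (by linarith [hpw y])]
  linarith [hpw y]

/-- The kernel of fractional integration, `(t - r)₊ ^ β`. -/
def fracKer (β t r : ℝ) : ℝ := if r < t then (t - r) ^ β else 0

theorem measurable_fracKer_uncurry (β : ℝ) :
    Measurable (Function.uncurry (fracKer β)) := by
  unfold fracKer Function.uncurry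
  exact Measurable.ite (measurableSet_lt measurable_snd measurable_fst) (by fun_prop)
    measurable_const

theorem measurable_fracKer (β t : ℝ) : Measurable (fracKer β t) :=
  (measurable_fracKer_uncurry β).comp measurable_prodMk_left

theorem fracKer_mul_eq_indicator (β t : ℝ) (f : ℝ → ℝ) :
    (fun r => fracKer β t r * f r) = (Set.Iio t).indicator fun r => (t - r) ^ β * f r := by
  funext r
  by_cases h : r < t <;> simp [fracKer, h]

theorem Icc_inter_Iio_eq_Ico {T t : ℝ} (htT : t ≤ T) :
    Set.Iio t ∩ Set.Icc 0 T = Set.Ico 0 t := by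
  ext r
  simp only [Set.mem_inter_iff, Set.mem_Iio, Set.mem_Icc, Set.mem_Ico]
  constructor
  · rintro ⟨h1, h2, -⟩
    exact ⟨h2, h1⟩
  · rintro ⟨h1, h2⟩
    exact ⟨h2, h1, by linarith⟩

theorem integral_fracKer_mul {T t : ℝ} (ht : 0 ≤ t) (htT : t ≤ T) (β : ℝ) (f : ℝ → ℝ) :
    ∫ r, fracKer β t r * f r ∂(intervalMeasure T) = ∫ r in (0 : ℝ)..t, (t - r) ^ β * f r := by
  rw [fracKer_mul_eq_indicator, integral_indicator measurableSet_Iio,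
    Measure.restrict_restrict measurableSet_Iio, Icc_inter_Iio_eq_Ico htT,
      integral_Ico_eq_integral_Ioc,
    intervalIntegral.integral_of_le ht]

theorem intervalIntegrable_sub_rpow {β : ℝ} (hβ : -1 < β) (t : ℝ) :
    IntervalIntegrable (fun r => (t - r) ^ β) volume 0 t := by
  have := (intervalIntegral.intervalIntegrable_rpow' (a := t) (b := 0) hβ).comp_sub_left t
  simpa using this

theorem integrable_fracKer {T t β : ℝ} (hβ : -1 < β) (ht : 0 ≤ t) (htT : t ≤ T) :
    Integrable (fracKer β t) (intervalMeasure T) := by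
  have h := fracKer_mul_eq_indicator β t (fun _ => 1)
  simp only [mul_one] at h
  rw [show fracKer β t = fun r => fracKer β t r from rfl, h,
    integrable_indicator_iff measurableSet_Iio, IntegrableOn,
    Measure.restrict_restrict measurableSet_Iio, Icc_inter_Iio_eq_Ico htT]
  exact (intervalIntegrable_iff_integrableOn_Ico_of_le ht).1 (intervalIntegrable_sub_rpow hβ t)

theorem fracKer_sq (β t r : ℝ) : fracKer β t r ^ 2 = fracKer (2 * β) t r := by
  unfold fracKer
  split_ifs with h
  · rw [← rpow_natCast, ← rpow_mul (by linarith), mul_comm]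
    norm_num
  · simp

theorem memLp_fracKer {T t β : ℝ} (hβ : -1 / 2 < β) (ht : 0 ≤ t) (htT : t ≤ T) :
    MemLp (fracKer β t) 2 (intervalMeasure T) := by
  rw [memLp_two_iff_integrable_sq (measurable_fracKer β t).aestronglyMeasurable]
  simp_rw [fracKer_sq]
  exact integrable_fracKer (by linarith) ht htT

theorem fracKer_nonneg (β t r : ℝ) : 0 ≤ fracKer β t r := by
  unfold fracKer
  split_ifs with h
  · exact rpow_nonneg (by linarith) _
  · exact le_rfl

theorem integral_fracKer {T t β : ℝ} (hβ : -1 < β) (ht : 0 ≤ t) (htT : t ≤ T) :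
    ∫ r, fracKer β t r ∂(intervalMeasure T) = t ^ (β + 1) / (β + 1) := by
  have h := integral_fracKer_mul ht htT β (fun _ => 1)
  simp only [mul_one] at h
  rw [h, intervalIntegral.integral_comp_sub_left (fun x => x ^ β), sub_self, sub_zero,
    integral_rpow (Or.inl hβ), zero_rpow (by linarith), sub_zero]

/-- The fractional integral of the `k`-th element of the real Fourier basis. -/
def fracWave (T β : ℝ) (k : ℤ) (t : ℝ) : ℝ :=
  ∫ r, fracKer β t r * cosWave T k (π / 4) r ∂(intervalMeasure T)

theorem measurable_fracWave (T β : ℝ) (k : ℤ) : Measurable (fracWave T β k) := by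
  have h : Measurable fun p : ℝ × ℝ => fracKer β p.1 p.2 * cosWave T k (π / 4) p.2 :=
    (measurable_fracKer_uncurry β).mul ((continuous_cosWave T k (π / 4)).measurable.comp
      measurable_snd)
  exact (h.stronglyMeasurable.integral_prod_right' (ν := intervalMeasure T)).measurable

theorem abs_cosWave_le (T : ℝ) (k : ℤ) (φ t : ℝ) : |cosWave T k φ t| ≤ √(2 / T) := by
  rw [cosWave, abs_mul, abs_of_nonneg (sqrt_nonneg _)]
  exact mul_le_of_le_one_right (sqrt_nonneg _) (abs_cos_le_one _)

theorem abs_fracWave_le {T β t : ℝ} (hβ : -1 < β) (ht : 0 ≤ t) (htT : t ≤ T) (k : ℤ) :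
    |fracWave T β k t| ≤ T ^ (β + 1) / (β + 1) * √(2 / T) := by
  have h1 : |fracWave T β k t| ≤ ∫ r, fracKer β t r * √(2 / T) ∂(intervalMeasure T) := by
    rw [fracWave, ← norm_eq_abs]
    refine norm_integral_le_of_norm_le ((integrable_fracKer hβ ht htT).mul_const _)
      (ae_of_all _ fun r => ?_)
    rw [norm_eq_abs, abs_mul, abs_of_nonneg (fracKer_nonneg β t r)]
    exact mul_le_mul_of_nonneg_left (abs_cosWave_le _ _ _ _) (fracKer_nonneg β t r)
  refine h1.trans ?_
  rw [integral_mul_const, integral_fracKer hβ ht htT]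
  have : 0 < β + 1 := by linarith
  gcongr

/-- The asymptotic singular values of fractional integration. -/
def fracSing (T β : ℝ) (k : ℤ) : ℝ := Real.Gamma (β + 1) * (2 * π * |(k : ℝ)| / T) ^ (-(β + 1))

/-- The phase shift caused by fractional integration. -/
def fracPhase (β : ℝ) (k : ℤ) : ℝ := (k.sign : ℝ) * (π * (β + 1) / 2) + π / 4

/-- The difference of the asymptotic singular wave and the fractional integral. -/
def remWave (T β : ℝ) (k : ℤ) (t : ℝ) : ℝ :=
  fracSing T β k * cosWave T k (fracPhase β k) t - fracWave T β k t

theorem cos_sign_mul {k : ℤ} (hk : k ≠ 0) (x y : ℝ) :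
    cos ((k.sign : ℝ) * x - y) = cos (x - (k.sign : ℝ) * y) := by
  rcases hk.lt_or_gt with h | h
  · rw [Int.sign_eq_neg_one_of_neg h, ← cos_neg]
    push_cast
    ring_nf
  · rw [Int.sign_eq_one_of_pos h]
    push_cast
    ring_nf

theorem sign_mul_sign_cast {k : ℤ} (hk : k ≠ 0) : (k.sign : ℝ) * (k.sign : ℝ) = 1 := by
  rcases hk.lt_or_gt with h | h
  · rw [Int.sign_eq_neg_one_of_neg h]; norm_num
  · rw [Int.sign_eq_one_of_pos h]; norm_num

theorem remWave_eq {T β t : ℝ} (hT : 0 < T) (hβ : -1 < β) (ht : 0 < t) (htT : t ≤ T) {k : ℤ}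
    (hk : k ≠ 0) : remWave T β k t = √(2 / T) *
      (Complex.exp ((-(k.sign * (π / 4)) : ℝ) * Complex.I) *
        oscRem β (2 * π * |(k : ℝ)| / T) t).re := by
  set ω : ℝ := 2 * π * |(k : ℝ)| / T with hω
  have hω0 : 0 < ω := by positivity
  have hfreq : ∀ φ s : ℝ, cosWave T k φ s = √(2 / T) * cos (ω * s - k.sign * φ) := by
    intro φ s
    rw [cosWave, ← cos_sign_mul hk]
    congr 3
    have h1 : (k : ℝ) = k.sign * |(k : ℝ)| := by
      have := Int.sign_mul_abs k
      exact_mod_cast this.symm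
    rw [hω]
    nth_rewrite 1 [h1]
    ring
  have h1 := integral_rpow_mul_cexp hβ hω0 ht
  set z : ℂ := Complex.exp ((-(k.sign * (π / 4)) : ℝ) * Complex.I) with hz
  have h2 : ∀ u : ℝ, (z * Complex.exp ((ω * t : ℝ) * Complex.I) *
      (((u ^ β : ℝ) : ℂ) * Complex.exp (-(ω * u : ℝ) * Complex.I))).re =
      u ^ β * cos (ω * (t - u) - k.sign * (π / 4)) := by
    intro u
    have h3 : z * Complex.exp ((ω * t : ℝ) * Complex.I) *
      (((u ^ β : ℝ) : ℂ) * Complex.exp (-(ω * u : ℝ) * Complex.I)) =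
      ((u ^ β : ℝ) : ℂ) * Complex.exp ((ω * (t - u) - k.sign * (π / 4) : ℝ) * Complex.I) := by
      rw [hz, mul_left_comm, ← Complex.exp_add, ← Complex.exp_add]
      push_cast
      ring_nf
    rw [h3, Complex.re_ofReal_mul, Complex.exp_ofReal_mul_I_re]
  have h4 : fracWave T β k t = √(2 / T) * (z * Complex.exp ((ω * t : ℝ) * Complex.I) *
      ∫ u in (0 : ℝ)..t, ((u ^ β : ℝ) : ℂ) * Complex.exp (-(ω * u : ℝ) * Complex.I)).re := by
    rw [fracWave, integral_fracKer_mul ht.le htT]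
    have h5 := intervalIntegral.integral_comp_sub_left (a := 0) (b := t)
      (fun r => (t - r) ^ β * cosWave T k (π / 4) r) t
    rw [sub_self, sub_zero] at h5
    rw [← h5, ← intervalIntegral.integral_const_mul]
    have h6 := Complex.reCLM.intervalIntegral_comp_comm
      ((intervalIntegrable_rpow_mul_cexp hβ ω t).const_mul
        (z * Complex.exp ((ω * t : ℝ) * Complex.I)))
    simp only [Complex.reCLM_apply] at h6
    rw [← h6, ← intervalIntegral.integral_const_mul]
    refine intervalIntegral.integral_congr fun u _ => ?_
    rw [h2, hfreq, sub_sub_cancel]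
    ring
  have h7 : fracSing T β k * cosWave T k (fracPhase β k) t = √(2 / T) *
      (z * Complex.exp ((ω * t : ℝ) * Complex.I) * oscRem β ω 0).re := by
    rw [oscRem_zero hβ hω0, hfreq, fracSing, ← hω]
    have h8 : z * Complex.exp ((ω * t : ℝ) * Complex.I) *
        ((Real.Gamma (β + 1) * ω ^ (-(β + 1)) : ℝ) *
          Complex.exp ((-(π * (β + 1) / 2) : ℝ) * Complex.I)) =
        ((Real.Gamma (β + 1) * ω ^ (-(β + 1)) : ℝ) : ℂ) *
          Complex.exp ((ω * t - k.sign * fracPhase β k : ℝ) * Complex.I) := by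
      rw [hz, mul_left_comm, ← Complex.exp_add, ← Complex.exp_add]
      congr 2
      rw [← add_mul, ← add_mul, fracPhase]
      have h9 : ω * t - k.sign * (k.sign * (π * (β + 1) / 2) + π / 4) =
          -(k.sign * (π / 4)) + ω * t + -(π * (β + 1) / 2) := by
        linear_combination (-(π * (β + 1) / 2)) * sign_mul_sign_cast hk
      rw [h9]
      push_cast
      ring
    rw [h8, Complex.re_ofReal_mul, Complex.exp_ofReal_mul_I_re]
    ring
  rw [remWave, h4, h7, h1, ← mul_sub, ← Complex.sub_re]
  congr 2
  have h9 : Complex.exp ((ω * t : ℝ) * Complex.I) * Complex.exp (-(ω * t : ℝ) * Complex.I) = 1 := by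
    rw [← Complex.exp_add]
    simp
  linear_combination (z * oscRem β ω t) * h9

theorem two_pi_div_le_freq {T : ℝ} (hT : 0 < T) {k : ℤ} (hk : k ≠ 0) :
    2 * π / T ≤ 2 * π * |(k : ℝ)| / T := by
  have h1 : (1 : ℝ) ≤ |(k : ℝ)| := by exact_mod_cast Int.one_le_abs hk
  exact div_le_div_of_nonneg_right (le_mul_of_one_le_right (by positivity) h1) hT.le

theorem abs_re_cexp_mul_le (x : ℝ) (w : ℂ) :
    |(Complex.exp (x * Complex.I) * w).re| ≤ ‖w‖ := by
  refine (Complex.abs_re_le_norm _).trans ?_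
  rw [norm_mul, Complex.norm_exp_ofReal_mul_I, one_mul]

theorem exists_abs_remWave_le {T β : ℝ} (hT : 0 < T) (hβ : -1 < β) : ∃ C, 0 ≤ C ∧
    ∀ k : ℤ, k ≠ 0 → ∀ t, 0 < t → t ≤ T → |remWave T β k t| ≤ C * t ^ min β 0 / |(k : ℝ)| := by
  obtain ⟨C, hC, h⟩ := exists_integral_norm_remKernel_le hT.le (ω₁ := 2 * π / T)
    (by positivity) β
  refine ⟨√(2 / T) * C * (T / (2 * π)), by positivity, fun k hk t ht htT => ?_⟩
  rw [remWave_eq hT hβ ht htT hk, abs_mul, abs_of_nonneg (sqrt_nonneg _)]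
  have h1 := h _ (two_pi_div_le_freq hT hk) t ht htT
  calc _ ≤ √(2 / T) * (C * t ^ min β 0 / (2 * π * |(k : ℝ)| / T)) := by
        gcongr
        exact (abs_re_cexp_mul_le _ _).trans ((norm_oscRem_le _ _ _).trans h1)
    _ = _ := by
        field_simp

theorem exists_remWave_piecewise_poly {T β : ℝ} (hT : 0 < T) (hβ : -1 < β) :
    ∃ a, 0 < a ∧ a < 1 ∧ ∃ C, 0 ≤ C ∧ ∀ (m : ℕ) (k : ℤ), k ≠ 0 → ∃ d : ℕ → ℕ → ℝ,
      ∀ (t : ℝ) (i : ℕ), T / 2 ^ (i + 1) < t → t ≤ T / 2 ^ i →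
        |remWave T β k t - ∑ j ∈ Finset.range m, d i j * (t - 3 / 4 * (T / 2 ^ i)) ^ j| ≤
          C * a ^ m * t ^ min β 0 / |(k : ℝ)| := by
  obtain ⟨C, hC, h⟩ := exists_integral_norm_remKernel_le hT.le (ω₁ := 2 * π / T)
    (by positivity) β
  obtain ⟨a, ha0, ha1, C', hC', h'⟩ := norm_oscRem_sub_poly_le β hβ
  refine ⟨a, ha0, ha1, √(2 / T) * C' * C * (T / (2 * π)) * (3 / 4) ^ min β 0, by positivity,
    fun m k hk => ?_⟩
  set ω : ℝ := 2 * π * |(k : ℝ)| / T with hω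
  have hω0 : 0 < ω := by positivity
  choose c hc using fun i : ℕ => h' ω hω0 (3 / 4 * (T / 2 ^ i)) (by positivity) m
  set z : ℂ := Complex.exp ((-(k.sign * (π / 4)) : ℝ) * Complex.I) with hz
  refine ⟨fun i j => √(2 / T) * (z * c i j).re, fun t i h1 h2 => ?_⟩
  set p : ℝ := 3 / 4 * (T / 2 ^ i) with hp
  have hp0 : 0 < p := by positivity
  have hpow : T / 2 ^ (i + 1) = T / 2 ^ i / 2 := by rw [pow_succ, div_div]
  rw [hpow] at h1
  have hTi : T / 2 ^ i ≤ T := div_le_self hT.le (one_le_pow₀ (by norm_num))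
  have hTi0 : 0 < T / 2 ^ i := by positivity
  have ht : 0 < t := by linarith
  have htp : |t - p| ≤ p / 3 := abs_le.2 ⟨by rw [hp]; linarith, by rw [hp]; linarith⟩
  have h3 : remWave T β k t - ∑ j ∈ Finset.range m, √(2 / T) * (z * c i j).re * (t - p) ^ j =
      √(2 / T) * (z * (oscRem β ω t -
        ∑ j ∈ Finset.range m, c i j * ((t - p : ℝ) : ℂ) ^ j)).re := by
    rw [remWave_eq hT hβ ht (h2.trans hTi) hk, mul_sub, Complex.sub_re, mul_sub, Finset.mul_sum,
      Complex.re_sum, Finset.mul_sum]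
    congr 1
    refine Finset.sum_congr rfl fun j _ => ?_
    rw [← mul_assoc z, ← Complex.ofReal_pow, Complex.re_mul_ofReal]
    ring
  rw [h3, abs_mul, abs_of_nonneg (sqrt_nonneg _)]
  have h4 := h _ (two_pi_div_le_freq hT hk) p hp0 (by rw [hp]; linarith)
  have h5 : p ^ min β 0 ≤ (3 / 4) ^ min β 0 * t ^ min β 0 := by
    rw [← mul_rpow (by norm_num) ht.le]
    refine rpow_le_rpow_of_nonpos (by positivity) ?_ (min_le_right _ _)
    rw [hp]
    linarith
  calc _ ≤ √(2 / T) * (C' * a ^ m * (C * ((3 / 4) ^ min β 0 * t ^ min β 0) / ω)) := by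
        gcongr
        refine (abs_re_cexp_mul_le _ _).trans ((hc i t htp).trans ?_)
        gcongr
        refine h4.trans ?_
        gcongr
    _ = _ := by
        rw [hω]
        field_simp

theorem exists_dyadic_cell {T t : ℝ} (htT : t ≤ T) (m : ℕ) :
    t ≤ T / 2 ^ m ∨ ∃ i < m, T / 2 ^ (i + 1) < t ∧ t ≤ T / 2 ^ i := by
  induction m with
  | zero => left; simpa using htT
  | succ m ih =>
    rcases ih with h | ⟨i, hi, h⟩
    · by_cases h' : t ≤ T / 2 ^ (m + 1)
      · exact Or.inl h'
      · exact Or.inr ⟨m, by omega, by linarith, h⟩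
    · exact Or.inr ⟨i, by omega, h⟩

theorem dyadic_cell_unique {T t : ℝ} (hT : 0 < T) {i j : ℕ} (h1 : T / 2 ^ (i + 1) < t)
    (h2 : t ≤ T / 2 ^ j) : j ≤ i := by
  by_contra h
  have h3 : T / 2 ^ j ≤ T / 2 ^ (i + 1) := by
    gcongr
    · norm_num
    · omega
  linarith

/-- Monomials supported on dyadic cells. -/
def cellMonomial (T : ℝ) (i j : ℕ) : ℝ → ℝ :=
  (Set.Ioc (T / 2 ^ (i + 1)) (T / 2 ^ i)).indicator fun t => (t - 3 / 4 * (T / 2 ^ i)) ^ j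

theorem memLp_cellMonomial (T : ℝ) (i j : ℕ) :
    MemLp (cellMonomial T i j) 2 (intervalMeasure T) :=
  (memLp_intervalMeasure_of_continuous (by fun_prop) 2).indicator measurableSet_Ioc

theorem sum_cellMonomial_eq {T t : ℝ} (hT : 0 < T) {m i : ℕ} (hi : i < m)
    (h1 : T / 2 ^ (i + 1) < t) (h2 : t ≤ T / 2 ^ i) (d : ℕ → ℕ → ℝ) :
    ∑ i ∈ Finset.range m, ∑ j ∈ Finset.range m, d i j * cellMonomial T i j t =
      ∑ j ∈ Finset.range m, d i j * (t - 3 / 4 * (T / 2 ^ i)) ^ j := by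
  rw [Finset.sum_eq_single i]
  · refine Finset.sum_congr rfl fun j _ => ?_
    rw [cellMonomial, Set.indicator_of_mem (Set.mem_Ioc.2 ⟨h1, h2⟩)]
  · intro l _ hl
    refine Finset.sum_eq_zero fun j _ => ?_
    rw [cellMonomial, Set.indicator_of_notMem, mul_zero]
    rintro ⟨h3, h4⟩
    exact hl (le_antisymm (dyadic_cell_unique hT h1 h4) (dyadic_cell_unique hT h3 h2))
  · intro h
    simp [hi] at h

theorem sum_cellMonomial_eq_zero {T t : ℝ} (hT : 0 < T) {m : ℕ} (h : t ≤ T / 2 ^ m)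
    (d : ℕ → ℕ → ℝ) :
    ∑ i ∈ Finset.range m, ∑ j ∈ Finset.range m, d i j * cellMonomial T i j t = 0 := by
  refine Finset.sum_eq_zero fun i hi => Finset.sum_eq_zero fun j _ => ?_
  rw [cellMonomial, Set.indicator_of_notMem, mul_zero]
  rintro ⟨h3, h4⟩
  have := dyadic_cell_unique hT h3 h
  have := Finset.mem_range.1 hi
  omega

theorem integral_rpow_indicator {T s x : ℝ} (hs : -1 < s) (hx : 0 ≤ x) (hxT : x ≤ T) :
    Integrable ((Set.Ioc 0 x).indicator fun t => t ^ s) (intervalMeasure T) ∧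
      ∫ t, (Set.Ioc 0 x).indicator (fun t => t ^ s) t ∂(intervalMeasure T) =
        x ^ (s + 1) / (s + 1) := by
  have h1 : Set.Ioc 0 x ∩ Set.Icc 0 T = Set.Ioc 0 x :=
    Set.inter_eq_left.2 fun t ht => ⟨ht.1.le, ht.2.trans hxT⟩
  constructor
  · rw [integrable_indicator_iff measurableSet_Ioc, IntegrableOn,
      Measure.restrict_restrict measurableSet_Ioc, h1]
    exact (intervalIntegrable_iff_integrableOn_Ioc_of_le hx).1
      (intervalIntegral.intervalIntegrable_rpow' hs)
  · rw [integral_indicator measurableSet_Ioc, Measure.restrict_restrict measurableSet_Ioc, h1,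
      ← intervalIntegral.integral_of_le hx, integral_rpow (Or.inl hs), zero_rpow (by linarith),
      sub_zero]

theorem memLp_fracWave {β : ℝ} (T : ℝ) (hβ : -1 < β) (k : ℤ) :
    MemLp (fracWave T β k) 2 (intervalMeasure T) :=
  MemLp.of_bound (measurable_fracWave T β k).aestronglyMeasurable _
    ((ae_restrict_iff' measurableSet_Icc).2 (ae_of_all _ fun _ ht =>
      abs_fracWave_le hβ ht.1 ht.2 k))

/-- The fractional integrals of the Fourier basis as elements of `L²([0, T])`. -/
def fracWaveLp {β : ℝ} (T : ℝ) (hβ : -1 < β) (k : ℤ) : Lp ℝ 2 (intervalMeasure T) :=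
  (memLp_fracWave T hβ k).toLp

/-- The remainders of the fractional integrals as elements of `L²([0, T])`. -/
def remWaveLp {β : ℝ} (T : ℝ) (hβ : -1 < β) (k : ℤ) : Lp ℝ 2 (intervalMeasure T) :=
  fracSing T β k • cosWaveLp T k (fracPhase β k) - fracWaveLp T hβ k

theorem remWaveLp_coeFn {β : ℝ} (T : ℝ) (hβ : -1 < β) (k : ℤ) :
    remWaveLp T hβ k =ᵐ[intervalMeasure T] remWave T β k := by
  filter_upwards [Lp.coeFn_sub (fracSing T β k • cosWaveLp T k (fracPhase β k)) (fracWaveLp T hβ k),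
    Lp.coeFn_smul (fracSing T β k) (cosWaveLp T k (fracPhase β k)),
    cosWaveLp_coeFn T k (fracPhase β k), (memLp_fracWave T hβ k).coeFn_toLp] with t h1 h2 h3 h4
  rw [remWaveLp, h1, Pi.sub_apply, h2, Pi.smul_apply, h3, fracWaveLp, h4, remWave, smul_eq_mul]

theorem Lp_norm_sq_le_integral {T : ℝ} (f : Lp ℝ 2 (intervalMeasure T)) {g h : ℝ → ℝ}
    (hf : f =ᵐ[intervalMeasure T] g) (hh : Integrable h (intervalMeasure T))
    (hgh : ∀ t, 0 < t → t ≤ T → g t ^ 2 ≤ h t) : ‖f‖ ^ 2 ≤ ∫ t, h t ∂(intervalMeasure T) := by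
  rw [← real_inner_self_eq_norm_sq, L2.inner_def]
  refine integral_mono_of_nonneg (ae_of_all _ fun t => real_inner_self_nonneg) hh ?_
  have h0 : ∀ᵐ t ∂(intervalMeasure T), t ∈ Set.Ioc 0 T := by
    rw [intervalMeasure, ← restrict_Ioc_eq_restrict_Icc]
    exact ae_restrict_mem measurableSet_Ioc
  filter_upwards [hf, h0] with t h1 h2
  rw [h1]
  have := hgh t h2.1 h2.2
  simpa [← sq] using this

theorem neg_one_lt_two_mul_min {β : ℝ} (hβ : -1 / 2 < β) : -1 < 2 * min β 0 := by
  have : -1 / 2 < min β 0 := lt_min hβ (by norm_num)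
  linarith

theorem rpow_mul_div_sq {t s c k : ℝ} (ht : 0 < t) : (c * t ^ s / |k|) ^ 2 =
    c ^ 2 / k ^ 2 * t ^ (2 * s) := by
  rw [div_pow, mul_pow, sq_abs, ← rpow_natCast (t ^ s), ← rpow_mul ht.le]
  push_cast
  ring_nf

theorem exists_norm_remWaveLp_sq_le {T β : ℝ} (hT : 0 < T) (hβ : -1 / 2 < β) : ∃ C, 0 ≤ C ∧
    ∀ k : ℤ, k ≠ 0 → ‖remWaveLp T (by linarith : -1 < β) k‖ ^ 2 ≤ C / (k : ℝ) ^ 2 := by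
  have hs := neg_one_lt_two_mul_min hβ
  obtain ⟨C, hC, h⟩ := exists_abs_remWave_le hT (by linarith : -1 < β)
  obtain ⟨hi, hv⟩ := integral_rpow_indicator hs hT.le (le_refl T)
  have hs1 : 0 < 2 * min β 0 + 1 := by linarith
  refine ⟨C ^ 2 * (T ^ (2 * min β 0 + 1) / (2 * min β 0 + 1)), by positivity, fun k hk => ?_⟩
  refine (Lp_norm_sq_le_integral _ (remWaveLp_coeFn T _ k) (hi.const_mul (C ^ 2 / (k : ℝ) ^ 2))
    fun t ht htT => ?_).trans_eq ?_
  · rw [Set.indicator_of_mem (Set.mem_Ioc.2 ⟨ht, htT⟩), ← rpow_mul_div_sq ht,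
    ← sq_abs (remWave _ _ _ _)]
    exact pow_le_pow_left₀ (abs_nonneg _) (h k hk t ht htT) 2
  · rw [integral_const_mul, hv]
    ring

theorem summable_norm_remWaveLp_sq {T β : ℝ} (hT : 0 < T) (hβ : -1 / 2 < β) :
    Summable fun k : ℤ => ‖remWaveLp T (by linarith : -1 < β) k‖ ^ 2 := by
  obtain ⟨C, hC, h⟩ := exists_norm_remWaveLp_sq_le hT hβ
  have h1 : Summable fun k : ℤ => C / (k : ℝ) ^ 2 := by
    simpa [div_eq_mul_inv] using (Real.summable_one_div_int_pow.2 one_lt_two).mul_left C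
  refine .of_norm_bounded_eventually h1 ?_
  filter_upwards [Filter.eventually_cofinite_ne 0] with k hk
  rw [norm_of_nonneg (sq_nonneg _)]
  exact h k hk

theorem fracSing_zero {T β : ℝ} (hβ : -1 < β) : fracSing T β 0 = 0 := by
  rw [fracSing, Int.cast_zero, abs_zero, mul_zero, zero_div, zero_rpow (by linarith), mul_zero]

theorem exists_remWaveLp_approx_rate {T β : ℝ} (hT : 0 < T) (hβ : -1 / 2 < β) :
    ∃ γ, 0 < γ ∧ γ < 1 ∧ ∃ C, 0 ≤ C ∧ ∀ (m : ℕ) (k : ℤ), k ≠ 0 → ∃ d : ℕ → ℕ → ℝ,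
      ‖remWaveLp T (by linarith : -1 < β) k - ∑ i ∈ Finset.range m, ∑ j ∈ Finset.range m,
        d i j • (memLp_cellMonomial T i j).toLp‖ ^ 2 ≤ C * γ ^ m / (k : ℝ) ^ 2 := by
  have hs := neg_one_lt_two_mul_min hβ
  have hβ1 : -1 < β := by linarith
  obtain ⟨C, hC, h⟩ := exists_abs_remWave_le hT hβ1
  obtain ⟨a, ha0, ha1, C', hC', h'⟩ := exists_remWave_piecewise_poly hT hβ1
  set s : ℝ := 2 * min β 0 + 1 with hsdef
  have hs1 : 0 < s := by linarith
  have hb0 : (0 : ℝ) < (1 / 2) ^ s := by positivity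
  have hb1 : ((1 : ℝ) / 2) ^ s < 1 := rpow_lt_one (by norm_num) (by norm_num) hs1
  refine ⟨max (a ^ 2) ((1 / 2) ^ s), lt_max_of_lt_right hb0, max_lt (by nlinarith) hb1,
    (C' ^ 2 + C ^ 2) * (T ^ s / s), by positivity, fun m k hk => ?_⟩
  obtain ⟨d, hd⟩ := h' m k hk
  refine ⟨d, ?_⟩
  have hx0 : 0 ≤ T / 2 ^ m := by positivity
  have hxT : T / 2 ^ m ≤ T := div_le_self hT.le (one_le_pow₀ (by norm_num))
  obtain ⟨hi1, hv1⟩ := integral_rpow_indicator hs hT.le (le_refl T)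
  obtain ⟨hi2, hv2⟩ := integral_rpow_indicator hs hx0 hxT
  have hae : (remWaveLp T hβ1 k - ∑ i ∈ Finset.range m, ∑ j ∈ Finset.range m,
      d i j • (memLp_cellMonomial T i j).toLp : Lp ℝ 2 (intervalMeasure T))
      =ᵐ[intervalMeasure T] fun t => remWave T β k t -
        ∑ i ∈ Finset.range m, ∑ j ∈ Finset.range m, d i j * cellMonomial T i j t := by
    have h1 : ∀ᵐ t ∂(intervalMeasure T), ∀ i j : ℕ,
        ((d i j • (memLp_cellMonomial T i j).toLp : Lp ℝ 2 (intervalMeasure T)) : ℝ → ℝ) t =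
          d i j * cellMonomial T i j t := by
      refine ae_all_iff.2 fun i => ae_all_iff.2 fun j => ?_
      filter_upwards [Lp.coeFn_smul (d i j) (memLp_cellMonomial T i j).toLp,
        (memLp_cellMonomial T i j).coeFn_toLp] with t h2 h3
      rw [h2, Pi.smul_apply, h3, smul_eq_mul]
    have h2 : ∀ᵐ t ∂(intervalMeasure T), ∀ i : ℕ, ((∑ j ∈ Finset.range m,
        d i j • (memLp_cellMonomial T i j).toLp : Lp ℝ 2 (intervalMeasure T)) : ℝ → ℝ) t =
        ∑ j ∈ Finset.range m, ((d i j • (memLp_cellMonomial T i j).toLp :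
          Lp ℝ 2 (intervalMeasure T)) : ℝ → ℝ) t := by
      refine ae_all_iff.2 fun i => ?_
      filter_upwards [Lp.coeFn_finsetSum (Finset.range m)
        fun j => d i j • (memLp_cellMonomial T i j).toLp] with t h3
      rw [h3, Finset.sum_apply]
    filter_upwards [h1, h2, Lp.coeFn_sub (remWaveLp T hβ1 k) (∑ i ∈ Finset.range m,
      ∑ j ∈ Finset.range m, d i j • (memLp_cellMonomial T i j).toLp), remWaveLp_coeFn T hβ1 k,
      Lp.coeFn_finsetSum (Finset.range m) fun i => ∑ j ∈ Finset.range m,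
        d i j • (memLp_cellMonomial T i j).toLp] with t h1 h2 h3 h4 h5
    rw [h3, Pi.sub_apply, h4, h5, Finset.sum_apply]
    simp only [h1, h2]
  refine (Lp_norm_sq_le_integral _ hae ((hi1.const_mul ((C' * a ^ m) ^ 2 / (k : ℝ) ^ 2)).add
    (hi2.const_mul (C ^ 2 / (k : ℝ) ^ 2))) fun t ht htT => ?_).trans ?_
  · simp only [Pi.add_apply]
    rw [Set.indicator_of_mem (Set.mem_Ioc.2 ⟨ht, htT⟩), ← rpow_mul_div_sq ht, ← sq_abs]
    rcases exists_dyadic_cell htT m with h3 | ⟨i, hi, h3, h4⟩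
    · rw [sum_cellMonomial_eq_zero hT h3, sub_zero, Set.indicator_of_mem (Set.mem_Ioc.2 ⟨ht, h3⟩),
        ← rpow_mul_div_sq ht]
      have := pow_le_pow_left₀ (abs_nonneg _) (h k hk t ht htT) 2
      have h5 := sq_nonneg (C' * a ^ m * t ^ min β 0 / |(k : ℝ)|)
      linarith
    · rw [sum_cellMonomial_eq hT hi h3 h4]
      have := pow_le_pow_left₀ (abs_nonneg _) (hd t i h3 h4) 2
      have h5 : 0 ≤ C ^ 2 / (k : ℝ) ^ 2 *
          (Set.Ioc 0 (T / 2 ^ m)).indicator (fun t => t ^ (2 * min β 0)) t :=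
        mul_nonneg (by positivity) (Set.indicator_nonneg (fun x hx => rpow_nonneg hx.1.le _) _)
      linarith
  · have hadd : ∫ t, ((fun t => (C' * a ^ m) ^ 2 / (k : ℝ) ^ 2 *
        (Set.Ioc 0 T).indicator (fun t => t ^ (2 * min β 0)) t) +
        (fun t => C ^ 2 / (k : ℝ) ^ 2 *
          (Set.Ioc 0 (T / 2 ^ m)).indicator (fun t => t ^ (2 * min β 0)) t)) t
          ∂(intervalMeasure T) = (C' * a ^ m) ^ 2 / (k : ℝ) ^ 2 * (T ^ s / s) +
          C ^ 2 / (k : ℝ) ^ 2 * ((T / 2 ^ m) ^ s / s) := by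
      rw [integral_add' (hi1.const_mul _) (hi2.const_mul _), integral_const_mul,
        integral_const_mul, hv1, hv2]
    rw [hadd]
    have h6 : (T / 2 ^ m) ^ s = T ^ s * ((1 / 2) ^ s) ^ m := by
      rw [div_eq_mul_one_div, mul_rpow hT.le (by positivity), ← rpow_natCast ((1 / 2 : ℝ) ^ s),
        ← rpow_mul (by norm_num), mul_comm s, rpow_mul (by norm_num), rpow_natCast, one_div_pow]
    have h7 : (a ^ 2) ^ m ≤ max (a ^ 2) ((1 / 2) ^ s) ^ m :=
      pow_le_pow_left₀ (by positivity) (le_max_left _ _) m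
    have h8 : ((1 / 2) ^ s) ^ m ≤ max (a ^ 2) ((1 / 2) ^ s) ^ m :=
      pow_le_pow_left₀ (by positivity) (le_max_right _ _) m
    rw [h6, mul_pow, ← pow_mul, mul_comm m 2, pow_mul]
    calc _ ≤ C' ^ 2 * max (a ^ 2) ((1 / 2) ^ s) ^ m / (k : ℝ) ^ 2 * (T ^ s / s) +
          C ^ 2 / (k : ℝ) ^ 2 * (T ^ s * max (a ^ 2) ((1 / 2) ^ s) ^ m / s) := by gcongr
      _ = _ := by ring

theorem exists_remWaveLp_approx {T β : ℝ} (hT : 0 < T) (hβ : -1 / 2 < β) :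
    ∃ γ, 0 < γ ∧ γ < 1 ∧ ∃ C, 0 ≤ C ∧ ∀ m : ℕ, ∃ E : Submodule ℝ (Lp ℝ 2 (intervalMeasure T)),
      FiniteDimensional ℝ E ∧ Module.finrank ℝ E ≤ m * m + 1 ∧
      ∀ k : ℤ, ∃ q ∈ E, ‖remWaveLp T (by linarith : -1 < β) k - q‖ ^ 2 ≤
        C * γ ^ m / (k : ℝ) ^ 2 := by
  obtain ⟨γ, hγ0, hγ1, C, hC, h⟩ := exists_remWaveLp_approx_rate hT hβ
  have hβ1 : -1 < β := by linarith
  refine ⟨γ, hγ0, hγ1, C, hC, fun m => ?_⟩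
  set g : Option (Fin m × Fin m) → Lp ℝ 2 (intervalMeasure T) := fun o =>
    o.elim (fracWaveLp T hβ1 0) fun ij => (memLp_cellMonomial T ij.1 ij.2).toLp with hg
  refine ⟨Submodule.span ℝ (Set.range g), FiniteDimensional.span_of_finite ℝ (Set.finite_range g),
    ?_, fun k => ?_⟩
  · refine (finrank_range_le_card g).trans_eq ?_
    simp
  · by_cases hk : k = 0
    · refine ⟨remWaveLp T hβ1 k, ?_, by simp [hk]⟩
      rw [hk, remWaveLp, fracSing_zero hβ1, zero_smul, zero_sub]
      exact Submodule.neg_mem _ (Submodule.subset_span ⟨none, rfl⟩)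
    · obtain ⟨d, hd⟩ := h m k hk
      refine ⟨_, ?_, hd⟩
      refine Submodule.sum_mem _ fun i hi => Submodule.sum_mem _ fun j hj =>
        Submodule.smul_mem _ _ (Submodule.subset_span ?_)
      exact ⟨some (⟨i, Finset.mem_range.1 hi⟩, ⟨j, Finset.mem_range.1 hj⟩), rfl⟩

section Distortion

variable {Ω H : Type*} [MeasurableSpace Ω] [NormedAddCommGroup H]

/-- Mean squared distortion of `G` quantized by the codebook `α`. -/
def distortion (P : Measure Ω) (G : Ω → H) (α : Finset H) : ℝ :=
  ∫ ω, (⨅ a : α, ‖G ω - (a : H)‖ ^ 2) ∂P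

theorem iInf_norm_sub_sq_le {α : Finset H} {a : H} (ha : a ∈ α) (x : H) :
    ⨅ a : α, ‖x - (a : H)‖ ^ 2 ≤ ‖x - a‖ ^ 2 :=
  ciInf_le (Set.finite_range _).bddBelow (⟨a, ha⟩ : α)

theorem iInf_norm_sub_sq_nonneg (α : Finset H) (x : H) : 0 ≤ ⨅ a : α, ‖x - (a : H)‖ ^ 2 :=
  Real.iInf_nonneg fun _ => sq_nonneg _

theorem exists_iInf_norm_sub_sq_eq {α : Finset H} (hα : α.Nonempty) (x : H) :
    ∃ a ∈ α, ‖x - a‖ ^ 2 = ⨅ a : α, ‖x - (a : H)‖ ^ 2 := by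
  have : Nonempty α := hα.to_subtype
  obtain ⟨a, ha⟩ := exists_eq_ciInf_of_finite (f := fun a : α => ‖x - (a : H)‖ ^ 2)
  exact ⟨a, a.2, ha⟩

theorem continuous_iInf_norm_sub_sq {α : Finset H} (hα : α.Nonempty) :
    Continuous fun x : H => ⨅ a : α, ‖x - (a : H)‖ ^ 2 := by
  have : Nonempty α := hα.to_subtype
  simp_rw [← Finset.inf'_univ_eq_ciInf]
  exact Continuous.finset_inf'_apply _ fun a _ => by fun_prop

theorem norm_sub_sq_le (x y : H) : ‖x - y‖ ^ 2 ≤ 2 * ‖x‖ ^ 2 + 2 * ‖y‖ ^ 2 := by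
  nlinarith [norm_sub_le x y, norm_nonneg (x - y), sq_nonneg (‖x‖ - ‖y‖)]

theorem integrable_iInf_norm_sub_sq {P : Measure Ω} [IsProbabilityMeasure P] {G : Ω → H}
    (hG : AEStronglyMeasurable G P)
    (hG2 : Integrable (fun ω => ‖G ω‖ ^ 2) P) {α : Finset H} (hα : α.Nonempty) :
    Integrable (fun ω => ⨅ a : α, ‖G ω - (a : H)‖ ^ 2) P := by
  obtain ⟨a, ha⟩ := id hα
  refine Integrable.mono' ((hG2.const_mul 2).add (integrable_const (2 * ‖a‖ ^ 2)))
    ((continuous_iInf_norm_sub_sq hα).comp_aestronglyMeasurable hG) (ae_of_all _ fun ω => ?_)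
  rw [norm_of_nonneg (iInf_norm_sub_sq_nonneg α _)]
  exact (iInf_norm_sub_sq_le ha _).trans (norm_sub_sq_le _ _)

theorem distortion_nonneg {P : Measure Ω} (G : Ω → H) (α : Finset H) : 0 ≤ distortion P G α :=
  integral_nonneg fun _ => iInf_norm_sub_sq_nonneg α _

open scoped Classical Pointwise in
theorem distortion_add_le {P : Measure Ω} [IsProbabilityMeasure P] {G R Z : Ω → H}
    (hG : AEStronglyMeasurable G P)
    (hG2 : Integrable (fun ω => ‖G ω‖ ^ 2) P) (hR : AEStronglyMeasurable R P)
    (hR2 : Integrable (fun ω => ‖R ω‖ ^ 2) P) (hZ : ∀ᵐ ω ∂P, Z ω = G ω + R ω)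
    {α β : Finset H} (hα : α.Nonempty) (hβ : β.Nonempty) {ε : ℝ} (hε : 0 < ε) :
    distortion P Z (α + β) ≤ (1 + ε) * distortion P G α + (1 + 1 / ε) * distortion P R β := by
  rw [distortion, distortion, distortion, ← integral_const_mul, ← integral_const_mul,
    ← integral_add ((integrable_iInf_norm_sub_sq hG hG2 hα).const_mul _)
      ((integrable_iInf_norm_sub_sq hR hR2 hβ).const_mul _)]
  refine integral_mono_of_nonneg (ae_of_all _ fun ω => iInf_norm_sub_sq_nonneg _ _)
    (((integrable_iInf_norm_sub_sq hG hG2 hα).const_mul _).add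
      ((integrable_iInf_norm_sub_sq hR hR2 hβ).const_mul _)) ?_
  filter_upwards [hZ] with ω hω
  obtain ⟨a, ha, ha'⟩ := exists_iInf_norm_sub_sq_eq hα (G ω)
  obtain ⟨b, hb, hb'⟩ := exists_iInf_norm_sub_sq_eq hβ (R ω)
  refine (iInf_norm_sub_sq_le (Finset.add_mem_add ha hb) _).trans ?_
  rw [← ha', ← hb', hω, add_sub_add_comm]
  set x := ‖G ω - a‖
  set y := ‖R ω - b‖
  have h1 : ‖G ω - a + (R ω - b)‖ ^ 2 ≤ (x + y) ^ 2 :=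
    pow_le_pow_left₀ (norm_nonneg _) (norm_add_le _ _) 2
  have h2 : (1 + ε) * x ^ 2 + (1 + 1 / ε) * y ^ 2 - (x + y) ^ 2 = (ε * x - y) ^ 2 / ε := by
    field_simp
    ring
  have h3 : 0 ≤ (ε * x - y) ^ 2 / ε := by positivity
  linarith

theorem distortion_congr_map {Ω' : Type*} [MeasurableSpace Ω'] {P : Measure Ω} {Q : Measure Ω'}
    [MeasurableSpace H] [BorelSpace H] {G : Ω → H} {G' : Ω' → H} (hG : AEMeasurable G P)
    (hG' : AEMeasurable G' Q) (h : P.map G = Q.map G') {α : Finset H} (hα : α.Nonempty) :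
    distortion P G α = distortion Q G' α := by
  have hc := (continuous_iInf_norm_sub_sq hα).measurable.stronglyMeasurable
  rw [distortion, distortion,
    ← integral_map (f := fun x : H => ⨅ a : α, ‖x - (a : H)‖ ^ 2) hG hc.aestronglyMeasurable,
    ← integral_map (f := fun x : H => ⨅ a : α, ‖x - (a : H)‖ ^ 2) hG' hc.aestronglyMeasurable, h]

end Distortion

section Crude

theorem exists_int_quantize (m : ℕ) (x : ℝ) :
    ∃ j ∈ Finset.Icc (-(4 ^ m : ℤ)) (4 ^ m), (x - j / 2 ^ m) ^ 2 ≤ (1 / 4) ^ m * (1 + x ^ 4) := by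
  have h4 : (4 : ℝ) ^ m = 2 ^ m * 2 ^ m := by rw [← mul_pow]; norm_num
  have h2 : (0 : ℝ) < 2 ^ m := by positivity
  rw [one_div, inv_pow, h4]
  by_cases hx : |x| ≤ 2 ^ m
  · refine ⟨round (x * 2 ^ m), ?_, ?_⟩
    · have h5 : |x * 2 ^ m| ≤ (4 : ℝ) ^ m := by
        rw [abs_mul, abs_of_pos h2, h4]
        exact mul_le_mul_of_nonneg_right hx h2.le
      have h6 := abs_le.1 h5
      have h7 := abs_le.1 (abs_sub_round (x * 2 ^ m))
      have h8 : (-(4 ^ m : ℤ) : ℝ) - 1 < round (x * 2 ^ m) := by push_cast; linarith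
      have h9 : (round (x * 2 ^ m) : ℝ) < (4 ^ m : ℤ) + 1 := by push_cast; linarith
      refine Finset.mem_Icc.2 ⟨?_, ?_⟩
      · have : (-(4 ^ m : ℤ)) - 1 < round (x * 2 ^ m) := by exact_mod_cast h8
        linarith
      · have : round (x * 2 ^ m) < (4 ^ m : ℤ) + 1 := by exact_mod_cast h9
        linarith
    · have h7 := abs_sub_round (x * 2 ^ m)
      have h8 : (x * 2 ^ m - round (x * 2 ^ m)) ^ 2 ≤ 1 := by
        rw [← sq_abs]
        nlinarith [abs_nonneg (x * 2 ^ m - round (x * 2 ^ m))]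
      have h9 : (x - round (x * 2 ^ m) / 2 ^ m) ^ 2 =
          (2 ^ m * 2 ^ m)⁻¹ * (x * 2 ^ m - round (x * 2 ^ m)) ^ 2 := by
        field_simp
      rw [h9]
      gcongr
      nlinarith [sq_nonneg (x ^ 2)]
  · refine ⟨0, by simp, ?_⟩
    push Not at hx
    have h7 : 2 ^ m * 2 ^ m ≤ x ^ 2 := by
      rw [← sq_abs]
      nlinarith
    rw [← div_eq_inv_mul, le_div_iff₀ (by positivity)]
    simp only [Int.cast_zero, zero_div, sub_zero]
    nlinarith [sq_nonneg x]

variable {H : Type*} [NormedAddCommGroup H] [InnerProductSpace ℝ H]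

theorem gaussianReal_zero_eq_map (v : NNReal) :
    gaussianReal 0 v = (gaussianReal 0 1).map (fun x => √(v : ℝ) * x) := by
  rw [gaussianReal_map_const_mul, mul_zero, mul_one]
  congr 1
  ext
  simp

theorem integrable_pow_four_gaussianReal (v : NNReal) :
    Integrable (fun x => x ^ 4) (gaussianReal 0 v) := by
  rw [gaussianReal_zero_eq_map, integrable_map_measure (by fun_prop) (by fun_prop)]
  simp only [Function.comp_def, mul_pow]
  exact (integrable_pow_gaussianReal 4).const_mul _

theorem integral_pow_four_gaussianReal (v : NNReal) :
    ∫ x, x ^ 4 ∂(gaussianReal 0 v) = v ^ 2 * ∫ x, x ^ 4 ∂(gaussianReal 0 1) := by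
  rw [gaussianReal_zero_eq_map, integral_map (by fun_prop) (by fun_prop), ← integral_const_mul]
  refine integral_congr_ae (ae_of_all _ fun x => ?_)
  simp only [mul_pow]
  rw [show (√(v : ℝ)) ^ 4 = (√(v : ℝ) ^ 2) ^ 2 by ring, sq_sqrt (NNReal.coe_nonneg v)]

theorem tsum_inner_sq_le (w : lp (fun _ : ℤ => H) 2) {f : H} (hf : ‖f‖ = 1) :
    ∑' k, inner ℝ f (w k) ^ 2 ≤ ∑' k, ‖w k‖ ^ 2 := by
  have h : ∀ k, inner ℝ f (w k) ^ 2 ≤ ‖w k‖ ^ 2 := fun k => by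
    rw [← sq_abs]
    refine pow_le_pow_left₀ (abs_nonneg _) ((abs_real_inner_le_norm _ _).trans_eq ?_) 2
    rw [hf, one_mul]
  exact Summable.tsum_le_tsum h (.of_nonneg_of_le (fun _ => sq_nonneg _) h
    (summable_norm_sq_lp w)) (summable_norm_sq_lp w)

theorem integrable_inner_gaussSeries_pow_four [CompleteSpace H]
    (w : lp (fun _ : ℤ => H) 2) (f : H) :
    Integrable (fun ω => inner ℝ f ((gaussSeries w : (ℤ → ℝ) → H) ω) ^ 4) gaussSeq := by
  have hm : AEMeasurable (fun ω => inner ℝ f ((gaussSeries w : (ℤ → ℝ) → H) ω)) gaussSeq :=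
    ((innerSL ℝ f).continuous.comp_aestronglyMeasurable
      (Lp.aestronglyMeasurable (gaussSeries w))).aemeasurable
  have := integrable_pow_four_gaussianReal (toNNReal (∑' k, inner ℝ f (w k) ^ 2))
  rw [← gaussSeries_inner_law, integrable_map_measure (by fun_prop) hm] at this
  exact this

theorem integral_inner_gaussSeries_pow_four_le [CompleteSpace H] (w : lp (fun _ : ℤ => H) 2) {f : H}
    (hf : ‖f‖ = 1) :
    ∫ ω, inner ℝ f ((gaussSeries w : (ℤ → ℝ) → H) ω) ^ 4 ∂gaussSeq ≤
      (∑' k, ‖w k‖ ^ 2) ^ 2 * ∫ x, x ^ 4 ∂(gaussianReal 0 1) := by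
  have hm : AEMeasurable (fun ω => inner ℝ f ((gaussSeries w : (ℤ → ℝ) → H) ω)) gaussSeq :=
    ((innerSL ℝ f).continuous.comp_aestronglyMeasurable
      (Lp.aestronglyMeasurable (gaussSeries w))).aemeasurable
  have h0 : 0 ≤ ∑' k, inner ℝ f (w k) ^ 2 := tsum_nonneg fun k => sq_nonneg _
  have := integral_pow_four_gaussianReal (toNNReal (∑' k, inner ℝ f (w k) ^ 2))
  rw [← gaussSeries_inner_law, integral_map hm (by fun_prop), Real.coe_toNNReal _ h0] at this
  rw [this]
  exact mul_le_mul_of_nonneg_right (pow_le_pow_left₀ h0 (tsum_inner_sq_le w hf) 2)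
    (integral_nonneg fun x => by positivity)

theorem norm_sub_sum_smul_sq_eq {ι : Type*} [Fintype ι] {v : ι → H} (hv : Orthonormal ℝ v) (x : H)
    (c : ι → ℝ) :
    ‖x - ∑ j, c j • v j‖ ^ 2 = ‖x‖ ^ 2 - 2 * ∑ j, c j * inner ℝ (v j) x + ∑ j, c j ^ 2 := by
  rw [@norm_sub_sq_real, ← real_inner_self_eq_norm_sq (∑ j, c j • v j), hv.inner_sum, inner_sum]
  simp only [inner_smul_right, real_inner_comm x, conj_trivial, pow_two]

theorem norm_sub_sum_smul_sq {ι : Type*} [Fintype ι] {v : ι → H} (hv : Orthonormal ℝ v) (x : H)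
    (c : ι → ℝ) :
    ‖x - ∑ j, c j • v j‖ ^ 2 =
      ‖x - ∑ j, inner ℝ (v j) x • v j‖ ^ 2 + ∑ j, (inner ℝ (v j) x - c j) ^ 2 := by
  rw [norm_sub_sum_smul_sq_eq hv, norm_sub_sum_smul_sq_eq hv]
  simp only [sub_sq, Finset.sum_add_distrib, Finset.sum_sub_distrib, Finset.mul_sum, ← pow_two]
  have : ∀ j, 2 * (c j * inner ℝ (v j) x) = 2 * inner ℝ (v j) x * c j := fun j => by ring
  simp only [this, ← Finset.mul_sum]
  ring

variable [CompleteSpace H]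

/-- Product quantizer of a Gaussian series in a finite dimensional space. -/
theorem exists_crude_code (w : lp (fun _ : ℤ => H) 2) (E : Submodule ℝ H) [FiniteDimensional ℝ E]
    {A : ℝ} (hE : ∀ k : ℤ, ∃ q ∈ E, ‖w k - q‖ ^ 2 ≤ A / (k : ℝ) ^ 2) (m : ℕ) :
    ∃ α : Finset H, α.Nonempty ∧ α.card ≤ (2 * 4 ^ m + 1) ^ Module.finrank ℝ E ∧
      distortion gaussSeq (gaussSeries w) α ≤ A * ∑' k : ℤ, 1 / (k : ℝ) ^ 2 +
        Module.finrank ℝ E * ((1 / 4) ^ m *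
          (1 + (∑' k, ‖w k‖ ^ 2) ^ 2 * ∫ x, x ^ 4 ∂(gaussianReal 0 1))) := by
  classical
  set d := Module.finrank ℝ E with hd
  set b := stdOrthonormalBasis ℝ E
  set v : Fin d → H := fun j => b j with hv'
  have hv : Orthonormal ℝ v := b.orthonormal.comp_linearIsometry E.subtypeₗᵢ
  set pt : (Fin d → Finset.Icc (-(4 ^ m : ℤ)) (4 ^ m)) → H :=
    fun z => ∑ j, ((z j : ℤ) / 2 ^ m : ℝ) • v j with hpt
  have h0mem : (0 : ℤ) ∈ Finset.Icc (-(4 ^ m : ℤ)) (4 ^ m) := by simp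
  have hne : (Finset.univ.image pt).Nonempty := ⟨pt fun _ => ⟨0, h0mem⟩, by simp⟩
  refine ⟨Finset.univ.image pt, hne, ?_, ?_⟩
  · refine Finset.card_image_le.trans ?_
    simp only [Finset.card_univ, Fintype.card_fun, Fintype.card_fin, Fintype.card_coe, Int.card_Icc]
    refine Nat.pow_le_pow_left (Int.toNat_le.2 ?_) _
    push_cast
    linarith
  set L : H →L[ℝ] H := ContinuousLinearMap.id ℝ H -
    ∑ j, (innerSL ℝ (v j)).smulRight (v j) with hL
  have hLx : ∀ x, L x = x - ∑ j, inner ℝ (v j) x • v j := fun x => by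
    simp [hL]
  obtain ⟨u, hu⟩ := exists_lp_map L w
  have hLw : ∀ k, ‖u k‖ ^ 2 ≤ A / (k : ℝ) ^ 2 := fun k => by
    obtain ⟨q, hq, hqk⟩ := hE k
    refine le_trans ?_ hqk
    have hqs : q = ∑ j, b.repr ⟨q, hq⟩ j • v j := by
      have := congrArg (fun e : E => (e : H)) (b.sum_repr ⟨q, hq⟩)
      simpa using this.symm
    rw [hqs, norm_sub_sum_smul_sq hv, hu k, hLx]
    exact le_add_of_nonneg_right (Finset.sum_nonneg fun j _ => sq_nonneg _)
  have hLG := gaussSeries_map L hu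
  set c4 := (∑' k, ‖w k‖ ^ 2) ^ 2 * ∫ x, x ^ 4 ∂(gaussianReal 0 1)
  set G : (ℤ → ℝ) → H := (gaussSeries w : (ℤ → ℝ) → H)
  have hint1 := integrable_norm_sq_gaussSeries u
  have hint3 : ∀ j, Integrable (fun ω => 1 + inner ℝ (v j) (G ω) ^ 4) gaussSeq := fun j =>
    (integrable_const 1).add (integrable_inner_gaussSeries_pow_four w (v j))
  have hint2 : Integrable (fun ω => ∑ j, (1 / 4) ^ m * (1 + inner ℝ (v j) (G ω) ^ 4)) gaussSeq :=
    integrable_finsetSum _ fun j _ => (hint3 j).const_mul _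
  calc distortion gaussSeq G (Finset.univ.image pt)
      ≤ ∫ ω, (‖(gaussSeries u : (ℤ → ℝ) → H) ω‖ ^ 2 +
          ∑ j, (1 / 4) ^ m * (1 + inner ℝ (v j) (G ω) ^ 4)) ∂gaussSeq := by
        refine integral_mono_of_nonneg (ae_of_all _ fun ω => iInf_norm_sub_sq_nonneg _ _)
          (hint1.add hint2) ?_
        filter_upwards [hLG] with ω hω
        choose z hz hz' using fun j => exists_int_quantize m (inner ℝ (v j) (G ω))
        refine (iInf_norm_sub_sq_le (a := pt fun j => ⟨z j, hz j⟩) (by simp) _).trans ?_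
        rw [hpt, norm_sub_sum_smul_sq hv, hω, hLx]
        exact add_le_add_right (Finset.sum_le_sum fun j _ => hz' j) _
    _ = ∑' k, ‖u k‖ ^ 2 +
          ∑ j, (1 / 4) ^ m * (1 + ∫ ω, inner ℝ (v j) (G ω) ^ 4 ∂gaussSeq) := by
        rw [integral_add hint1 hint2, integral_norm_sq_gaussSeries,
          integral_finsetSum _ fun j _ => (hint3 j).const_mul _]
        congr 1
        refine Finset.sum_congr rfl fun j _ => ?_
        rw [integral_const_mul, integral_add (integrable_const 1)
          (integrable_inner_gaussSeries_pow_four w (v j))]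
        simp
        rfl
    _ ≤ A * ∑' k : ℤ, 1 / (k : ℝ) ^ 2 + d * ((1 / 4) ^ m * (1 + c4)) := by
        refine add_le_add ?_ ?_
        · rw [← tsum_mul_left]
          refine Summable.tsum_le_tsum (fun k => (hLw k).trans_eq (by ring))
            (summable_norm_sq_lp u) ((Real.summable_one_div_int_pow.2 one_lt_two).mul_left A)
        · refine (Finset.sum_le_card_nsmul _ _ ((1 / 4) ^ m * (1 + c4)) fun j _ => ?_).trans_eq
            (by simp)
          have := integral_inner_gaussSeries_pow_four_le w (hv.1 j)
          gcongr

theorem tendsto_rpow_mul_pow_atTop {s γ : ℝ} (hγ0 : 0 ≤ γ) (hγ1 : γ < 1) :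
    Tendsto (fun m : ℕ => ((m : ℝ) + 1) ^ s * γ ^ m) atTop (nhds 0) := by
  obtain ⟨k, hk⟩ := exists_nat_ge s
  have h1 := tendsto_pow_const_mul_const_pow_of_abs_lt_one k (r := γ)
    (by rwa [abs_of_nonneg hγ0])
  have h2 := h1.const_mul (2 ^ k)
  rw [mul_zero] at h2
  refine squeeze_zero' (Eventually.of_forall fun m => by positivity) ?_ h2
  filter_upwards [eventually_ge_atTop 1] with m hm
  have hm' : (1 : ℝ) ≤ m := by exact_mod_cast hm
  rw [← mul_assoc, ← mul_pow]
  refine mul_le_mul_of_nonneg_right ?_ (by positivity)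
  calc ((m : ℝ) + 1) ^ s ≤ (m + 1) ^ (k : ℝ) := rpow_le_rpow_of_exponent_le (by linarith) hk
    _ = (m + 1) ^ k := rpow_natCast _ _
    _ ≤ (2 * m) ^ k := by gcongr; linarith

theorem exists_crude_code_rate (w : lp (fun _ : ℤ => H) 2) {γ C : ℝ} (hγ0 : 0 < γ) (hγ1 : γ < 1)
    (hC : 0 ≤ C) (h : ∀ m : ℕ, ∃ E : Submodule ℝ H,
      FiniteDimensional ℝ E ∧ Module.finrank ℝ E ≤ m * m + 1 ∧
      ∀ k : ℤ, ∃ q ∈ E, ‖w k - q‖ ^ 2 ≤ C * γ ^ m / (k : ℝ) ^ 2) {s ε : ℝ} (hs : 0 ≤ s)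
    (hε : 0 < ε) :
    ∀ᶠ x : ℝ in atTop, ∃ α : Finset H, α.Nonempty ∧ log α.card ≤ x ∧
      distortion gaussSeq (gaussSeries w) α ≤ ε * x ^ (-s) := by
  obtain ⟨δ, hγδ, h4δ, hδ1⟩ : ∃ δ, γ ≤ δ ∧ 1 / 4 ≤ δ ∧ δ < 1 :=
    ⟨max γ (1 / 4), le_max_left _ _, le_max_right _ _, max_lt hγ1 (by norm_num)⟩
  have hδ0 : 0 ≤ δ := hγ0.le.trans hγδ
  obtain ⟨c4, hc4⟩ : ∃ c4, c4 = (∑' k, ‖w k‖ ^ 2) ^ 2 * ∫ x, x ^ 4 ∂(gaussianReal 0 1) := ⟨_, rfl⟩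
  have hc4' : 0 ≤ c4 := by
    rw [hc4]
    exact mul_nonneg (sq_nonneg _) (integral_nonneg fun x => by positivity)
  obtain ⟨Z, hZ⟩ : ∃ Z, Z = ∑' k : ℤ, 1 / (k : ℝ) ^ 2 := ⟨_, rfl⟩
  have hZ' : 0 ≤ Z := by
    rw [hZ]
    exact tsum_nonneg fun k => by positivity
  set K := C * Z + (1 + c4) with hK
  have hmt : Tendsto (fun x : ℝ => ⌊x ^ (1 / 4 : ℝ)⌋₊) atTop atTop :=
    tendsto_nat_floor_atTop.comp (tendsto_rpow_atTop (by norm_num))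
  have hlim := (tendsto_rpow_mul_pow_atTop (s := 4 * s + 2) hδ0 hδ1).const_mul K
  rw [mul_zero] at hlim
  have hev := hmt.eventually (hlim.eventually_lt_const hε)
  have h34 : Tendsto (fun x : ℝ => x ^ (1 / 4 : ℝ)) atTop atTop := tendsto_rpow_atTop (by norm_num)
  filter_upwards [hev, h34.eventually_ge_atTop 8, eventually_gt_atTop 0] with x hx hx8 hx0
  set y := x ^ (1 / 4 : ℝ) with hy
  set m := ⌊y⌋₊ with hm
  have hy4 : y ^ 4 = x := by
    rw [hy, ← rpow_natCast, ← rpow_mul hx0.le]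
    norm_num
  have hmy : (m : ℝ) ≤ y := Nat.floor_le (by linarith)
  have hmy1 : y < m + 1 := Nat.lt_floor_add_one y
  obtain ⟨E, hEfin, hEd, hE⟩ := h m
  obtain ⟨α, hα, hcard, hdist⟩ := exists_crude_code w E hE m
  rw [← hc4, ← hZ] at hdist
  have hEd' : (Module.finrank ℝ E : ℝ) ≤ m * m + 1 := by exact_mod_cast hEd
  refine ⟨α, hα, ?_, ?_⟩
  · have hα0 : (0 : ℝ) < α.card := by exact_mod_cast hα.card_pos
    have h4 : log (2 * 4 ^ m + 1) ≤ 2 * m + 2 := by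
      rw [log_le_iff_le_exp (by positivity)]
      have e2 : (4 : ℝ) ≤ exp 2 := by
        have := add_one_le_exp (1 : ℝ)
        have h2 : exp 2 = exp 1 * exp 1 := by rw [← exp_add]; norm_num
        nlinarith
      rw [exp_add, mul_comm 2 (m : ℝ), exp_nat_mul]
      have h5 : (4 : ℝ) ^ m ≤ exp 2 ^ m := by gcongr
      have h6 : (1 : ℝ) ≤ 4 ^ m := one_le_pow₀ (by norm_num)
      nlinarith
    calc log α.card ≤ log ((2 * 4 ^ m + 1) ^ Module.finrank ℝ E) :=
          log_le_log hα0 (by exact_mod_cast hcard)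
      _ = Module.finrank ℝ E * log (2 * 4 ^ m + 1) := by rw [log_pow]
      _ ≤ (m * m + 1) * (2 * m + 2) :=
          mul_le_mul hEd' h4 (log_nonneg (by linarith [pow_pos (show (0 : ℝ) < 4 by norm_num) m]))
            (by positivity)
      _ ≤ (y * y + 1) * (2 * y + 2) := by gcongr
      _ ≤ x := by
          rw [← hy4]
          nlinarith [mul_nonneg (show 0 ≤ y by linarith) (show 0 ≤ y by linarith),
            mul_le_mul_of_nonneg_left hx8 (show 0 ≤ y ^ 3 by positivity),
            mul_le_mul_of_nonneg_left hx8 (show 0 ≤ y ^ 2 by positivity)]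
  · have hm1 : (0 : ℝ) < m + 1 := by positivity
    have h5 : γ ^ m ≤ δ ^ m := pow_le_pow_left₀ hγ0.le hγδ m
    have h6 : (1 / 4 : ℝ) ^ m ≤ δ ^ m := pow_le_pow_left₀ (by norm_num) h4δ m
    have h7 : x ≤ ((m : ℝ) + 1) ^ (4 : ℝ) := by
      rw [← hy4, show (4 : ℝ) = (4 : ℕ) by norm_num, rpow_natCast]
      exact pow_le_pow_left₀ (by linarith) hmy1.le 4
    have h8 : x ^ s ≤ ((m : ℝ) + 1) ^ (4 * s) := by
      rw [rpow_mul hm1.le]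
      exact rpow_le_rpow hx0.le h7 hs
    have h9 : distortion gaussSeq (gaussSeries w) α ≤ K * (((m : ℝ) + 1) ^ (2 : ℝ) * δ ^ m) := by
      refine hdist.trans ?_
      rw [rpow_two]
      calc C * γ ^ m * Z + Module.finrank ℝ E * ((1 / 4) ^ m * (1 + c4))
          ≤ C * δ ^ m * Z + (m + 1) ^ 2 * (δ ^ m * (1 + c4)) := by
            gcongr
            exact hEd'.trans (by linarith [add_sq (m : ℝ) 1, (Nat.cast_nonneg m : (0 : ℝ) ≤ m)])
        _ ≤ (m + 1) ^ 2 * (C * δ ^ m * Z) + (m + 1) ^ 2 * (δ ^ m * (1 + c4)) := by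
            have : (1 : ℝ) ≤ (m + 1) ^ 2 := one_le_pow₀ (by
              linarith [(Nat.cast_nonneg m : (0 : ℝ) ≤ m)])
            have h0 : 0 ≤ C * δ ^ m * Z := by positivity
            exact add_le_add_left (le_mul_of_one_le_left h0 this) _
        _ = K * (((m : ℝ) + 1) ^ 2 * δ ^ m) := by rw [hK]; ring
    rw [rpow_neg hx0.le, ← div_eq_mul_inv, le_div_iff₀ (by positivity)]
    calc distortion gaussSeq (gaussSeries w) α * x ^ s
        ≤ K * (((m : ℝ) + 1) ^ (2 : ℝ) * δ ^ m) * ((m : ℝ) + 1) ^ (4 * s) := by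
          gcongr
      _ = K * (((m : ℝ) + 1) ^ (4 * s + 2) * δ ^ m) := by rw [rpow_add hm1]; ring
      _ ≤ ε := hx.le

end Crude

section Grid

/-- Mass that `f` gives to the `i`-th cell of the regular grid of mesh `T / n`. -/
def gridWeight (T : ℝ) (f : ℝ → ℝ) (n i : ℕ) : ℝ :=
  ∫ t, {t : ℝ | ⌊n * t / T⌋₊ = i}.indicator f t ∂(intervalMeasure T)

theorem gridPoint_mem {T : ℝ} (hT : 0 < T) {n i : ℕ} (hi : i ≤ n) :
    T * i / n ∈ Set.Icc 0 T := by
  have h1 : (i : ℝ) / n ≤ 1 := div_le_one_of_le₀ (by exact_mod_cast hi) (by positivity)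
  rw [mul_div_assoc]
  exact ⟨by positivity, by nlinarith⟩

theorem measurableSet_grid (T : ℝ) (n i : ℕ) : MeasurableSet {t : ℝ | ⌊n * t / T⌋₊ = i} := by
  have : Measurable fun t : ℝ => ⌊n * t / T⌋₊ := Nat.measurable_floor.comp (by fun_prop)
  exact this (measurableSet_singleton i)

theorem floor_le_of_mem {T t : ℝ} (hT : 0 < T) (ht : t ∈ Set.Icc 0 T) (n : ℕ) :
    ⌊n * t / T⌋₊ ≤ n := by
  have h1 : n * t / T ≤ n := by
    rw [div_le_iff₀ hT]
    exact mul_le_mul_of_nonneg_left ht.2 (Nat.cast_nonneg n)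
  exact Nat.floor_le_of_le h1

theorem tendsto_gridPoint {T t : ℝ} (hT : 0 < T) (ht : t ∈ Set.Icc 0 T) :
    Tendsto (fun n : ℕ => T * ⌊n * t / T⌋₊ / n) atTop (nhds t) := by
  have h1 : Tendsto (fun n : ℕ => T * ((⌊t / T * (n : ℝ)⌋₊ : ℝ) / n)) atTop (nhds (T * (t / T))) :=
    ((tendsto_nat_floor_mul_div_atTop (div_nonneg ht.1 hT.le)).comp
      tendsto_natCast_atTop_atTop).const_mul T
  rw [mul_div_cancel₀ _ hT.ne'] at h1
  refine h1.congr fun n => ?_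
  rw [mul_div_assoc, show t / T * (n : ℝ) = n * t / T by ring]

variable {E : Type*} [NormedAddCommGroup E] [NormedSpace ℝ E] [CompleteSpace E]

theorem ae_intervalMeasure_mem (T : ℝ) : ∀ᵐ t ∂(intervalMeasure T), t ∈ Set.Icc 0 T :=
  ae_restrict_mem measurableSet_Icc

theorem sum_gridWeight {T : ℝ} (hT : 0 < T) {f : ℝ → ℝ} (hf : Integrable f (intervalMeasure T))
    (g : ℝ → E) (n : ℕ) :
    ∑ i ∈ Finset.range (n + 1), gridWeight T f n i • g (T * i / n) =
      ∫ t, f t • g (T * ⌊n * t / T⌋₊ / n) ∂(intervalMeasure T) := by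
  simp only [gridWeight, ← integral_smul_const]
  rw [← integral_finsetSum _ fun i _ =>
    (hf.indicator (measurableSet_grid T n i)).smul_const (g (T * i / n))]
  refine integral_congr_ae ?_
  filter_upwards [ae_intervalMeasure_mem T] with t ht
  rw [Finset.sum_eq_single ⌊n * t / T⌋₊]
  · rw [Set.indicator_of_mem (by simp)]
  · intro i _ hi
    rw [Set.indicator_of_notMem (by simpa using hi.symm), zero_smul]
  · intro h
    exact absurd (Finset.mem_range.2 (Nat.lt_succ_of_le (floor_le_of_mem hT ht n))) h

theorem tendsto_sum_gridWeight {T : ℝ} (hT : 0 < T) {f : ℝ → ℝ}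
    (hf : Integrable f (intervalMeasure T)) {g : ℝ → E} (hg : ContinuousOn g (Set.Icc 0 T)) :
    Tendsto (fun n : ℕ => ∑ i ∈ Finset.range (n + 1), gridWeight T f n i • g (T * i / n)) atTop
      (nhds (∫ t, f t • g t ∂(intervalMeasure T))) := by
  obtain ⟨C, hC⟩ := isCompact_Icc.exists_bound_of_continuousOn hg
  simp_rw [sum_gridWeight hT hf]
  refine tendsto_integral_of_dominated_convergence (fun t => ‖f t‖ * C) (fun n => ?_)
    (hf.norm.mul_const C) (fun n => ?_) ?_
  · refine hf.aestronglyMeasurable.smul ?_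
    have h1 : StronglyMeasurable fun i : ℕ => g (T * i / n) := .of_discrete
    have h2 : Measurable fun t : ℝ => ⌊n * t / T⌋₊ := Nat.measurable_floor.comp (by fun_prop)
    exact (h1.comp_measurable h2).aestronglyMeasurable
  · filter_upwards [ae_intervalMeasure_mem T] with t ht
    rw [norm_smul]
    exact mul_le_mul_of_nonneg_left (hC _ (gridPoint_mem hT (floor_le_of_mem hT ht n)))
      (norm_nonneg _)
  · filter_upwards [ae_intervalMeasure_mem T] with t ht
    refine Tendsto.const_smul ?_ _
    have h1 := (hg t ht).tendsto
    refine h1.comp (tendsto_nhdsWithin_iff.2 ⟨tendsto_gridPoint hT ht, Eventually.of_forall fun n =>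
      gridPoint_mem hT (floor_le_of_mem hT ht n)⟩)

end Grid

section Kernel

open Classical in
/-- The kernel `r ↦ (t - r)₊ ^ β` as an element of `L²([0, T])`. -/
def kerLp {β : ℝ} (T : ℝ) (hβ : -1 / 2 < β) (t : ℝ) : Lp ℝ 2 (intervalMeasure T) :=
  if h : 0 ≤ t ∧ t ≤ T then (memLp_fracKer hβ h.1 h.2).toLp else 0

theorem kerLp_coeFn {T t β : ℝ} (hβ : -1 / 2 < β) (ht : t ∈ Set.Icc 0 T) :
    kerLp T hβ t =ᵐ[intervalMeasure T] fracKer β t := by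
  rw [kerLp, dif_pos (Set.mem_Icc.1 ht)]
  exact MemLp.coeFn_toLp _

theorem inner_kerLp_of_le {T s t β : ℝ} (hβ : -1 / 2 < β) (hs : s ∈ Set.Icc 0 T)
    (ht : t ∈ Set.Icc 0 T) (hst : s ≤ t) : inner ℝ (kerLp T hβ s) (kerLp T hβ t) =
      ∫ r in (0 : ℝ)..s, (t - r) ^ β * (s - r) ^ β := by
  rw [L2.inner_def]
  have h1 : ∫ r, inner ℝ (kerLp T hβ s r) (kerLp T hβ t r) ∂(intervalMeasure T) =
      ∫ r, fracKer β s r * fracKer β t r ∂(intervalMeasure T) := by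
    refine integral_congr_ae ?_
    filter_upwards [kerLp_coeFn hβ hs, kerLp_coeFn hβ ht] with r h1 h2
    rw [h1, h2]
    simp [mul_comm]
  rw [h1, integral_fracKer_mul hs.1 hs.2]
  refine intervalIntegral.integral_congr_ae ?_
  filter_upwards [compl_mem_ae_iff.2 (measure_singleton s)] with r hr hr'
  rw [Set.uIoc_of_le hs.1] at hr'
  have : r < t := lt_of_lt_of_le (lt_of_le_of_ne hr'.2 hr) hst
  rw [fracKer, if_pos this, mul_comm]

theorem inner_kerLp {T s t β : ℝ} (hβ : -1 / 2 < β) (hs : s ∈ Set.Icc 0 T)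
    (ht : t ∈ Set.Icc 0 T) : inner ℝ (kerLp T hβ s) (kerLp T hβ t) =
      ∫ r in (0 : ℝ)..(min s t), (t - r) ^ β * (s - r) ^ β := by
  rcases le_total s t with h | h
  · rw [min_eq_left h, inner_kerLp_of_le hβ hs ht h]
  · rw [min_eq_right h, real_inner_comm, inner_kerLp_of_le hβ ht hs h]
    simp only [mul_comm]

theorem inner_cosWaveLp_kerLp {T t β : ℝ} (hβ : -1 / 2 < β) (ht : t ∈ Set.Icc 0 T) (k : ℤ) :
    inner ℝ (cosWaveLp T k (π / 4)) (kerLp T hβ t) = fracWave T β k t := by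
  rw [L2.inner_def, fracWave]
  refine integral_congr_ae ?_
  filter_upwards [kerLp_coeFn hβ ht, cosWaveLp_coeFn T k (π / 4)] with r h1 h2
  rw [h1, h2]
  simp

end Kernel

section Law

theorem tendsto_sum_gridWeight_inner {Ω : Type*} {X : Ω → ℝ → ℝ} {T : ℝ}
    {Y : Ω → Lp ℝ 2 (intervalMeasure T)} (hT : 0 < T)
      (hXcont : ∀ ω, ContinuousOn (X ω) (Set.Icc 0 T))
    (hY : ∀ ω, (Y ω : ℝ → ℝ) =ᵐ[intervalMeasure T] X ω) (f : Lp ℝ 2 (intervalMeasure T)) (ω : Ω) :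
    Tendsto (fun n : ℕ => ∑ i ∈ Finset.range (n + 1), gridWeight T f n i * X ω (T * i / n)) atTop
      (nhds (inner ℝ f (Y ω))) := by
  have hf : Integrable f (intervalMeasure T) := (Lp.memLp f).integrable (by norm_num)
  have h := tendsto_sum_gridWeight hT hf (hXcont ω)
  have h1 : ∫ t, f t • X ω t ∂(intervalMeasure T) = inner ℝ f (Y ω) := by
    rw [L2.inner_def]
    refine integral_congr_ae ?_
    filter_upwards [hY ω] with t ht
    rw [ht]
    simp [mul_comm]
  rw [← h1]
  exact h

variable {Ω : Type*} [MeasurableSpace Ω] {P : Measure Ω} {X : Ω → ℝ → ℝ} {T β : ℝ}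

theorem memLp_of_map_gaussianReal {Z : Ω → ℝ} (hZ : Measurable Z) {v : NNReal}
    (h : P.map Z = gaussianReal 0 v) : MemLp Z 2 P := by
  have h1 : MemLp (id : ℝ → ℝ) 2 (P.map Z) := by
    rw [h]
    exact memLp_id_gaussianReal 2
  exact h1.comp_measurePreserving ⟨hZ, rfl⟩

theorem integral_cexp_of_map_gaussianReal {Z : Ω → ℝ} (hZ : Measurable Z) {v : NNReal}
    (h : P.map Z = gaussianReal 0 v) :
    ∫ ω, Complex.exp (Z ω * Complex.I) ∂P =
      Complex.exp (((-(∫ ω, Z ω ^ 2 ∂P) / 2 : ℝ)) : ℂ) := by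
  have h1 : ∫ ω, Z ω ^ 2 ∂P = v := by
    rw [← integral_sq_gaussianReal v, ← h, integral_map hZ.aemeasurable (by fun_prop)]
  have h2 : charFun (P.map Z) 1 = charFun (gaussianReal 0 v) 1 := by rw [h]
  rw [charFun_gaussianReal, charFun_apply_real, integral_map hZ.aemeasurable
    (Continuous.aestronglyMeasurable (by fun_prop))] at h2
  rw [h1]
  simp only [Complex.ofReal_one, one_mul] at h2
  rw [h2]
  congr 1
  push_cast
  ring

theorem integral_cexp_sum (hXmeas : ∀ t : ℝ, Measurable fun ω => X ω t)
    (hXgauss : ∀ (k : ℕ) (t : Fin k → ℝ) (c : Fin k → ℝ), ∃ v : NNReal,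
      Measure.map (fun ω => ∑ i, c i * X ω (t i)) P = gaussianReal 0 v)
    (hβ : -1 / 2 < β) (hXcov : ∀ s ∈ Set.Icc (0 : ℝ) T, ∀ t ∈ Set.Icc (0 : ℝ) T,
      ∫ ω, X ω s * X ω t ∂P = inner ℝ (kerLp T hβ s) (kerLp T hβ t))
    (k : ℕ) (t : Fin k → ℝ) (ht : ∀ i, t i ∈ Set.Icc 0 T) (c : Fin k → ℝ) :
    ∫ ω, Complex.exp ((∑ i, c i * X ω (t i) : ℝ) * Complex.I) ∂P =
      Complex.exp ((-‖∑ i, c i • kerLp T hβ (t i)‖ ^ 2 / 2 : ℝ) : ℂ) := by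
  obtain ⟨v, hv⟩ := hXgauss k t c
  have hm : Measurable fun ω => ∑ i, c i * X ω (t i) :=
    Finset.measurable_fun_sum _ fun i _ => (hXmeas (t i)).const_mul _
  rw [integral_cexp_of_map_gaussianReal hm hv]
  have hL2 : ∀ s, MemLp (fun ω => X ω s) 2 P := fun s => by
    obtain ⟨v, hv⟩ := hXgauss 1 (fun _ => s) (fun _ => 1)
    simp only [Finset.univ_unique, one_mul, Finset.sum_const, Finset.card_singleton, one_smul] at hv
    exact memLp_of_map_gaussianReal (hXmeas s) hv
  have hint : ∀ s u, Integrable (fun ω => X ω s * X ω u) P := fun s u =>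
    (hL2 s).integrable_mul (hL2 u)
  have h1 : ∫ ω, (∑ i, c i * X ω (t i)) ^ 2 ∂P = ‖∑ i, c i • kerLp T hβ (t i)‖ ^ 2 := by
    rw [← real_inner_self_eq_norm_sq, sum_inner]
    simp only [inner_sum, inner_smul_left, inner_smul_right, conj_trivial]
    have h2 : ∀ ω, (∑ i, c i * X ω (t i)) ^ 2 =
        ∑ i, ∑ j, c i * (c j * (X ω (t i) * X ω (t j))) := fun ω => by
      rw [pow_two, Finset.sum_mul_sum]
      refine Finset.sum_congr rfl fun i _ => Finset.sum_congr rfl fun j _ => by ring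
    simp only [h2]
    rw [integral_finsetSum _ fun i _ => integrable_finsetSum _ fun j _ =>
      ((hint (t i) (t j)).const_mul _).const_mul _]
    refine Finset.sum_congr rfl fun i _ => ?_
    rw [integral_finsetSum _ fun j _ => ((hint (t i) (t j)).const_mul _).const_mul _]
    refine Finset.sum_congr rfl fun j _ => ?_
    rw [integral_const_mul, integral_const_mul, hXcov _ (ht i) _ (ht j)]
    ring
  rw [h1]

variable [IsProbabilityMeasure P]

theorem continuousOn_kerLp (hXmeas : ∀ t : ℝ, Measurable fun ω => X ω t)
    (hXcont : ∀ ω, ContinuousOn (X ω) (Set.Icc 0 T)) (hβ : -1 / 2 < β)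
    (hchar : ∀ (k : ℕ) (t : Fin k → ℝ), (∀ i, t i ∈ Set.Icc 0 T) → ∀ c : Fin k → ℝ,
      ∫ ω, Complex.exp ((∑ i, c i * X ω (t i) : ℝ) * Complex.I) ∂P =
        Complex.exp ((-‖∑ i, c i • kerLp T hβ (t i)‖ ^ 2 / 2 : ℝ) : ℂ)) :
    ContinuousOn (kerLp T hβ) (Set.Icc 0 T) := by
  intro t ht
  have h1 : Tendsto (fun s => ∫ ω, Complex.exp ((X ω s - X ω t : ℝ) * Complex.I) ∂P)
      (nhdsWithin t (Set.Icc 0 T)) (nhds (∫ _, 1 ∂P)) := by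
    refine tendsto_integral_filter_of_dominated_convergence (fun _ => 1)
      (Eventually.of_forall fun s => ?_)
      (Eventually.of_forall fun s => ae_of_all _ fun ω => (Complex.norm_exp_ofReal_mul_I _).le)
      (integrable_const 1) (ae_of_all _ fun ω => ?_)
    · have hc : Continuous fun x : ℝ => Complex.exp (x * Complex.I) := by fun_prop
      exact hc.comp_aestronglyMeasurable ((hXmeas s).sub (hXmeas t)).aestronglyMeasurable
    · have hc : Continuous fun x : ℝ => Complex.exp ((x - X ω t : ℝ) * Complex.I) := by fun_prop
      have h2 := (hc.tendsto (X ω t)).comp (hXcont ω t ht).tendsto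
      simpa [Function.comp_def] using h2
  have h2 : Tendsto (fun s => rexp (-‖kerLp T hβ s - kerLp T hβ t‖ ^ 2 / 2))
      (nhdsWithin t (Set.Icc 0 T)) (nhds 1) := by
    have h3 := h1.norm
    rw [integral_const, probReal_univ, one_smul, norm_one] at h3
    refine h3.congr' ?_
    filter_upwards [self_mem_nhdsWithin] with s hs
    have h4 := hchar 2 ![s, t] (by
      intro i
      fin_cases i
      exacts [hs, ht]) ![1, -1]
    simp only [Fin.sum_univ_two, Matrix.cons_val_zero, Matrix.cons_val_one, one_mul, neg_mul,
      one_smul, neg_smul, ← sub_eq_add_neg] at h4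
    rw [h4, Complex.norm_exp, Complex.ofReal_re]
  have h3 := (h2.log one_ne_zero).const_mul (-2)
  simp only [log_exp, log_one, mul_zero] at h3
  have h4 := h3.sqrt
  rw [sqrt_zero] at h4
  refine tendsto_iff_norm_sub_tendsto_zero.2 (h4.congr fun s => ?_)
  rw [show -2 * (-‖kerLp T hβ s - kerLp T hβ t‖ ^ 2 / 2) =
    ‖kerLp T hβ s - kerLp T hβ t‖ ^ 2 by ring,
    sqrt_sq (norm_nonneg _)]

theorem norm_sq_integral_smul_kerLp (hT : 0 < T) (hβ : -1 / 2 < β)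
    (hk : ContinuousOn (kerLp T hβ) (Set.Icc 0 T)) (f : Lp ℝ 2 (intervalMeasure T)) :
    ‖∫ t, f t • kerLp T hβ t ∂(intervalMeasure T)‖ ^ 2 =
      ∑' k, inner ℝ f (fracWaveLp T (by linarith : -1 < β) k) ^ 2 := by
  have hf : Integrable f (intervalMeasure T) := (Lp.memLp f).integrable (by norm_num)
  have hint : Integrable (fun t => f t • kerLp T hβ t) (intervalMeasure T) := by
    obtain ⟨C, hC⟩ := isCompact_Icc.exists_bound_of_continuousOn hk
    refine Integrable.mono' (hf.norm.mul_const C) (hf.aestronglyMeasurable.smul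
      (hk.aestronglyMeasurable measurableSet_Icc)) ?_
    filter_upwards [ae_intervalMeasure_mem T] with t ht
    rw [norm_smul]
    exact mul_le_mul_of_nonneg_left (hC t ht) (norm_nonneg _)
  rw [← (hasSum_inner_cosWaveLp_sq hT _).tsum_eq]
  refine tsum_congr fun k => ?_
  congr 1
  rw [← innerSL_apply_apply ℝ, ← ContinuousLinearMap.integral_comp_comm _ hint, L2.inner_def]
  refine integral_congr_ae ?_
  filter_upwards [ae_intervalMeasure_mem T, (memLp_fracWave T (by linarith : -1 < β) k).coeFn_toLp]
    with t ht h1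
  rw [innerSL_apply_apply, inner_smul_right, inner_cosWaveLp_kerLp hβ ht, fracWaveLp, h1]
  simp [mul_comm]

variable {Y : Ω → Lp ℝ 2 (intervalMeasure T)}

theorem measurable_inner_of_process (hT : 0 < T) (hXmeas : ∀ t : ℝ, Measurable fun ω => X ω t)
    (hXcont : ∀ ω, ContinuousOn (X ω) (Set.Icc 0 T))
    (hY : ∀ ω, (Y ω : ℝ → ℝ) =ᵐ[intervalMeasure T] X ω) (f : Lp ℝ 2 (intervalMeasure T)) :
    Measurable fun ω => inner ℝ f (Y ω) :=
  measurable_of_tendsto_metrizable (f := fun (n : ℕ) ω =>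
      ∑ i ∈ Finset.range (n + 1), gridWeight T f n i * X ω (T * i / n))
    (fun _ => Finset.measurable_fun_sum _ fun _ _ => (hXmeas _).const_mul _)
    (tendsto_pi_nhds.2 fun ω => tendsto_sum_gridWeight_inner hT hXcont hY f ω)

theorem integral_cexp_inner (hT : 0 < T) (hXmeas : ∀ t : ℝ, Measurable fun ω => X ω t)
    (hXcont : ∀ ω, ContinuousOn (X ω) (Set.Icc 0 T)) (hβ : -1 / 2 < β)
    (hchar : ∀ (k : ℕ) (t : Fin k → ℝ), (∀ i, t i ∈ Set.Icc 0 T) → ∀ c : Fin k → ℝ,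
      ∫ ω, Complex.exp ((∑ i, c i * X ω (t i) : ℝ) * Complex.I) ∂P =
        Complex.exp ((-‖∑ i, c i • kerLp T hβ (t i)‖ ^ 2 / 2 : ℝ) : ℂ))
    (hY : ∀ ω, (Y ω : ℝ → ℝ) =ᵐ[intervalMeasure T] X ω) (f : Lp ℝ 2 (intervalMeasure T)) :
    ∫ ω, Complex.exp ((inner ℝ f (Y ω) : ℝ) * Complex.I) ∂P = Complex.exp
      ((-(∑' k, inner ℝ f (fracWaveLp T (by linarith : -1 < β) k) ^ 2) / 2 : ℝ) : ℂ) := by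
  have hk := continuousOn_kerLp hXmeas hXcont hβ hchar
  rw [← norm_sq_integral_smul_kerLp hT hβ hk f]
  have hf : Integrable f (intervalMeasure T) := (Lp.memLp f).integrable (by norm_num)
  have hcexp : Continuous fun x : ℝ => Complex.exp (x * Complex.I) := by fun_prop
  have h1 : Tendsto (fun n : ℕ => ∫ ω, Complex.exp ((∑ i ∈ Finset.range (n + 1),
      gridWeight T f n i * X ω (T * i / n) : ℝ) * Complex.I) ∂P) atTop
      (nhds (∫ ω, Complex.exp ((inner ℝ f (Y ω) : ℝ) * Complex.I) ∂P)) := by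
    refine tendsto_integral_of_dominated_convergence (fun _ => 1) (fun n => ?_)
      (integrable_const 1)
      (fun n => ae_of_all _ fun ω => (Complex.norm_exp_ofReal_mul_I _).le)
      (ae_of_all _ fun ω => ?_)
    · have hm : Measurable fun ω => ∑ i ∈ Finset.range (n + 1),
          gridWeight T f n i * X ω (T * i / n) :=
        Finset.measurable_fun_sum _ fun i _ => (hXmeas _).const_mul _
      exact hcexp.comp_aestronglyMeasurable hm.aestronglyMeasurable
    · exact (hcexp.tendsto _).comp (tendsto_sum_gridWeight_inner hT hXcont hY f ω)
  refine tendsto_nhds_unique h1 ?_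
  have hc : Continuous fun x : Lp ℝ 2 (intervalMeasure T) =>
      Complex.exp ((-‖x‖ ^ 2 / 2 : ℝ) : ℂ) := by fun_prop
  refine ((hc.tendsto _).comp (tendsto_sum_gridWeight hT hf hk)).congr fun n => ?_
  have h2 := hchar (n + 1) (fun i => T * (i : ℕ) / n)
    (fun i => gridPoint_mem hT (Nat.lt_succ_iff.1 i.2)) (fun i => gridWeight T f n i)
  simp only [Finset.sum_range]
  exact h2.symm

theorem orthonormal_cosWaveLp (hT : 0 < T) :
    Orthonormal ℝ fun k : ℤ => cosWaveLp T k (π / 4) := by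
  rw [orthonormal_iff_ite]
  intro k l
  rw [inner_cosWaveLp hT, sub_self, cos_zero, show π / 4 + π / 4 = π / 2 by ring, cos_pi_div_two]
  simp

theorem measurable_of_process [MeasurableSpace (Lp ℝ 2 (intervalMeasure T))]
    [BorelSpace (Lp ℝ 2 (intervalMeasure T))] (hT : 0 < T)
    (hm : ∀ f : Lp ℝ 2 (intervalMeasure T), Measurable fun ω => inner ℝ f (Y ω)) :
    Measurable Y := by
  have : Fact ((2 : ENNReal) ≠ ⊤) := ⟨by norm_num⟩
  have hbot : (Submodule.span ℝ (Set.range fun k : ℤ => cosWaveLp T k (π / 4)))ᗮ = ⊥ := by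
    refine (Submodule.eq_bot_iff _).2 fun g hg => ?_
    have h1 := hasSum_inner_cosWaveLp_sq hT g
    have h2 : ∀ k : ℤ, inner ℝ (cosWaveLp T k (π / 4)) g ^ 2 = 0 := fun k => by
      rw [Submodule.inner_right_of_mem_orthogonal (Submodule.subset_span (Set.mem_range_self k)) hg]
      norm_num
    simp only [h2] at h1
    have := h1.unique hasSum_zero
    simpa using this
  set b := HilbertBasis.mkOfOrthogonalEqBot (orthonormal_cosWaveLp hT) hbot
  refine measurable_of_tendsto_metrizable' (atTop : Filter (Finset ℤ))
    (f := fun s ω => ∑ k ∈ s, b.repr (Y ω) k • b k) (fun s => ?_)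
    (tendsto_pi_nhds.2 fun ω => b.hasSum_repr (Y ω))
  refine Finset.measurable_fun_sum _ fun k _ => ?_
  simp only [b.repr_apply_apply]
  exact (hm (b k)).smul_const _

/-- The process, seen in `L²([0, T])`, has the law of a Gaussian series. -/
theorem map_process_eq [MeasurableSpace (Lp ℝ 2 (intervalMeasure T))]
    [BorelSpace (Lp ℝ 2 (intervalMeasure T))] (hT : 0 < T)
    (hXmeas : ∀ t : ℝ, Measurable fun ω => X ω t)
    (hXcont : ∀ ω, ContinuousOn (X ω) (Set.Icc 0 T)) (hβ : -1 / 2 < β)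
    (hchar : ∀ (k : ℕ) (t : Fin k → ℝ), (∀ i, t i ∈ Set.Icc 0 T) → ∀ c : Fin k → ℝ,
      ∫ ω, Complex.exp ((∑ i, c i * X ω (t i) : ℝ) * Complex.I) ∂P =
        Complex.exp ((-‖∑ i, c i • kerLp T hβ (t i)‖ ^ 2 / 2 : ℝ) : ℂ))
    (hY : ∀ ω, (Y ω : ℝ → ℝ) =ᵐ[intervalMeasure T] X ω)
    (v : lp (fun _ : ℤ => Lp ℝ 2 (intervalMeasure T)) 2)
    (hv : ∀ k, v k = fracWaveLp T (by linarith : -1 < β) k) :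
    Measurable Y ∧ P.map Y = gaussSeq.map (gaussSeries v) := by
  have : Fact ((2 : ENNReal) ≠ ⊤) := ⟨by norm_num⟩
  have hYm : Measurable Y :=
    measurable_of_process hT (measurable_inner_of_process hT hXmeas hXcont hY)
  refine ⟨hYm, ?_⟩
  have := Measure.isProbabilityMeasure_map hYm.aemeasurable (μ := P)
  have := Measure.isProbabilityMeasure_map
    (Lp.aestronglyMeasurable (gaussSeries v)).aemeasurable (μ := gaussSeq)
  refine Measure.ext_of_charFun (funext fun f => ?_)
  rw [charFun_gaussSeries, charFun_apply, integral_map hYm.aemeasurable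
    (Continuous.aestronglyMeasurable (by fun_prop))]
  simp only [hv, real_inner_comm f]
  exact integral_cexp_inner hT hXmeas hXcont hβ hchar hY f

end Law

section SymmetricSums

/-- Nonzero integers of absolute value at most `N`. -/
def symIcc (N : ℕ) : Finset ℤ := (Finset.Icc (-(N : ℤ)) N).erase 0

theorem mem_symIcc {N : ℕ} {k : ℤ} : k ∈ symIcc N ↔ k ≠ 0 ∧ k.natAbs ≤ N := by
  rw [symIcc, Finset.mem_erase, Finset.mem_Icc]
  omega

theorem symIcc_subset {N J : ℕ} (h : N ≤ J) : symIcc N ⊆ symIcc J := fun k hk => by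
  rw [mem_symIcc] at hk ⊢
  omega

theorem sum_symIcc (f : ℕ → ℝ) (N : ℕ) :
    ∑ k ∈ symIcc N, f k.natAbs = 2 * ∑ k ∈ Finset.Icc 1 N, f k := by
  induction N with
  | zero =>
    have : symIcc 0 = ∅ := Finset.eq_empty_of_forall_notMem fun k hk => by
      rw [mem_symIcc] at hk
      omega
    simp [this]
  | succ N ih =>
    have h1 : symIcc (N + 1) = insert ((N : ℤ) + 1) (insert (-((N : ℤ) + 1)) (symIcc N)) := by
      ext k
      simp only [Finset.mem_insert, mem_symIcc]
      omega
    have h2 : -((N : ℤ) + 1) ∉ symIcc N := fun h => by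
      rw [mem_symIcc] at h
      omega
    have h3 : ((N : ℤ) + 1) ∉ insert (-((N : ℤ) + 1)) (symIcc N) := fun h => by
      simp only [Finset.mem_insert, mem_symIcc] at h
      omega
    have h4 : ((N : ℤ) + 1).natAbs = N + 1 := by omega
    have h5 : (-((N : ℤ) + 1)).natAbs = N + 1 := by omega
    rw [h1, Finset.sum_insert h3, Finset.sum_insert h2, ih, Finset.sum_Icc_succ_top (by omega), h4,
      h5]
    ring

theorem card_symIcc (N : ℕ) : ((symIcc N).card : ℝ) = 2 * N := by
  have := sum_symIcc (fun _ => 1) N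
  simpa using this

theorem exists_subset_symIcc (s : Finset ℤ) (hs : 0 ∉ s) (N : ℕ) :
    ∃ J, N ≤ J ∧ s ⊆ symIcc J := by
  refine ⟨N + s.sup Int.natAbs, by omega, fun k hk => ?_⟩
  rw [mem_symIcc]
  refine ⟨fun h => hs (h ▸ hk), ?_⟩
  have := Finset.le_sup (f := Int.natAbs) hk
  omega

end SymmetricSums

section Sums

theorem rpow_tangent_le {p x y : ℝ} (hp : p ≤ 0) (hx : 0 < x) (hy : 0 < y) :
    x ^ p + p * x ^ (p - 1) * (y - x) ≤ y ^ p := by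
  have h1 : 1 + p * (y / x - 1) ≤ (y / x) ^ p := by
    have hxy : 0 < y / x := by positivity
    rw [rpow_def_of_pos hxy]
    have h2 := log_le_sub_one_of_pos hxy
    nlinarith [add_one_le_exp (log (y / x) * p)]
  have h3 : y ^ p = x ^ p * (y / x) ^ p := by
    rw [← mul_rpow hx.le (by positivity), mul_div_cancel₀ _ hx.ne']
  have h4 : x ^ (p - 1) = x ^ p / x := by rw [rpow_sub hx, rpow_one]
  rw [h3, h4]
  calc x ^ p + p * (x ^ p / x) * (y - x) = x ^ p * (1 + p * (y / x - 1)) := by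
        field_simp
    _ ≤ _ := mul_le_mul_of_nonneg_left h1 (by positivity)

theorem sum_Ioc_rpow_le {b : ℝ} (hb : 1 < b) {N J : ℕ} (hN : 1 ≤ N) (hJ : N ≤ J) :
    ∑ k ∈ Finset.Ioc N J, (k : ℝ) ^ (-b) ≤ (N : ℝ) ^ (1 - b) / (b - 1) := by
  have hb1 : 0 < b - 1 := by linarith
  have key : ∑ k ∈ Finset.Ioc N J, (k : ℝ) ^ (-b) ≤
      ((N : ℝ) ^ (1 - b) - (J : ℝ) ^ (1 - b)) / (b - 1) := by
    induction J, hJ using Nat.le_induction with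
    | base => simp
    | succ J hJ ih =>
      rw [Finset.sum_Ioc_succ_top (by omega)]
      have hJ0 : (0 : ℝ) < J := by exact_mod_cast (by omega : 0 < J)
      have h1 := rpow_tangent_le (p := 1 - b) (by linarith)
        (by positivity : (0 : ℝ) < (J + 1 : ℕ)) hJ0
      rw [show 1 - b - 1 = -b by ring] at h1
      rw [le_div_iff₀ hb1] at ih ⊢
      push_cast at h1 ⊢
      nlinarith
  refine key.trans ?_
  gcongr
  have : (0 : ℝ) ≤ (J : ℝ) ^ (1 - b) := by positivity
  linarith

theorem le_sum_Ioc_rpow {b : ℝ} (hb : 1 < b) {N J : ℕ} (hJ : N ≤ J) :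
    ((N + 1 : ℝ) ^ (1 - b) - (J + 1 : ℝ) ^ (1 - b)) / (b - 1) ≤
      ∑ k ∈ Finset.Ioc N J, (k : ℝ) ^ (-b) := by
  have hb1 : 0 < b - 1 := by linarith
  induction J, hJ using Nat.le_induction with
  | base => simp
  | succ J hJ ih =>
    rw [Finset.sum_Ioc_succ_top (by omega)]
    have h1 := rpow_tangent_le (p := 1 - b) (by linarith)
      (by positivity : (0 : ℝ) < (J + 1 : ℝ)) (by positivity : (0 : ℝ) < (J + 1 : ℝ) + 1)
    rw [show 1 - b - 1 = -b by ring] at h1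
    rw [div_le_iff₀ hb1] at ih ⊢
    push_cast at h1 ⊢
    nlinarith

theorem sum_log_ge (N : ℕ) : N * log N - N ≤ ∑ k ∈ Finset.Icc 1 N, log (k : ℝ) := by
  induction N with
  | zero => simp
  | succ N ih =>
    rw [Finset.sum_Icc_succ_top (by omega)]
    rcases Nat.eq_zero_or_pos N with rfl | hN
    · simp
    have hN0 : (0 : ℝ) < N := by exact_mod_cast hN
    have h1 := log_le_sub_one_of_pos (by positivity : 0 < ((N : ℝ) + 1) / N)
    rw [log_div (by positivity) (by positivity)] at h1
    have h2 : N * (((N : ℝ) + 1) / N - 1) = 1 := by field_simp; ring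
    push_cast
    nlinarith [mul_le_mul_of_nonneg_left h1 hN0.le]

theorem sum_log_le {N : ℕ} (hN : 1 ≤ N) :
    ∑ k ∈ Finset.Icc 1 N, log (k : ℝ) ≤ N * log N - N + log N + 1 := by
  induction N, hN using Nat.le_induction with
  | base => simp
  | succ N hN ih =>
    rw [Finset.sum_Icc_succ_top (by omega)]
    have hN0 : (0 : ℝ) < N := by exact_mod_cast hN
    have h1 := log_le_sub_one_of_pos (by positivity : 0 < (N : ℝ) / (N + 1))
    rw [log_div (by positivity) (by positivity)] at h1
    have h2 : ((N : ℝ) + 1) * (N / (N + 1) - 1) = -1 := by field_simp; ring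
    have h3 := mul_le_mul_of_nonneg_left h1 (by positivity : (0 : ℝ) ≤ N + 1)
    push_cast
    nlinarith

end Sums

section Reduction

theorem continuous_iInf_sum_sq {ι κ : Type*} [Fintype ι] [Fintype κ] [Nonempty κ] (σ : ι → ℝ)
    (a : κ → ι → ℝ) : Continuous fun x : ι → ℝ => ⨅ i, ∑ j, (σ j * x j - a i j) ^ 2 := by
  simp_rw [← Finset.inf'_univ_eq_ciInf]
  exact Continuous.finset_inf'_apply _ fun i _ => by fun_prop

theorem integral_gaussSeq_iInf_sum_sq {κ : Type*} [Fintype κ] [Nonempty κ] (S : Finset ℤ)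
    (σ : ℤ → ℝ) (a : κ → S → ℝ) :
    ∫ ω : ℤ → ℝ, (⨅ i, ∑ j : S, (σ j * ω j - a i j) ^ 2) ∂gaussSeq =
      ∫ x, (⨅ i, ∑ j : S, (σ j * x j - a i j) ^ 2) ∂(stdGauss S) :=
  integral_restrict_infinitePi (fun _ : ℤ => gaussianReal 0 1) (s := S)
    (f := fun x : S → ℝ => ⨅ i, ∑ j : S, (σ j * x j - a i j) ^ 2)
    (continuous_iInf_sum_sq (fun j : S => σ j) a).aestronglyMeasurable

theorem integrable_gaussSeq_iInf_sum_sq {κ : Type*} [Fintype κ] [Nonempty κ] (S : Finset ℤ)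
    (σ : ℤ → ℝ) (a : κ → S → ℝ) :
    Integrable (fun ω : ℤ → ℝ => ⨅ i, ∑ j : S, (σ j * ω j - a i j) ^ 2) gaussSeq := by
  obtain ⟨i₀⟩ := ‹Nonempty κ›
  have hint : Integrable (fun ω : ℤ → ℝ => ∑ j : S, (σ j * ω j - a i₀ j) ^ 2) gaussSeq :=
    integrable_finsetSum _ fun j _ =>
      (((memLp_coord j).const_mul (σ j)).sub (memLp_const (a i₀ j))).integrable_sq
  have hm : Measurable fun ω : ℤ → ℝ => ⨅ i, ∑ j : S, (σ j * ω j - a i j) ^ 2 :=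
    have : Nonempty κ := ⟨i₀⟩
    (continuous_iInf_sum_sq (fun j : S => σ j) a).measurable.comp
      (g := fun x : S → ℝ => ⨅ i, ∑ j : S, (σ j * x j - a i j) ^ 2)
      (f := fun ω : ℤ → ℝ => S.restrict ω) (Finset.measurable_restrict S)
  refine hint.mono' hm.aestronglyMeasurable (ae_of_all _ fun ω => ?_)
  rw [norm_of_nonneg (Real.iInf_nonneg fun i => Finset.sum_nonneg fun j _ => sq_nonneg _)]
  exact ciInf_le (Set.finite_range _).bddBelow i₀

variable {H : Type*} [NormedAddCommGroup H] [InnerProductSpace ℝ H] [CompleteSpace H]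
  {u : ℤ → H} {σ : ℤ → ℝ} {c : lp (fun _ : ℤ => H) 2}

theorem inner_gaussSeries_ae (hu : Orthonormal ℝ u) (hc : ∀ k, c k = σ k • u k) :
    ∀ᵐ ω ∂gaussSeq, ∀ k, inner ℝ (u k) ((gaussSeries c : (ℤ → ℝ) → H) ω) = σ k * ω k := by
  refine ae_all_iff.2 fun k => ?_
  obtain ⟨w, hw⟩ := exists_lp_map (innerSL ℝ (u k)) c
  have h1 : ∀ l, l ≠ k → w l = 0 := fun l hl => by
    rw [hw, innerSL_apply_apply, hc, inner_smul_right, hu.2 hl.symm, mul_zero]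
  have h2 : w k = σ k := by
    rw [hw, innerSL_apply_apply, hc, inner_smul_right, real_inner_self_eq_norm_sq, hu.1 k]
    ring
  filter_upwards [gaussSeries_map (innerSL ℝ (u k)) hw, gaussSeries_eq_of_single h1] with ω h3 h4
  rw [h3, innerSL_apply_apply] at h4
  rw [h4, h2, smul_eq_mul, mul_comm]

theorem le_distortion_gaussSeries (hu : Orthonormal ℝ u) (hc : ∀ k, c k = σ k • u k)
    {S A : Finset ℤ} (hAS : A ⊆ S) {θ : ℝ} (hθ : 0 < θ) (hA : ∀ j ∈ A, 0 < σ j)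
    (hB : ∀ j ∈ S, j ∉ A → σ j ^ 2 ≤ θ) {α : Finset H} (hα : α.Nonempty) :
    ∑ j ∈ A, θ * (1 + log (σ j ^ 2 / θ)) + ∑ j ∈ S \ A, σ j ^ 2 - 2 * θ * log α.card ≤
      distortion gaussSeq (gaussSeries c) α := by
  classical
  have : Nonempty α := hα.to_subtype
  have h1 := stdGauss_integral_iInf_ge (fun j : S => σ j)
    (Finset.univ.filter fun j : S => (j : ℤ) ∈ A)
    hθ (fun j hj => hA j (Finset.mem_filter.1 hj).2)
    (fun j hj => hB j j.2 fun h => hj (Finset.mem_filter.2 ⟨Finset.mem_univ _, h⟩))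
    (fun (a : α) (j : S) => inner ℝ (u j) (a : H))
  have h2 : ∑ j : S, (if j ∈ Finset.univ.filter fun j : S => (j : ℤ) ∈ A then
      θ * (1 + log (σ j ^ 2 / θ)) else σ j ^ 2) =
      ∑ j ∈ A, θ * (1 + log (σ j ^ 2 / θ)) + ∑ j ∈ S \ A, σ j ^ 2 := by
    simp only [Finset.mem_filter, Finset.mem_univ, true_and]
    rw [Finset.sum_coe_sort S (fun j : ℤ => if j ∈ A then θ * (1 + log (σ j ^ 2 / θ)) else σ j ^ 2),
      Finset.sum_ite, Finset.filter_mem_eq_inter, Finset.inter_eq_right.2 hAS,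
      Finset.filter_notMem_eq_sdiff]
  rw [h2, Fintype.card_coe, ← integral_gaussSeq_iInf_sum_sq S σ] at h1
  refine h1.trans (integral_mono_of_nonneg (ae_of_all _ fun ω => Real.iInf_nonneg fun i =>
    Finset.sum_nonneg fun j _ => sq_nonneg _) (integrable_iInf_norm_sub_sq
    (Lp.aestronglyMeasurable _) (integrable_norm_sq_gaussSeries c) hα) ?_)
  filter_upwards [inner_gaussSeries_ae hu hc] with ω hω
  refine ciInf_mono (Set.finite_range _).bddBelow fun a => ?_
  have h3 := hu.sum_inner_products_le ((gaussSeries c : (ℤ → ℝ) → H) ω - a) (s := S)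
  refine le_trans (le_of_eq ?_) h3
  rw [← Finset.sum_coe_sort S]
  refine Finset.sum_congr rfl fun j _ => ?_
  rw [inner_sub_right, hω, norm_eq_abs, sq_abs]

theorem exists_distortion_gaussSeries_le (hu : Orthonormal ℝ u) (hc : ∀ k, c k = σ k • u k)
    (S : Finset ℤ) {κ : Type*} [Fintype κ] [Nonempty κ] (a : κ → S → ℝ) :
    ∃ α : Finset H, α.Nonempty ∧ α.card ≤ Fintype.card κ ∧
      distortion gaussSeq (gaussSeries c) α ≤ ∑' k, (if k ∈ S then 0 else σ k ^ 2) +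
        ∫ x, (⨅ i, ∑ j : S, (σ j * x j - a i j) ^ 2) ∂(stdGauss S) := by
  classical
  set v : S → H := fun j => u j with hvdef
  have hv : Orthonormal ℝ v := hu.comp _ Subtype.val_injective
  set pt : κ → H := fun i => ∑ j, a i j • v j with hpt
  refine ⟨Finset.univ.image pt, Finset.univ_nonempty.image _, Finset.card_image_le, ?_⟩
  set L : H →L[ℝ] H := ContinuousLinearMap.id ℝ H -
    ∑ j, (innerSL ℝ (v j)).smulRight (v j) with hL
  have hLx : ∀ x, L x = x - ∑ j, inner ℝ (v j) x • v j := fun x => by simp [hL]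
  obtain ⟨w, hw⟩ := exists_lp_map L c
  have hwk : ∀ k, ‖w k‖ ^ 2 = if k ∈ S then 0 else σ k ^ 2 := fun k => by
    rw [hw, hLx, hc]
    simp only [hvdef, inner_smul_right]
    rw [Finset.sum_coe_sort S (fun j : ℤ => (σ k * inner ℝ (u j) (u k)) • u j)]
    have h1 : ∀ j, (σ k * inner ℝ (u j) (u k)) • u j = if j = k then σ k • u k else 0 := fun j => by
      rw [orthonormal_iff_ite.1 hu j k]
      split_ifs with h
      · rw [h, mul_one]
      · rw [mul_zero, zero_smul]
    simp only [h1, Finset.sum_ite_eq']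
    split_ifs with h
    · simp
    · rw [sub_zero, norm_smul, hu.1 k, mul_one, norm_eq_abs, sq_abs]
  have hint1 := integrable_norm_sq_gaussSeries w
  have hint2 := integrable_gaussSeq_iInf_sum_sq S σ a
  have h2 := integral_norm_sq_gaussSeries w
  simp only [hwk] at h2
  rw [← h2, ← integral_gaussSeq_iInf_sum_sq S σ, ← integral_add hint1 hint2]
  refine integral_mono_of_nonneg (ae_of_all _ fun ω => iInf_norm_sub_sq_nonneg _ _)
    (hint1.add hint2) ?_
  filter_upwards [inner_gaussSeries_ae hu hc, gaussSeries_map L hw] with ω hω hω'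
  obtain ⟨i, hi⟩ := exists_eq_ciInf_of_finite (f := fun i => ∑ j : S, (σ j * ω j - a i j) ^ 2)
  refine (iInf_norm_sub_sq_le (a := pt i) (by simp) _).trans (le_of_eq ?_)
  rw [← hi, hω', hLx, hpt, norm_sub_sum_smul_sq hv]
  simp only [hvdef, hω]

end Reduction

section PowerLaw

theorem tendsto_floor_rpow_mul {a p l : ℝ} (ha : 0 < a) {g : ℕ → ℝ}
    (hg : Tendsto g atTop (nhds l)) :
    Tendsto (fun x : ℝ => x ^ p * ((⌊a * x⌋₊ : ℝ) ^ (-p) * g ⌊a * x⌋₊)) atTop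
      (nhds (a ^ (-p) * l)) := by
  have h1 : Tendsto (fun x : ℝ => ((⌊a * x⌋₊ : ℝ) / x) ^ (-p)) atTop (nhds (a ^ (-p))) :=
    (tendsto_nat_floor_mul_div_atTop ha.le).rpow_const (Or.inl ha.ne')
  have h2 : Tendsto (fun x : ℝ => g ⌊a * x⌋₊) atTop (nhds l) :=
    hg.comp (tendsto_nat_floor_atTop.comp (tendsto_id.const_mul_atTop ha))
  refine (h1.mul h2).congr' ?_
  filter_upwards [eventually_gt_atTop 0] with x hx
  rw [div_rpow (Nat.cast_nonneg _) hx.le, rpow_neg hx.le p, div_inv_eq_mul]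
  ring

variable {H : Type*} [NormedAddCommGroup H] [InnerProductSpace ℝ H] [CompleteSpace H]
  {u : ℤ → H} {σ : ℤ → ℝ} {c : lp (fun _ : ℤ => H) 2} {b K : ℝ}

theorem sum_log_symIcc (hK : 0 < K) (hσ : ∀ k, σ k ^ 2 = K * (k.natAbs : ℝ) ^ (-b)) {N : ℕ}
    (hN : 1 ≤ N) :
    ∑ k ∈ symIcc N, log (σ k ^ 2 / (K * (N : ℝ) ^ (-b))) =
      2 * b * (N * log N - ∑ k ∈ Finset.Icc 1 N, log (k : ℝ)) := by
  have hN0 : (0 : ℝ) < N := by exact_mod_cast hN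
  have h1 : ∀ k ∈ symIcc N, log (σ k ^ 2 / (K * (N : ℝ) ^ (-b))) =
      (fun j : ℕ => b * log N - b * log j) k.natAbs := fun k hk => by
    have hk0 : (0 : ℝ) < k.natAbs := by
      exact_mod_cast Int.natAbs_pos.2 (mem_symIcc.1 hk).1
    rw [hσ, mul_div_mul_left _ _ hK.ne', log_div (by positivity) (by positivity), log_rpow hk0,
      log_rpow hN0]
    ring
  rw [Finset.sum_congr rfl h1, sum_symIcc fun j : ℕ => b * log N - b * log j,
    Finset.sum_sub_distrib, ← Finset.mul_sum,
    ← Finset.mul_sum]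
  simp only [Finset.sum_const, Nat.card_Icc, nsmul_eq_mul, Nat.add_sub_cancel]
  ring

theorem sum_sdiff_symIcc (hσ : ∀ k, σ k ^ 2 = K * (k.natAbs : ℝ) ^ (-b)) {N J : ℕ}
    (hJ : N ≤ J) :
    ∑ k ∈ symIcc J \ symIcc N, σ k ^ 2 = 2 * K * ∑ k ∈ Finset.Ioc N J, (k : ℝ) ^ (-b) := by
  have h1 := Finset.sum_sdiff (f := fun k => σ k ^ 2) (symIcc_subset hJ)
  have h2 : ∀ M : ℕ, ∑ k ∈ symIcc M, σ k ^ 2 =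
      2 * ∑ k ∈ Finset.Icc 1 M, K * (k : ℝ) ^ (-b) := fun M => by
    rw [← sum_symIcc fun j : ℕ => K * (j : ℝ) ^ (-b)]
    exact Finset.sum_congr rfl fun k _ => hσ k
  have h3 : ∑ k ∈ Finset.Icc 1 N, (k : ℝ) ^ (-b) + ∑ k ∈ Finset.Ioc N J, (k : ℝ) ^ (-b) =
      ∑ k ∈ Finset.Icc 1 J, (k : ℝ) ^ (-b) := by
    rw [← Finset.sum_union (Finset.disjoint_left.2 fun k hk hk' => by
      rw [Finset.mem_Icc] at hk
      rw [Finset.mem_Ioc] at hk'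
      omega)]
    refine Finset.sum_congr (Finset.ext fun k => ?_) fun _ _ => rfl
    rw [Finset.mem_union, Finset.mem_Icc, Finset.mem_Ioc, Finset.mem_Icc]
    omega
  rw [h2, h2, ← Finset.mul_sum, ← Finset.mul_sum, ← h3] at h1
  linarith

theorem le_distortion_powerLaw (hb : 1 < b) (hK : 0 < K) (hu : Orthonormal ℝ u)
    (hc : ∀ k, c k = σ k • u k) (hσ0 : ∀ k, k ≠ 0 → 0 < σ k)
    (hσ : ∀ k, σ k ^ 2 = K * (k.natAbs : ℝ) ^ (-b)) {N : ℕ} (hN : 1 ≤ N) {α : Finset H}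
    (hα : α.Nonempty) (hcard : log α.card ≤ b * (N + 1)) :
    (N : ℝ) ^ (-(b - 1)) * (2 * K * (1 - b * (log N / N) - 2 * b * (1 / N) +
      (1 + 1 / N) ^ (-(b - 1)) / (b - 1))) ≤ distortion gaussSeq (gaussSeries c) α := by
  have hN0 : (0 : ℝ) < N := by exact_mod_cast hN
  have hb1 : 0 < b - 1 := by linarith
  set θ := K * (N : ℝ) ^ (-b) with hθ
  have hθ0 : 0 < θ := by positivity
  have hlim : Tendsto (fun J : ℕ => 2 * θ * (N - b * log N - 2 * b) +
      2 * K * (((N + 1 : ℝ) ^ (-(b - 1)) - (J + 1 : ℝ) ^ (-(b - 1))) / (b - 1))) atTop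
      (nhds (2 * θ * (N - b * log N - 2 * b) +
      2 * K * (((N + 1 : ℝ) ^ (-(b - 1)) - 0) / (b - 1)))) := by
    refine tendsto_const_nhds.add (((tendsto_const_nhds.sub ?_).div_const _).const_mul _)
    exact (tendsto_rpow_neg_atTop hb1).comp
      (tendsto_atTop_add_const_right _ _ tendsto_natCast_atTop_atTop)
  refine le_trans (le_of_eq ?_) (le_of_tendsto hlim ?_)
  · have h1 : (N : ℝ) ^ (-(b - 1)) = (N : ℝ) ^ (-b) * N := by
      rw [← rpow_add_one hN0.ne']
      congr 1
      ring
    have h2 : (N + 1 : ℝ) ^ (-(b - 1)) = (N : ℝ) ^ (-(b - 1)) * (1 + 1 / N) ^ (-(b - 1)) := by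
      rw [← mul_rpow hN0.le (by positivity)]
      congr 1
      field_simp
    rw [h2, h1, hθ]
    field_simp
    ring
  · filter_upwards [eventually_ge_atTop N] with J hJ
    refine le_trans ?_ (le_distortion_gaussSeries hu hc (symIcc_subset hJ) hθ0
      (fun j hj => hσ0 j (mem_symIcc.1 hj).1) (fun j hj hj' => ?_) hα)
    · rw [← Finset.mul_sum, Finset.sum_add_distrib, sum_log_symIcc hK hσ hN,
        sum_sdiff_symIcc hσ hJ]
      have h1 := le_sum_Ioc_rpow hb hJ
      have h2 := sum_log_le hN
      have h3 : ∑ k ∈ symIcc N, (1 : ℝ) = 2 * N := by simpa using card_symIcc N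
      rw [h3, neg_sub]
      have h4 : 2 * θ * log α.card ≤ 2 * θ * (b * (N + 1)) := by gcongr
      have h5 := mul_le_mul_of_nonneg_left h1 (by positivity : 0 ≤ 2 * K)
      have h6 := mul_le_mul_of_nonneg_left h2 (by positivity : 0 ≤ 2 * θ * b)
      linear_combination h4 + h5 + h6
    · rw [hσ, hθ]
      have h1 : N < j.natAbs := by
        by_contra! h
        exact hj' (mem_symIcc.2 ⟨(mem_symIcc.1 hj).1, h⟩)
      gcongr K * ?_
      exact rpow_le_rpow_of_nonpos hN0 (by exact_mod_cast h1.le) (by linarith)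

theorem eventually_le_distortion_powerLaw (hb : 1 < b) (hK : 0 < K) (hu : Orthonormal ℝ u)
    (hc : ∀ k, c k = σ k • u k) (hσ0 : ∀ k, k ≠ 0 → 0 < σ k)
    (hσ : ∀ k, σ k ^ 2 = K * (k.natAbs : ℝ) ^ (-b)) {ℓ : ℝ}
    (hℓ : ℓ < 2 * K * b ^ (b - 1) * (b / (b - 1))) :
    ∀ᶠ x : ℝ in atTop, ∀ α : Finset H, α.Nonempty → log α.card ≤ x →
      ℓ * x ^ (-(b - 1)) ≤ distortion gaussSeq (gaussSeries c) α := by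
  have hb0 : 0 < b := by linarith
  have hb1 : 0 < b - 1 := by linarith
  have hg : Tendsto (fun N : ℕ => 2 * K * (1 - b * (log N / N) - 2 * b * (1 / N) +
      (1 + 1 / (N : ℝ)) ^ (-(b - 1)) / (b - 1))) atTop
      (nhds (2 * K * (1 - b * 0 - 2 * b * 0 + (1 + 0) ^ (-(b - 1)) / (b - 1)))) := by
    have h1 : Tendsto (fun N : ℕ => log (N : ℝ) / N) atTop (nhds 0) :=
      isLittleO_log_id_atTop.tendsto_div_nhds_zero.comp tendsto_natCast_atTop_atTop
    have h2 : Tendsto (fun N : ℕ => 1 / (N : ℝ)) atTop (nhds 0) :=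
      tendsto_one_div_atTop_nhds_zero_nat
    refine (((tendsto_const_nhds.sub (h1.const_mul b)).sub (h2.const_mul _)).add
      (((tendsto_const_nhds.add h2).rpow_const (Or.inl (by norm_num))).div_const _)).const_mul _
  have h1 := tendsto_floor_rpow_mul (p := b - 1) (inv_pos.2 hb0) hg
  have h2 : b⁻¹ ^ (-(b - 1)) *
      (2 * K * (1 - b * 0 - 2 * b * 0 + (1 + 0) ^ (-(b - 1)) / (b - 1))) =
      2 * K * b ^ (b - 1) * (b / (b - 1)) := by
    rw [inv_rpow hb0.le, rpow_neg hb0.le, inv_inv, add_zero, one_rpow]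
    field_simp
    ring
  rw [h2] at h1
  filter_upwards [h1.eventually_const_lt hℓ, eventually_ge_atTop b] with x hx hxb α hα hαx
  have hx0 : 0 < x := hb0.trans_le hxb
  have hN : 1 ≤ ⌊b⁻¹ * x⌋₊ := by
    rw [Nat.one_le_floor_iff, ← div_eq_inv_mul, one_le_div hb0]
    exact hxb
  refine le_trans ?_ (le_distortion_powerLaw hb hK hu hc hσ0 hσ hN hα (hαx.trans ?_))
  · rw [rpow_neg hx0.le, ← div_eq_mul_inv, div_le_iff₀' (by positivity)]
    exact hx.le
  · have := Nat.lt_floor_add_one (b⁻¹ * x)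
    rw [← div_eq_inv_mul, div_lt_iff₀' hb0] at this
    rw [← div_eq_inv_mul]
    exact this.le

theorem tsum_compl_symIcc_le (hb : 1 < b) (hK : 0 < K)
    (hσ : ∀ k, σ k ^ 2 = K * (k.natAbs : ℝ) ^ (-b)) {N : ℕ} (hN : 1 ≤ N) :
    ∑' k, (if k ∈ symIcc N then 0 else σ k ^ 2) ≤
      2 * K * ((N : ℝ) ^ (-(b - 1)) / (b - 1)) := by
  have hb1 : 0 < b - 1 := by linarith
  refine Real.tsum_le_of_sum_le (fun k => by split_ifs <;> positivity) fun s => ?_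
  obtain ⟨J, hJ, hs⟩ := exists_subset_symIcc (s.erase 0) (Finset.notMem_erase 0 s) N
  have h0 : ∀ t : Finset ℤ, ∑ k ∈ t, (if k ∈ symIcc N then 0 else σ k ^ 2) =
      ∑ k ∈ t \ symIcc N, σ k ^ 2 := fun t => by
    rw [Finset.sum_ite, Finset.sum_const_zero, zero_add, Finset.filter_notMem_eq_sdiff]
  have h1 : ∑ k ∈ s, (if k ∈ symIcc N then 0 else σ k ^ 2) =
      ∑ k ∈ s.erase 0, (if k ∈ symIcc N then 0 else σ k ^ 2) := by
    refine (Finset.sum_erase _ ?_).symm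
    rw [hσ, Int.natAbs_zero, Nat.cast_zero, zero_rpow (by linarith), mul_zero, ite_self]
  calc _ ≤ ∑ k ∈ symIcc J \ symIcc N, σ k ^ 2 := by
        rw [h1, h0]
        exact Finset.sum_le_sum_of_subset_of_nonneg (Finset.sdiff_subset_sdiff hs subset_rfl)
          fun _ _ _ => sq_nonneg _
    _ ≤ _ := by
        rw [sum_sdiff_symIcc hσ hJ]
        gcongr
        have := sum_Ioc_rpow_le hb hN hJ
        rwa [neg_sub]

theorem exists_distortion_powerLaw_le (hb : 1 < b) (hK : 0 < K) (hu : Orthonormal ℝ u)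
    (hc : ∀ k, c k = σ k • u k) (hσ0 : ∀ k, k ≠ 0 → 0 < σ k)
    (hσ : ∀ k, σ k ^ 2 = K * (k.natAbs : ℝ) ^ (-b)) {N : ℕ} (hN : 1 ≤ N) {δ : ℝ} (hδ : 0 < δ)
    (hδ1 : δ ≤ 1) :
    ∃ α : Finset H, α.Nonempty ∧ log α.card ≤ (b + 4 * δ) * N + 2 ∧
      distortion gaussSeq (gaussSeries c) α ≤ 2 * K * ((N : ℝ) ^ (-(b - 1)) / (b - 1)) +
        ((1 + δ) * (K * (N : ℝ) ^ (-b)) * (2 * N) + exp (-(δ ^ 2 / 32 * (2 * N))) *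
        (2 * (K ^ 2 * (2 * N) ^ 2 * ∫ x, x ^ 4 ∂(gaussianReal 0 1)) + 4)) := by
  have hN0 : (0 : ℝ) < N := by exact_mod_cast hN
  set z := (b + 4 * δ) * N with hz
  have hcard : (Fintype.card (symIcc N) : ℝ) = 2 * N := by
    rw [Fintype.card_coe, card_symIcc]
  have hpos : ∀ j : symIcc N, 1 ≤ (j : ℤ).natAbs ∧ (j : ℤ).natAbs ≤ N := fun j =>
    ⟨Int.natAbs_pos.2 (mem_symIcc.1 j.2).1, (mem_symIcc.1 j.2).2⟩
  have hlow : ∀ j : symIcc N, K * (N : ℝ) ^ (-b) ≤ σ j ^ 2 := fun j => by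
    rw [hσ]
    gcongr K * ?_
    exact rpow_le_rpow_of_nonpos (by exact_mod_cast (hpos j).1) (by exact_mod_cast (hpos j).2)
      (by linarith)
  have hup : ∀ j : symIcc N, σ j ^ 2 ≤ K := fun j => by
    rw [hσ]
    refine mul_le_of_le_one_right hK.le (rpow_le_one_of_one_le_of_nonpos ?_ (by linarith))
    exact_mod_cast (hpos j).1
  have hexp : exp (∑ j : symIcc N, 1 / 2 * log (σ j ^ 2 / (K * (N : ℝ) ^ (-b))) +
      2 * δ * Fintype.card (symIcc N)) ≤ ⌈exp z⌉₊ := by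
    refine le_trans (exp_le_exp.2 ?_) (Nat.le_ceil _)
    rw [hcard, ← Finset.mul_sum,
      Finset.sum_coe_sort (symIcc N) fun k => log (σ k ^ 2 / (K * (N : ℝ) ^ (-b))),
      sum_log_symIcc hK hσ hN, hz]
    have := mul_le_mul_of_nonneg_left (sum_log_ge N) (by linarith : 0 ≤ b)
    linear_combination this
  obtain ⟨a, ha⟩ := exists_code_stdGauss (fun j : symIcc N => hσ0 j (mem_symIcc.1 j.2).1)
    (by positivity) hlow hδ hδ1 hup hexp
  obtain ⟨α, hα, hαc, hαd⟩ := exists_distortion_gaussSeries_le hu hc (symIcc N) a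
  refine ⟨α, hα, ?_, hαd.trans (add_le_add (tsum_compl_symIcc_le hb hK hσ hN) ?_)⟩
  · rw [Fintype.card_option, Fintype.card_fin] at hαc
    have h1 : (α.card : ℝ) ≤ ⌈exp z⌉₊ + 1 := by exact_mod_cast hαc
    have h2 := Nat.ceil_lt_add_one (exp_pos z).le
    have h3 : 1 ≤ exp z := one_le_exp (by positivity)
    have h4 : (3 : ℝ) ≤ exp 2 := by linarith [add_one_le_exp (2 : ℝ)]
    rw [log_le_iff_le_exp (by exact_mod_cast hα.card_pos), exp_add]
    nlinarith
  · rwa [hcard] at ha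

theorem eventually_exists_distortion_powerLaw_le (hb : 1 < b) (hK : 0 < K)
    (hu : Orthonormal ℝ u) (hc : ∀ k, c k = σ k • u k) (hσ0 : ∀ k, k ≠ 0 → 0 < σ k)
    (hσ : ∀ k, σ k ^ 2 = K * (k.natAbs : ℝ) ^ (-b)) {ℓ : ℝ}
    (hℓ : 2 * K * b ^ (b - 1) * (b / (b - 1)) < ℓ) :
    ∀ᶠ x : ℝ in atTop, ∃ α : Finset H, α.Nonempty ∧ log α.card ≤ x ∧
      distortion gaussSeq (gaussSeries c) α ≤ ℓ * x ^ (-(b - 1)) := by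
  have hb0 : 0 < b := by linarith
  have hb1 : 0 < b - 1 := by linarith
  obtain ⟨δ, hδ, hδ1, hδℓ⟩ : ∃ δ : ℝ, 0 < δ ∧ δ ≤ 1 ∧
      (b + 5 * δ) ^ (b - 1) * (2 * K * (1 / (b - 1) + (1 + δ) + 0)) < ℓ := by
    have h1 : Tendsto (fun δ : ℝ => (b + 5 * δ) ^ (b - 1) *
        (2 * K * (1 / (b - 1) + (1 + δ) + 0))) (nhds 0)
        (nhds ((b + 5 * 0) ^ (b - 1) * (2 * K * (1 / (b - 1) + (1 + 0) + 0)))) := by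
      refine ContinuousAt.tendsto (ContinuousAt.mul ?_ (by fun_prop))
      exact ContinuousAt.rpow_const (by fun_prop) (Or.inl (by linarith))
    have h2 : (b + 5 * 0) ^ (b - 1) * (2 * K * (1 / (b - 1) + (1 + 0) + 0)) < ℓ := by
      refine lt_of_eq_of_lt ?_ hℓ
      rw [mul_zero, add_zero]
      field_simp
      ring
    have h3 := (h1.mono_left (nhdsWithin_le_nhds (s := Set.Ioi 0))).eventually_lt_const h2
    obtain ⟨δ, h4, h5, h6⟩ := (h3.and ((eventually_mem_nhdsWithin).and
      (nhdsWithin_le_nhds (Iic_mem_nhds one_pos)))).exists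
    exact ⟨δ, h5, h6, h4⟩
  set M := ∫ x, x ^ 4 ∂(gaussianReal 0 1) with hM
  have hg : Tendsto (fun N : ℕ => 2 * K * (1 / (b - 1) + (1 + δ) +
      1 / (2 * K) * (8 * K ^ 2 * M * ((N : ℝ) ^ (b + 1) * exp (-(δ ^ 2 / 16) * N)) +
        4 * ((N : ℝ) ^ (b - 1) * exp (-(δ ^ 2 / 16) * N))))) atTop
      (nhds (2 * K * (1 / (b - 1) + (1 + δ) +
        1 / (2 * K) * (8 * K ^ 2 * M * 0 + 4 * 0)))) := by
    have h1 := fun s : ℝ => (tendsto_rpow_mul_exp_neg_mul_atTop_nhds_zero s (δ ^ 2 / 16)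
      (by positivity)).comp (tendsto_natCast_atTop_atTop (R := ℝ))
    exact (tendsto_const_nhds.add ((((h1 (b + 1)).const_mul _).add
      ((h1 (b - 1)).const_mul _)).const_mul _)).const_mul _
  have hbδ : 0 < b + 5 * δ := by positivity
  have h1 := tendsto_floor_rpow_mul (p := b - 1) (inv_pos.2 hbδ) hg
  have h2 : (b + 5 * δ)⁻¹ ^ (-(b - 1)) * (2 * K * (1 / (b - 1) + (1 + δ) +
        1 / (2 * K) * (8 * K ^ 2 * M * 0 + 4 * 0))) < ℓ := by
    rw [inv_rpow hbδ.le, rpow_neg hbδ.le, inv_inv]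
    simpa using hδℓ
  have hN : Tendsto (fun x : ℝ => ⌊(b + 5 * δ)⁻¹ * x⌋₊) atTop atTop :=
    tendsto_nat_floor_atTop.comp (tendsto_id.const_mul_atTop (inv_pos.2 hbδ))
  filter_upwards [h1.eventually_lt_const h2, hN.eventually_ge_atTop 1,
    hN.eventually_ge_atTop ⌈2 / δ⌉₊, eventually_gt_atTop 0] with x hx hN1 hNδ hx0
  set N := ⌊(b + 5 * δ)⁻¹ * x⌋₊ with hNdef
  have hN0 : (0 : ℝ) < N := by exact_mod_cast hN1
  obtain ⟨α, hα, hαc, hαd⟩ := exists_distortion_powerLaw_le hb hK hu hc hσ0 hσ hN1 hδ hδ1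
  refine ⟨α, hα, hαc.trans ?_, hαd.trans ?_⟩
  · have h3 : 2 / δ ≤ N := Nat.ceil_le.1 hNδ
    rw [div_le_iff₀ hδ] at h3
    have h4 : (N : ℝ) ≤ (b + 5 * δ)⁻¹ * x := Nat.floor_le (by positivity)
    rw [← div_eq_inv_mul, le_div_iff₀ hbδ] at h4
    linarith
  · rw [rpow_neg hx0.le, ← div_eq_mul_inv, le_div_iff₀' (by positivity)]
    refine le_trans (le_of_eq ?_) hx.le
    congr 1
    have e1 : (N : ℝ) ^ (-b) = (N : ℝ) ^ (-(b - 1)) / N := by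
      rw [← rpow_sub_one hN0.ne']
      congr 1
      ring
    have e2 : (N : ℝ) ^ (b + 1) = (N : ℝ) ^ (b - 1) * N ^ 2 := by
      rw [← rpow_natCast, ← rpow_add hN0]
      congr 1
      push_cast
      ring
    have e3 : (N : ℝ) ^ (-(b - 1)) * (N : ℝ) ^ (b - 1) = 1 := by
      rw [← rpow_add hN0]
      simp
    have e4 : exp (-(δ ^ 2 / 32 * (2 * N))) = exp (-(δ ^ 2 / 16) * N) := by
      congr 1
      ring
    rw [e1, e2, e4, ← hM]
    field_simp
    linear_combination (-(exp (-(δ ^ 2 * N / 16))) * (8 * K ^ 2 * M * N ^ 2 + 4) * (b - 1)) * e3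

end PowerLaw

section Rates

variable {Ω H : Type*} [MeasurableSpace Ω] {P : Measure Ω} [IsProbabilityMeasure P]
  [NormedAddCommGroup H] {p κ : ℝ}

open scoped Classical Pointwise in
theorem log_card_add_le {E : Type*} [AddCommGroup E] {α β : Finset E}
    (hα : α.Nonempty) (hβ : β.Nonempty) :
    log (α + β).card ≤ log α.card + log β.card := by
  have h1 : (0 : ℝ) < α.card := by exact_mod_cast hα.card_pos
  have h2 : (0 : ℝ) < β.card := by exact_mod_cast hβ.card_pos
  rw [← log_mul h1.ne' h2.ne']
  refine log_le_log (by exact_mod_cast (hα.add hβ).card_pos) ?_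
  exact_mod_cast Finset.card_add_le

open scoped Pointwise in
theorem eventually_exists_distortion_le_of_add {G R Z : Ω → H} (hG : AEStronglyMeasurable G P)
    (hG2 : Integrable (fun ω => ‖G ω‖ ^ 2) P) (hR : AEStronglyMeasurable R P)
    (hR2 : Integrable (fun ω => ‖R ω‖ ^ 2) P) (hZ : ∀ᵐ ω ∂P, Z ω = G ω + R ω)
    (hGd : ∀ ℓ, κ < ℓ → ∀ᶠ x : ℝ in atTop, ∃ α : Finset H, α.Nonempty ∧ log α.card ≤ x ∧
      distortion P G α ≤ ℓ * x ^ (-p))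
    (hRd : ∀ ε, 0 < ε → ∀ᶠ x : ℝ in atTop, ∃ α : Finset H, α.Nonempty ∧ log α.card ≤ x ∧
      distortion P R α ≤ ε * x ^ (-p)) {ℓ : ℝ} (hℓ : κ < ℓ) :
    ∀ᶠ x : ℝ in atTop, ∃ α : Finset H, α.Nonempty ∧ log α.card ≤ x ∧
      distortion P Z α ≤ ℓ * x ^ (-p) := by
  classical
  obtain ⟨m, hκm, hmℓ⟩ := exists_between hℓ
  obtain ⟨η, hη0, hη1, hη⟩ : ∃ η : ℝ, 0 < η ∧ η < 1 ∧ (1 + η) * (m * (1 - η) ^ (-p)) < ℓ := by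
    have h1 : Tendsto (fun η : ℝ => (1 + η) * (m * (1 - η) ^ (-p))) (nhds 0)
        (nhds ((1 + 0) * (m * (1 - 0) ^ (-p)))) := by
      refine ContinuousAt.tendsto (ContinuousAt.mul (by fun_prop)
        (ContinuousAt.mul (by fun_prop) ?_))
      exact ContinuousAt.rpow_const (by fun_prop) (Or.inl (by norm_num))
    have h2 := (h1.mono_left (nhdsWithin_le_nhds (s := Set.Ioi 0))).eventually_lt_const
      (by simpa using hmℓ : (1 + 0) * (m * (1 - 0) ^ (-p)) < ℓ)
    obtain ⟨η, h3, h4, h5⟩ := (h2.and (eventually_mem_nhdsWithin.and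
      (nhdsWithin_le_nhds (Iio_mem_nhds one_pos)))).exists
    exact ⟨η, h4, h5, h3⟩
  set Q := (1 + 1 / η) * η ^ (-p) with hQ
  have hQ0 : 0 < Q := by positivity
  set ε := (ℓ - (1 + η) * (m * (1 - η) ^ (-p))) / Q with hε
  have hε0 : 0 < ε := div_pos (by linarith) hQ0
  have hη' : 0 < 1 - η := by linarith
  filter_upwards [(tendsto_id.const_mul_atTop hη').eventually (hGd m hκm),
    (tendsto_id.const_mul_atTop hη0).eventually (hRd ε hε0), eventually_gt_atTop 0]
    with x ⟨α, hα, hαc, hαd⟩ ⟨β, hβ, hβc, hβd⟩ hx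
  refine ⟨α + β, hα.add hβ, (log_card_add_le hα hβ).trans ?_,
    (distortion_add_le hG hG2 hR hR2 hZ hα hβ hη0).trans ?_⟩
  · simp only [id] at hαc hβc
    linarith
  · simp only [id] at hαd hβd
    rw [mul_rpow hη'.le hx.le] at hαd
    rw [mul_rpow hη0.le hx.le] at hβd
    calc _ ≤ (1 + η) * (m * ((1 - η) ^ (-p) * x ^ (-p))) +
          (1 + 1 / η) * (ε * (η ^ (-p) * x ^ (-p))) := by gcongr
      _ = ((1 + η) * (m * (1 - η) ^ (-p)) + ε * Q) * x ^ (-p) := by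
          rw [hQ]
          ring
      _ = _ := by
          rw [hε, div_mul_cancel₀ _ hQ0.ne']
          ring

open scoped Pointwise in
theorem eventually_le_distortion_of_add {G R Z : Ω → H} (hZm : AEStronglyMeasurable Z P)
    (hZ2 : Integrable (fun ω => ‖Z ω‖ ^ 2) P) (hR : AEStronglyMeasurable R P)
    (hR2 : Integrable (fun ω => ‖R ω‖ ^ 2) P) (hG : ∀ᵐ ω ∂P, G ω = Z ω + R ω)
    (hGd : ∀ ℓ, ℓ < κ → ∀ᶠ x : ℝ in atTop, ∀ α : Finset H, α.Nonempty → log α.card ≤ x →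
      ℓ * x ^ (-p) ≤ distortion P G α)
    (hRd : ∀ ε, 0 < ε → ∀ᶠ x : ℝ in atTop, ∃ α : Finset H, α.Nonempty ∧ log α.card ≤ x ∧
      distortion P R α ≤ ε * x ^ (-p)) {ℓ : ℝ} (hℓ : ℓ < κ) :
    ∀ᶠ x : ℝ in atTop, ∀ α : Finset H, α.Nonempty → log α.card ≤ x →
      ℓ * x ^ (-p) ≤ distortion P Z α := by
  classical
  obtain ⟨m, hℓm, hmκ⟩ := exists_between hℓ
  obtain ⟨η, hη0, hη⟩ : ∃ η : ℝ, 0 < η ∧ (1 + η) * ℓ - m * (1 + η) ^ (-p) < 0 := by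
    have h1 : Tendsto (fun η : ℝ => (1 + η) * ℓ - m * (1 + η) ^ (-p)) (nhds 0)
        (nhds ((1 + 0) * ℓ - m * (1 + 0) ^ (-p))) := by
      refine ContinuousAt.tendsto (ContinuousAt.sub (by fun_prop)
        (ContinuousAt.mul (by fun_prop) ?_))
      exact ContinuousAt.rpow_const (by fun_prop) (Or.inl (by norm_num))
    have h2 := (h1.mono_left (nhdsWithin_le_nhds (s := Set.Ioi 0))).eventually_lt_const
      (by simpa using hℓm : (1 + 0) * ℓ - m * (1 + 0) ^ (-p) < 0)
    obtain ⟨η, h3, h4⟩ := (h2.and eventually_mem_nhdsWithin).exists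
    exact ⟨η, h4, h3⟩
  set Q := (1 + 1 / η) * η ^ (-p) with hQ
  have hQ0 : 0 < Q := by positivity
  set ε := (m * (1 + η) ^ (-p) - (1 + η) * ℓ) / Q with hε
  have hε0 : 0 < ε := div_pos (by linarith) hQ0
  have hη' : 0 < 1 + η := by linarith
  filter_upwards [(tendsto_id.const_mul_atTop hη').eventually (hGd m hmκ),
    (tendsto_id.const_mul_atTop hη0).eventually (hRd ε hε0), eventually_gt_atTop 0]
    with x hGx ⟨β, hβ, hβc, hβd⟩ hx α hα hαc
  simp only [id] at hGx hβc hβd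
  have h1 := hGx (α + β) (hα.add hβ) ((log_card_add_le hα hβ).trans (by linarith))
  have h2 := distortion_add_le hZm hZ2 hR hR2 hG hα hβ hη0
  rw [mul_rpow hη'.le hx.le] at h1
  rw [mul_rpow hη0.le hx.le] at hβd
  have h3 : (1 + 1 / η) * distortion P R β ≤
      (m * (1 + η) ^ (-p) - (1 + η) * ℓ) * x ^ (-p) := by
    calc _ ≤ (1 + 1 / η) * (ε * (η ^ (-p) * x ^ (-p))) := by gcongr
      _ = ε * Q * x ^ (-p) := by
          rw [hQ]
          ring
      _ = _ := by rw [hε, div_mul_cancel₀ _ hQ0.ne']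
  refine le_of_mul_le_mul_left ?_ hη'
  linarith

end Rates

theorem tendsto_quantErr_mul {Ω H : Type*} [MeasurableSpace Ω] {P : Measure Ω}
    [NormedAddCommGroup H] {p κ : ℝ} {Y : Ω → H} (hκ : 0 < κ)
    (hupper : ∀ ℓ, κ < ℓ → ∀ᶠ x : ℝ in atTop, ∃ α : Finset H, α.Nonempty ∧ log α.card ≤ x ∧
      distortion P Y α ≤ ℓ * x ^ (-p))
    (hlower : ∀ ℓ, ℓ < κ → ∀ᶠ x : ℝ in atTop, ∀ α : Finset H, α.Nonempty → log α.card ≤ x →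
      ℓ * x ^ (-p) ≤ distortion P Y α) :
    Tendsto (fun n : ℕ => quantErr P Y n * log n ^ (p / 2)) atTop
      (nhds (κ ^ (1 / 2 : ℝ))) := by
  have hlog : Tendsto (fun n : ℕ => log (n : ℝ)) atTop atTop :=
    tendsto_log_atTop.comp tendsto_natCast_atTop_atTop
  have hroot : ∀ {ℓ x : ℝ}, 0 ≤ ℓ → 0 < x →
      (ℓ * x ^ (-p)) ^ (1 / 2 : ℝ) * x ^ (p / 2) = ℓ ^ (1 / 2 : ℝ) := fun {ℓ x} hℓ hx => by
    rw [mul_rpow hℓ (by positivity), ← rpow_mul hx.le, mul_assoc, ← rpow_add hx]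
    ring_nf
    simp
  refine tendsto_order.2 ⟨fun a ha => ?_, fun a ha => ?_⟩
  · obtain ⟨ℓ, hℓa, hℓκ⟩ : ∃ ℓ, max a 0 ^ 2 < ℓ ∧ ℓ < κ := by
      refine exists_between ?_
      rw [← rpow_natCast, ← lt_rpow_inv_iff_of_pos (le_max_right _ _) hκ.le (by norm_num)]
      simpa using And.intro (by simpa using ha) (by positivity)
    have hℓ0 : 0 ≤ ℓ := (sq_nonneg _).trans hℓa.le
    filter_upwards [hlog.eventually (hlower ℓ hℓκ), hlog.eventually_gt_atTop 0,
      eventually_ge_atTop 1] with n hn hn0 hn1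
    have h1 : (ℓ * log n ^ (-p)) ^ (1 / 2 : ℝ) ≤ quantErr P Y n := by
      refine le_csInf ⟨_, {0}, Finset.singleton_nonempty 0, by simpa using hn1, rfl⟩ ?_
      rintro _ ⟨α, hα, hαn, rfl⟩
      refine rpow_le_rpow (by positivity) (hn α hα (log_le_log ?_ ?_)) (by norm_num)
      · exact_mod_cast hα.card_pos
      · exact_mod_cast hαn
    calc a ≤ max a 0 := le_max_left _ _
      _ < ℓ ^ (1 / 2 : ℝ) := by
          rw [one_div, lt_rpow_inv_iff_of_pos (le_max_right _ _) hℓ0 (by norm_num)]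
          exact_mod_cast hℓa
      _ ≤ _ := by
          rw [← hroot hℓ0 hn0]
          gcongr
  · have ha0 : 0 < a := lt_trans (by positivity) ha
    obtain ⟨ℓ, hκℓ, hℓa⟩ : ∃ ℓ, κ < ℓ ∧ ℓ < a ^ 2 := by
      refine exists_between ?_
      rw [← rpow_natCast, ← rpow_inv_lt_iff_of_pos hκ.le ha0.le (by norm_num)]
      simpa using ha
    have hℓ0 : 0 ≤ ℓ := hκ.le.trans hκℓ.le
    filter_upwards [hlog.eventually (hupper ℓ hκℓ), hlog.eventually_gt_atTop 0,
      eventually_ge_atTop 1] with n ⟨α, hα, hαc, hαd⟩ hn0 hn1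
    have h1 : quantErr P Y n ≤ (ℓ * log n ^ (-p)) ^ (1 / 2 : ℝ) := by
      refine le_trans (csInf_le ⟨0, ?_⟩ ⟨α, hα, ?_, rfl⟩)
        (rpow_le_rpow (distortion_nonneg Y α) hαd (by norm_num))
      · rintro _ ⟨β, -, -, rfl⟩
        exact rpow_nonneg (distortion_nonneg Y β) _
      · rw [log_le_log_iff (by exact_mod_cast hα.card_pos) (by exact_mod_cast hn1)] at hαc
        exact_mod_cast hαc
    calc _ ≤ (ℓ * log n ^ (-p)) ^ (1 / 2 : ℝ) * log n ^ (p / 2) := by gcongr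
      _ = ℓ ^ (1 / 2 : ℝ) := hroot hℓ0 hn0
      _ < a := by
          rw [one_div, rpow_inv_lt_iff_of_pos hℓ0 ha0.le (by norm_num)]
          exact_mod_cast hℓa

theorem orthonormal_cosWaveLp_fracPhase {T : ℝ} (hT : 0 < T) (β : ℝ) :
    Orthonormal ℝ fun k : ℤ => cosWaveLp T k (fracPhase β k) := by
  have hphase : ∀ k : ℤ, fracPhase β k + fracPhase β (-k) = π / 2 := fun k => by
    rw [fracPhase, fracPhase, Int.sign_neg]
    push_cast
    ring
  rw [orthonormal_iff_ite]
  intro k l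
  rw [inner_cosWaveLp hT]
  have h2 : (if k = -l then cos (fracPhase β k + fracPhase β l) else 0) = 0 := by
    split_ifs with h
    · rw [h, add_comm, hphase, cos_pi_div_two]
    · rfl
  rw [h2, add_zero]
  split_ifs with h
  · rw [h, sub_self, cos_zero]
  · rfl

theorem fracSing_sq {T β : ℝ} (hT : 0 < T) (k : ℤ) :
    fracSing T β k ^ 2 = Real.Gamma (β + 1) ^ 2 * (2 * π / T) ^ (-(2 * (β + 1))) *
      (k.natAbs : ℝ) ^ (-(2 * (β + 1))) := by
  have h1 : 2 * π * |(k : ℝ)| / T = 2 * π / T * |(k : ℝ)| := by ring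
  have h2 : ((k.natAbs : ℕ) : ℝ) = |(k : ℝ)| := by
    rw [Nat.cast_natAbs, Int.cast_abs]
  rw [fracSing, h1, h2, mul_pow, mul_rpow (by positivity) (abs_nonneg _), mul_pow,
    ← rpow_natCast ((2 * π / T) ^ (-(β + 1))), ← rpow_natCast (|(k : ℝ)| ^ (-(β + 1))),
    ← rpow_mul (by positivity), ← rpow_mul (abs_nonneg _), mul_assoc]
  push_cast
  ring_nf

theorem fracSing_pos {T β : ℝ} (hT : 0 < T) (hβ : -1 < β) {k : ℤ} (hk : k ≠ 0) :
    0 < fracSing T β k := by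
  have : 0 < |(k : ℝ)| := abs_pos.2 (by exact_mod_cast hk)
  have := Real.Gamma_pos_of_pos (by linarith : 0 < β + 1)
  rw [fracSing]
  positivity

/-- Two-sided distortion asymptotics of the Gaussian series of fractional integrals. -/
theorem exists_fracWaveLp_series {T β : ℝ} (hT : 0 < T) (hβ : -1 / 2 < β) {b κ : ℝ}
    (hb : b = 2 * (β + 1))
    (hκ : κ = 2 * (Real.Gamma (β + 1) ^ 2 * (2 * π / T) ^ (-b)) * b ^ (b - 1) * (b / (b - 1))) :
    ∃ v : lp (fun _ : ℤ => Lp ℝ 2 (intervalMeasure T)) 2,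
      (∀ k, v k = fracWaveLp T (by linarith : -1 < β) k) ∧
      (∀ ℓ, κ < ℓ → ∀ᶠ x : ℝ in atTop, ∃ α : Finset (Lp ℝ 2 (intervalMeasure T)),
        α.Nonempty ∧ log α.card ≤ x ∧
        distortion gaussSeq (gaussSeries v) α ≤ ℓ * x ^ (-(b - 1))) ∧
      ∀ ℓ, ℓ < κ → ∀ᶠ x : ℝ in atTop, ∀ α : Finset (Lp ℝ 2 (intervalMeasure T)),
        α.Nonempty → log α.card ≤ x →
        ℓ * x ^ (-(b - 1)) ≤ distortion gaussSeq (gaussSeries v) α := by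
  have hβ1 : -1 < β := by linarith
  have hb1 : 1 < b := by linarith
  have hΓ := Real.Gamma_pos_of_pos (by linarith : 0 < β + 1)
  set K := Real.Gamma (β + 1) ^ 2 * (2 * π / T) ^ (-b) with hKdef
  have hK : 0 < K := by positivity
  have hu := orthonormal_cosWaveLp_fracPhase hT β
  have hσ : ∀ k, fracSing T β k ^ 2 = K * (k.natAbs : ℝ) ^ (-b) := fun k => by
    rw [hKdef, hb, fracSing_sq hT]
  have hσ0 : ∀ k : ℤ, k ≠ 0 → 0 < fracSing T β k := fun k => fracSing_pos hT hβ1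
  have hsum : Summable fun k : ℤ => ‖fracSing T β k • cosWaveLp T k (fracPhase β k)‖ ^ 2 := by
    simp_rw [norm_smul, hu.1, mul_one, norm_eq_abs, sq_abs, hσ]
    refine Summable.mul_left _ ?_
    have h1 := (summable_nat_rpow (p := -b)).2 (by linarith)
    exact Summable.of_nat_of_neg (by simpa using h1) (by simpa using h1)
  set c := lpOf _ hsum with hc
  set r := lpOf _ (summable_norm_remWaveLp_sq hT hβ) with hr
  obtain ⟨γ, hγ0, hγ1, C, hC, hE⟩ := exists_remWaveLp_approx hT hβ
  have hrate := fun ε (hε : 0 < ε) =>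
    exists_crude_code_rate r hγ0 hγ1 hC hE (by linarith : 0 ≤ b - 1) hε
  have hrate' := fun ε (hε : 0 < ε) =>
    exists_crude_code_rate (-r) hγ0 hγ1 hC (fun m => by
      obtain ⟨E, h1, h2, h3⟩ := hE m
      refine ⟨E, h1, h2, fun k => ?_⟩
      obtain ⟨q, hq, hqk⟩ := h3 k
      refine ⟨-q, E.neg_mem hq, ?_⟩
      rw [lp.coeFn_neg, Pi.neg_apply, ← neg_sub_neg, neg_neg, neg_neg, norm_sub_rev]
      exact hqk) (by linarith : 0 ≤ b - 1) hε
  have hadd : ∀ w w' : lp (fun _ : ℤ => Lp ℝ 2 (intervalMeasure T)) 2,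
      ∀ᵐ ω ∂gaussSeq, gaussSeries (w + w') ω = gaussSeries w ω + gaussSeries w' ω :=
    fun w w' => by
      rw [map_add]
      exact Lp.coeFn_add _ _
  have hm := fun w : lp (fun _ : ℤ => Lp ℝ 2 (intervalMeasure T)) 2 =>
    Lp.aestronglyMeasurable (gaussSeries w)
  refine ⟨c - r, fun k => ?_, fun ℓ hℓ => ?_, fun ℓ hℓ => ?_⟩
  · rw [lp.coeFn_sub, Pi.sub_apply, hc, hr, lpOf_apply, lpOf_apply, remWaveLp, sub_sub_cancel]
  · refine eventually_exists_distortion_le_of_add (hm c) (integrable_norm_sq_gaussSeries c)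
      (hm (-r)) (integrable_norm_sq_gaussSeries (-r)) ?_ (fun ℓ hℓ => ?_) hrate' hℓ
    · rw [sub_eq_add_neg]
      exact hadd c (-r)
    · exact eventually_exists_distortion_powerLaw_le hb1 hK hu (fun _ => rfl) hσ0 hσ
        (hκ ▸ hℓ)
  · refine eventually_le_distortion_of_add (hm (c - r)) (integrable_norm_sq_gaussSeries (c - r))
      (hm r) (integrable_norm_sq_gaussSeries r) (G := gaussSeries c) ?_ (fun ℓ hℓ => ?_) hrate hℓ
    · have := hadd (c - r) r
      rwa [sub_add_cancel] at this
    · exact eventually_le_distortion_powerLaw hb1 hK hu (fun _ => rfl) hσ0 hσ (hκ ▸ hℓ)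

theorem rate_constant_eq {T ρ : ℝ} (hT : 0 < T) (hρ : 0 < ρ) :
    (2 * (Real.Gamma (ρ + 1 / 2) ^ 2 * (2 * π / T) ^ (-(2 * ρ + 1))) *
      (2 * ρ + 1) ^ (2 * ρ + 1 - 1) * ((2 * ρ + 1) / (2 * ρ + 1 - 1))) ^ (1 / 2 : ℝ) =
    T ^ (ρ + 1 / 2) * π ^ (-(ρ + 1 / 2)) * (ρ + 1 / 2) ^ ρ *
      ((2 * ρ + 1) / (2 * ρ)) ^ ((1 : ℝ) / 2) * Real.Gamma (ρ + 1 / 2) := by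
  have hΓ := Real.Gamma_pos_of_pos (by linarith : 0 < ρ + 1 / 2)
  have hsq : ∀ {a s : ℝ}, 0 < a → (a ^ s) ^ 2 = a ^ (2 * s) := fun {a s} ha => by
    rw [← rpow_natCast, ← rpow_mul ha.le]
    push_cast
    ring_nf
  have hb : 2 * ρ + 1 - 1 = 2 * ρ := by ring
  have h2 : (2 : ℝ) ^ (-(2 * ρ + 1)) = (2 ^ (2 * ρ))⁻¹ / 2 := by
    rw [← rpow_neg two_pos.le, ← rpow_sub_one two_ne_zero]
    congr 1
    ring
  have hT' : ((T : ℝ) ^ (-(2 * ρ + 1)))⁻¹ = T ^ (2 * ρ + 1) := by rw [rpow_neg hT.le, inv_inv]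
  rw [hb, one_div, rpow_inv_eq (by positivity) (by positivity) (by norm_num), rpow_two, mul_pow,
    mul_pow, mul_pow, mul_pow, hsq hT, hsq pi_pos, hsq (by positivity), hsq (by positivity),
    div_rpow (by positivity) hT.le, mul_rpow (by positivity) pi_pos.le, div_eq_mul_inv _ (T ^ _),
    hT', h2, mul_inv_cancel₀ two_ne_zero, rpow_one,
    (by ring : 2 * (ρ + 2⁻¹) = 2 * ρ + 1), (by ring : 2 * -(ρ + 2⁻¹) = -(2 * ρ + 1)),
    (by ring : ρ + 2⁻¹ = (2 * ρ + 1) / 2), div_rpow (by positivity) two_pos.le]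
  field_simp

/-- High-resolution formula for the Riemann–Liouville process `X^ρ`, viewed as a centered
Gaussian random vector in `L²([0,T], dt)`:
`e_n(X^ρ) ∼ T^{ρ+1/2} π^{-(ρ+1/2)} (ρ+1/2)^ρ ((2ρ+1)/(2ρ))^{1/2} Γ(ρ+1/2) (log n)^{-ρ}`. -/
theorem riemannLiouville_quantization_asymptotics
    {Ω : Type*} [MeasurableSpace Ω] (P : Measure Ω) [IsProbabilityMeasure P]
    (T ρ : ℝ) (hT : 0 < T) (hρ : 0 < ρ)
    (μ : Measure ℝ) (hμ : μ = Measure.restrict MeasureTheory.volume (Set.Icc (0 : ℝ) T))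
    -- the Riemann–Liouville process `X^ρ`, pathwise continuous
    (X : Ω → ℝ → ℝ)
    (hXmeas : ∀ t : ℝ, Measurable fun ω => X ω t)
    (hXcont : ∀ ω, ContinuousOn (X ω) (Set.Icc 0 T))
    -- `X^ρ` is a centered Gaussian process
    (hXgauss : ∀ (k : ℕ) (t : Fin k → ℝ) (c : Fin k → ℝ), ∃ v : NNReal,
      Measure.map (fun ω => ∑ i, c i * X ω (t i)) P = gaussianReal 0 v)
    -- with the Riemann–Liouville covariance function
    (hXcov : ∀ s ∈ Set.Icc (0 : ℝ) T, ∀ t ∈ Set.Icc (0 : ℝ) T,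
      ∫ ω, X ω s * X ω t ∂P
        = ∫ r in (0 : ℝ)..(min s t), (t - r) ^ (ρ - 1/2) * (s - r) ^ (ρ - 1/2))
    -- `Y` is `X^ρ` regarded as a random vector in `H = L²([0,T], dt)`
    (Y : Ω → Lp ℝ 2 μ)
    (hY : ∀ ω, (Y ω : ℝ → ℝ) =ᵐ[μ] X ω) :
    Tendsto (fun n : ℕ => quantErr P Y n /
        (T ^ (ρ + 1/2) * π ^ (-(ρ + 1/2)) * (ρ + 1/2) ^ ρ
          * ((2 * ρ + 1) / (2 * ρ)) ^ ((1 : ℝ)/2) * Real.Gamma (ρ + 1/2)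
          * Real.log n ^ (-ρ)))
      atTop (nhds 1) := by
  obtain rfl : μ = intervalMeasure T := hμ
  have hβ : -1 / 2 < ρ - 1 / 2 := by linarith
  have hΓ := Real.Gamma_pos_of_pos (by linarith : 0 < ρ + 1 / 2)
  let _ : MeasurableSpace (Lp ℝ 2 (intervalMeasure T)) := borel _
  have : BorelSpace (Lp ℝ 2 (intervalMeasure T)) := ⟨rfl⟩
  obtain ⟨v, hv, hupper, hlower⟩ := exists_fracWaveLp_series hT hβ rfl rfl
  obtain ⟨hYm, hmap⟩ := map_process_eq hT hXmeas hXcont hβ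
    (integral_cexp_sum hXmeas hXgauss hβ fun s hs t ht => by
      rw [inner_kerLp hβ hs ht, hXcov s hs t ht]) hY v hv
  have hdist : ∀ α : Finset (Lp ℝ 2 (intervalMeasure T)), α.Nonempty →
      distortion P Y α = distortion gaussSeq (gaussSeries v) α := fun α hα =>
    have : Fact ((2 : ENNReal) ≠ ⊤) := ⟨by norm_num⟩
    distortion_congr_map hYm.aemeasurable
      (Lp.aestronglyMeasurable (gaussSeries v)).aemeasurable hmap hα
  have hb : 2 * (ρ - 1 / 2 + 1) = 2 * ρ + 1 := by ring
  have hβρ : ρ - 1 / 2 + 1 = ρ + 1 / 2 := by ring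
  rw [hb, hβρ] at hupper hlower
  have hκ : 0 < 2 * (Real.Gamma (ρ + 1 / 2) ^ 2 * (2 * π / T) ^ (-(2 * ρ + 1))) *
      (2 * ρ + 1) ^ (2 * ρ + 1 - 1) * ((2 * ρ + 1) / (2 * ρ + 1 - 1)) := by
    have : 0 < 2 * ρ + 1 - 1 := by linarith
    positivity
  have hlim := tendsto_quantErr_mul (P := P) (Y := Y) hκ
    (fun ℓ hℓ => (hupper ℓ hℓ).mono fun x ⟨α, hα, hαc, hαd⟩ =>
      ⟨α, hα, hαc, (hdist α hα).trans_le hαd⟩)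
    (fun ℓ hℓ => (hlower ℓ hℓ).mono fun x hx α hα hαc =>
      (hx α hα hαc).trans_eq (hdist α hα).symm)
  rw [rate_constant_eq hT hρ] at hlim
  set A := T ^ (ρ + 1 / 2) * π ^ (-(ρ + 1 / 2)) * (ρ + 1 / 2) ^ ρ *
    ((2 * ρ + 1) / (2 * ρ)) ^ ((1 : ℝ) / 2) * Real.Gamma (ρ + 1 / 2) with hA
  have hA0 : 0 < A := by positivity
  have h1 := hlim.div_const A
  rw [div_self hA0.ne'] at h1
  refine h1.congr fun n => ?_
  rw [rpow_neg (log_natCast_nonneg n), (by ring : (2 * ρ + 1 - 1) / 2 = ρ), ← div_eq_mul_inv,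
    div_div_eq_mul_div]
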